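/- Let q be a prime power and 𝔽_q the finite field with q elements. Let G ∈ 𝔽_q[x_1,…,x_n] (n ≥ 3) be an absolutely irreducible homogeneous polynomial of total degree d ≥ 1, and let H ∈ 𝔽_q[x_1,…,x_n] be a homogeneous polynomial of total degree e ≥ 1 that is not divisible by G. Set α = (d−1)(d−2) and β = 5·d^{13/3} + d(d+e−1) (as real numbers). If q > (1/4)·(α + √(α² + 4β))², then there exists a point x ∈ 𝔽_q^n such that G(x) = 0, ∇G(x) ≠ 0, and H(x) ≠ 0. -/

import Mathlib

namespace PlaneCurve

open Polynomial

section BiDegree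

variable {A : Type*} [CommRing A]

/-- A bivariate polynomial has total degree at most `n`. -/
def BiDeg (n : ℕ) (P : A[X][X]) : Prop :=
  ∀ i, P.coeff i ≠ 0 → (P.coeff i).natDegree + i ≤ n

theorem BiDeg.zero (n : ℕ) : BiDeg n (0 : A[X][X]) := fun i h => by simp at h

theorem BiDeg.mono {n m : ℕ} {P : A[X][X]} (h : BiDeg n P) (hnm : n ≤ m) : BiDeg m P :=
  fun i hi => (h i hi).trans hnm

theorem BiDeg.add {n : ℕ} {P Q : A[X][X]} (hP : BiDeg n P) (hQ : BiDeg n Q) :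
    BiDeg n (P + Q) := by
  intro i hi
  rw [coeff_add] at hi ⊢
  by_cases h1 : P.coeff i = 0
  · rw [h1, zero_add] at hi ⊢
    exact hQ i hi
  by_cases h2 : Q.coeff i = 0
  · rw [h2, add_zero]
    exact hP i h1
  have := natDegree_add_le (P.coeff i) (Q.coeff i)
  have := hP i h1
  have := hQ i h2
  omega

theorem BiDeg.neg {n : ℕ} {P : A[X][X]} (hP : BiDeg n P) : BiDeg n (-P) := by
  intro i hi
  rw [coeff_neg, neg_ne_zero] at hi
  rw [coeff_neg, natDegree_neg]
  exact hP i hi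

theorem BiDeg.sub {n : ℕ} {P Q : A[X][X]} (hP : BiDeg n P) (hQ : BiDeg n Q) :
    BiDeg n (P - Q) := sub_eq_add_neg P Q ▸ hP.add hQ.neg

theorem BiDeg.sum {ι : Type*} {n : ℕ} (s : Finset ι) (P : ι → A[X][X])
    (h : ∀ i ∈ s, BiDeg n (P i)) : BiDeg n (∑ i ∈ s, P i) := by
  classical
  induction s using Finset.induction_on with
  | empty => simpa using BiDeg.zero n
  | insert a s ha ih =>
    rw [Finset.sum_insert ha]
    exact (h a (by simp)).add (ih fun i hi => h i (by simp [hi]))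

theorem BiDeg.monomial {a b n : ℕ} (c : A) (h : a + b ≤ n) :
    BiDeg n (Polynomial.monomial b (Polynomial.monomial a c)) := by
  intro i hi
  rw [coeff_monomial] at hi ⊢
  split_ifs at hi ⊢ with hb
  · have := natDegree_monomial_le c (m := a)
    omega
  · exact absurd rfl hi

theorem BiDeg.mul {n m : ℕ} {P Q : A[X][X]} (hP : BiDeg n P) (hQ : BiDeg m Q) :
    BiDeg (n + m) (P * Q) := by
  intro i hi
  rw [coeff_mul] at hi ⊢
  have key : ∀ s : Finset (ℕ × ℕ), (∀ x ∈ s, x.1 + x.2 = i) →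
      ∑ x ∈ s, P.coeff x.1 * Q.coeff x.2 ≠ 0 →
      (∑ x ∈ s, P.coeff x.1 * Q.coeff x.2).natDegree + i ≤ n + m := by
    intro s hs h0
    obtain ⟨x, hx, hx0⟩ := Finset.exists_ne_zero_of_sum_ne_zero h0
    have hle : ∀ x ∈ s, P.coeff x.1 * Q.coeff x.2 ≠ 0 →
        (P.coeff x.1 * Q.coeff x.2).natDegree + i ≤ n + m := by
      intro x hx hx0
      have h1 := hP x.1 (left_ne_zero_of_mul hx0)
      have h2 := hQ x.2 (right_ne_zero_of_mul hx0)
      have := natDegree_mul_le (p := P.coeff x.1) (q := Q.coeff x.2)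
      have := hs x hx
      omega
    have hi : i ≤ n + m := by have := hle x hx hx0; omega
    have : (∑ x ∈ s, P.coeff x.1 * Q.coeff x.2).natDegree ≤ n + m - i := by
      apply natDegree_sum_le_of_forall_le
      intro y hy
      by_cases hy0 : P.coeff y.1 * Q.coeff y.2 = 0
      · simp [hy0]
      · have := hle y hy hy0
        omega
    omega
  exact key _ (fun x hx => by simpa using hx) hi

theorem BiDeg.one : BiDeg 0 (1 : A[X][X]) := by
  have := BiDeg.monomial (A := A) (a := 0) (b := 0) (n := 0) 1 (by simp)
  simpa using this

theorem BiDeg.pow {n : ℕ} {P : A[X][X]} (hP : BiDeg n P) (k : ℕ) : BiDeg (k * n) (P ^ k) := by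
  induction k with
  | zero => simpa using BiDeg.one
  | succ k ih =>
    rw [pow_succ, add_mul, one_mul]
    exact ih.mul hP

theorem biDeg_X : BiDeg 1 (X : A[X][X]) := by
  have := BiDeg.monomial (A := A) (a := 0) (b := 1) (n := 1) 1 (by simp)
  simpa [Polynomial.X] using this

theorem biDeg_C_X : BiDeg 1 (C X : A[X][X]) := by
  have := BiDeg.monomial (A := A) (a := 1) (b := 0) (n := 1) 1 (by simp)
  simpa [Polynomial.X] using this

theorem biDeg_C {n : ℕ} {a : A[X]} (h : a.natDegree ≤ n) : BiDeg n (C a) := by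
  intro i hi
  rw [coeff_C] at hi ⊢
  split_ifs at hi ⊢ with hb
  · omega
  · exact absurd rfl hi

theorem BiDeg.natDegree_le {n : ℕ} {P : A[X][X]} (hP : BiDeg n P) : P.natDegree ≤ n := by
  by_cases h : P = 0
  · simp [h]
  · have := hP P.natDegree (by simpa using h)
    omega

theorem BiDeg.derivative {n : ℕ} {P : A[X][X]} (hP : BiDeg n P) :
    BiDeg (n - 1) (derivative P) := by
  intro i hi
  rw [coeff_derivative] at hi ⊢
  have := hP (i + 1) (left_ne_zero_of_mul hi)
  have h2 : (((i : A[X]) + 1)).natDegree = 0 := by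
    have : ((i : A[X]) + 1) = Polynomial.C ((i : A) + 1) := by simp
    rw [this, natDegree_C]
  have := natDegree_mul_le (p := P.coeff (i + 1)) (q := ((i : A[X]) + 1))
  omega

theorem BiDeg.modByMonic [Nontrivial A] {d n : ℕ} {f h : A[X][X]} (hf : f.Monic)
    (hd : f.natDegree = d)
    (hfd : BiDeg d f) (hh : BiDeg n h) : BiDeg n (h %ₘ f) := by
  suffices H : ∃ r q : A[X][X], r + f * q = h ∧ r.degree < f.degree ∧ BiDeg n r by
    obtain ⟨r, q, h1, h2, h3⟩ := H
    rwa [(div_modByMonic_unique q r hf ⟨h1, h2⟩).2]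
  induction hk : h.natDegree using Nat.strong_induction_on generalizing h with
  | _ k ih =>
    by_cases hlt : h.degree < f.degree
    · exact ⟨h, 0, by simp, hlt, hh⟩
    have h0 : h ≠ 0 := by
      rintro rfl
      exact hlt (by simpa [bot_lt_iff_ne_bot] using hf.ne_zero)
    rw [not_lt] at hlt
    have hdk : d ≤ k := by
      rw [← hd, ← hk]; exact natDegree_le_natDegree hlt
    set t : A[X][X] := Polynomial.C h.leadingCoeff * Polynomial.X ^ (k - d) with ht
    have htd : BiDeg (n - d) t := by
      have hlc := hh k (by rw [← hk]; simpa using h0)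
      rw [ht, C_mul_X_pow_eq_monomial]
      intro i hi
      rw [coeff_monomial] at hi ⊢
      split_ifs at hi ⊢ with hb
      · rw [leadingCoeff, hk]
        omega
      · exact absurd rfl hi
    have hnd : d ≤ n := hdk.trans (hk ▸ hh.natDegree_le)
    have hsub : BiDeg n (h - f * t) := hh.sub ((hfd.mul htd).mono (by omega))
    by_cases hs : h - f * t = 0
    · exact ⟨0, t, by rw [zero_add]; exact (sub_eq_zero.1 hs).symm,
        by simpa [bot_lt_iff_ne_bot] using hf.ne_zero, BiDeg.zero n⟩
    have hdeg : (h - f * t).natDegree < k := by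
      have := div_wf_lemma ⟨hlt, h0⟩ hf
      rw [hk, hd] at this
      have h3 := natDegree_lt_natDegree hs this
      rwa [hk] at h3
    obtain ⟨r, q, h1, h2, h3⟩ := ih _ hdeg hsub rfl
    exact ⟨r, q + t, by rw [mul_add, ← add_assoc, h1]; ring, h2, h3⟩

end BiDegree

section Norm

variable {κ : Type*} [CommRing κ] [Nontrivial κ] {f : κ[X][X]} {d : ℕ}

theorem natDegree_det_le_of_weights {m n : ℕ} (M : Matrix (Fin m) (Fin m) κ[X])
    (h : ∀ i j, M i j ≠ 0 → (M i j).natDegree + i ≤ n + j) : M.det.natDegree ≤ n * m := by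
  have hdet : M.det = ∑ σ : Equiv.Perm (Fin m), Equiv.Perm.sign σ • ∏ i, M (σ i) i :=
    Matrix.det_apply M
  rw [hdet]
  apply natDegree_sum_le_of_forall_le
  intro σ _
  by_cases h0 : ∃ i, M (σ i) i = 0
  · obtain ⟨i, hi⟩ := h0
    rw [Finset.prod_eq_zero (f := fun i => M (σ i) i) (Finset.mem_univ i) hi]
    simp
  push Not at h0
  have h1 : (Equiv.Perm.sign σ • ∏ i, M (σ i) i).natDegree ≤ (∏ i, M (σ i) i).natDegree := by
    rcases Int.units_eq_one_or (Equiv.Perm.sign σ) with h | h <;> simp [h]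
  refine h1.trans ((natDegree_prod_le _ (fun i => M (σ i) i)).trans ?_)
  have h2 : ∑ i, ((M (σ i) i).natDegree + (σ i : ℕ)) ≤ ∑ i : Fin m, (n + (i : ℕ)) :=
    Finset.sum_le_sum fun i _ => h _ _ (h0 i)
  rw [Finset.sum_add_distrib, Finset.sum_add_distrib,
    Equiv.sum_comp σ (fun i : Fin m => (i : ℕ))] at h2
  simp only [Finset.sum_const, Finset.card_univ, Fintype.card_fin, smul_eq_mul] at h2
  rw [mul_comm]
  show ∑ i, (M (σ i) i).natDegree ≤ _
  omega

theorem natDegree_norm_le (hf : f.Monic) (hd : f.natDegree = d) (hfd : BiDeg d f) {n : ℕ}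
    {h : κ[X][X]} (hh : BiDeg n h) :
    (Algebra.norm κ[X] (AdjoinRoot.mk f h)).natDegree ≤ n * d := by
  rw [Algebra.norm_eq_matrix_det (AdjoinRoot.powerBasisAux' hf), ← hd]
  apply natDegree_det_le_of_weights
  intro i j hij
  rw [Algebra.leftMulMatrix_eq_repr_mul, AdjoinRoot.powerBasisAux'_repr_apply_to_fun] at hij ⊢
  have hb : AdjoinRoot.powerBasisAux' hf j = AdjoinRoot.mk f (X ^ (j : ℕ)) := by
    rw [map_pow, AdjoinRoot.mk_X]
    exact (AdjoinRoot.powerBasis' hf).basis_eq_pow j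
  rw [hb, ← map_mul, AdjoinRoot.modByMonicHom_mk] at hij ⊢
  have h1 : BiDeg (n + j) (h * X ^ (j : ℕ)) := hh.mul (by simpa using (biDeg_X (A := κ)).pow j)
  exact BiDeg.modByMonic hf hd hfd h1 i hij

end Norm

end PlaneCurve

namespace PlaneCurve

open Polynomial

section Bezout

variable {κ : Type*} [Field κ] {f : κ[X][X]} {d : ℕ}

theorem finite_quotient_span {S ι : Type*} [CommRing S] [IsDomain S] [Finite ι] [Algebra κ[X] S]
    [Algebra κ S] [IsScalarTower κ κ[X] S] (b : Module.Basis ι κ[X] S) {s : S} (hs : s ≠ 0) :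
    Module.Finite κ (S ⧸ Ideal.span ({s} : Set S)) := by
  have := Fintype.ofFinite ι
  have h := Ideal.span_singleton_eq_bot.not.2 hs
  exact Module.Finite.equiv
    ((Ideal.quotientEquivPiSpan (Ideal.span {s}) b h).restrictScalars κ).symm

theorem isDomain_adjoinRoot (hirr : Irreducible f) : IsDomain (AdjoinRoot f) :=
  AdjoinRoot.isDomain_of_prime hirr.prime

theorem finrank_quotient_le (hf : f.Monic) (hd : f.natDegree = d) (hfd : BiDeg d f)
    (hirr : Irreducible f) {n : ℕ} {h : κ[X][X]} (hh : BiDeg n h) (h0 : AdjoinRoot.mk f h ≠ 0) :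
    Module.Finite κ (AdjoinRoot f ⧸ Ideal.span {AdjoinRoot.mk f h}) ∧
    Module.finrank κ (AdjoinRoot f ⧸ Ideal.span {AdjoinRoot.mk f h}) ≤ n * d := by
  have := isDomain_adjoinRoot hirr
  refine ⟨finite_quotient_span (AdjoinRoot.powerBasis' hf).basis h0, ?_⟩
  rw [finrank_quotient_span_eq_natDegree_norm (AdjoinRoot.powerBasis' hf).basis h0]
  exact natDegree_norm_le hf hd hfd hh

/-- The evaluation at a point of the curve `f = 0`. -/
noncomputable def evalPt (f : κ[X][X]) (P : κ × κ) (hP : f.evalEval P.1 P.2 = 0) :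
    AdjoinRoot f →ₐ[κ] κ :=
  { AdjoinRoot.lift (evalRingHom P.1) P.2 (by
      rw [← coe_evalEvalRingHom, evalEvalRingHom_eq] at hP
      exact hP) with
    commutes' := fun r => by
      have : algebraMap κ (AdjoinRoot f) r = AdjoinRoot.of f (C r) := rfl
      rw [this]
      exact (AdjoinRoot.lift_of _).trans (by simp) }

theorem evalPt_mk (P : κ × κ) (hP : f.evalEval P.1 P.2 = 0) (h : κ[X][X]) :
    evalPt f P hP (AdjoinRoot.mk f h) = h.evalEval P.1 P.2 := by
  have hP' : f.eval₂ (evalRingHom P.1) P.2 = 0 := by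
    rw [← coe_evalEvalRingHom, evalEvalRingHom_eq] at hP
    exact hP
  have : evalPt f P hP (AdjoinRoot.mk f h) = h.eval₂ (evalRingHom P.1) P.2 :=
    AdjoinRoot.lift_mk hP' h
  rw [this, ← coe_evalEvalRingHom, evalEvalRingHom_eq, coe_eval₂RingHom]

theorem finite_and_ncard_le_of_evalPt (s : AdjoinRoot f)
    [Module.Finite κ (AdjoinRoot f ⧸ Ideal.span {s})] :
    {P : κ × κ | ∃ hP : f.evalEval P.1 P.2 = 0, evalPt f P hP s = 0}.Finite ∧
    {P : κ × κ | ∃ hP : f.evalEval P.1 P.2 = 0, evalPt f P hP s = 0}.ncard ≤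
      Module.finrank κ (AdjoinRoot f ⧸ Ideal.span {s}) := by
  set T := {P : κ × κ | ∃ hP : f.evalEval P.1 P.2 = 0, evalPt f P hP s = 0}
  let F : T → (AdjoinRoot f ⧸ Ideal.span {s} →ₐ[κ] κ) := fun P =>
    Ideal.Quotient.liftₐ (Ideal.span {s}) (evalPt f P.1 P.2.1) (by
      intro a ha
      obtain ⟨b, rfl⟩ := Ideal.mem_span_singleton.1 ha
      rw [map_mul, P.2.2, zero_mul])
  have hF : Function.Injective F := by
    intro P Q h
    have hx := DFunLike.congr_fun h (Ideal.Quotient.mk _ (AdjoinRoot.mk f (C X)))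
    have hy := DFunLike.congr_fun h (Ideal.Quotient.mk _ (AdjoinRoot.mk f X))
    have hx' : evalPt f P.1 P.2.1 (AdjoinRoot.mk f (C X)) =
      evalPt f Q.1 Q.2.1 (AdjoinRoot.mk f (C X)) := hx
    have hy' : evalPt f P.1 P.2.1 (AdjoinRoot.mk f X) =
      evalPt f Q.1 Q.2.1 (AdjoinRoot.mk f X) := hy
    rw [evalPt_mk, evalPt_mk] at hx' hy'
    simp only [evalEval_C, eval_X, evalEval_X] at hx' hy'
    exact Subtype.ext (Prod.ext hx' hy')
  have hfin : Finite T := Finite.of_injective F hF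
  refine ⟨hfin, ?_⟩
  rw [← Nat.card_coe_set_eq]
  exact (Nat.card_le_card_of_injective F hF).trans (card_algHom_le_finrank _ _ _)

theorem finite_and_ncard_zeros_le (hf : f.Monic) (hd : f.natDegree = d) (hfd : BiDeg d f)
    (hirr : Irreducible f) {n : ℕ} {h : κ[X][X]} (hh : BiDeg n h) (h0 : ¬ f ∣ h) :
    {P : κ × κ | f.evalEval P.1 P.2 = 0 ∧ h.evalEval P.1 P.2 = 0}.Finite ∧
    {P : κ × κ | f.evalEval P.1 P.2 = 0 ∧ h.evalEval P.1 P.2 = 0}.ncard ≤ n * d := by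
  obtain ⟨h1, h2⟩ := finrank_quotient_le hf hd hfd hirr hh
    (fun h => h0 (AdjoinRoot.mk_eq_zero.1 h))
  obtain ⟨h3, h4⟩ := finite_and_ncard_le_of_evalPt (AdjoinRoot.mk f h)
  have : {P : κ × κ | f.evalEval P.1 P.2 = 0 ∧ h.evalEval P.1 P.2 = 0} =
      {P : κ × κ | ∃ hP : f.evalEval P.1 P.2 = 0, evalPt f P hP (AdjoinRoot.mk f h) = 0} := by
    ext P
    simp only [Set.mem_ofPred_eq]
    constructor
    · rintro ⟨a, b⟩
      exact ⟨a, by rwa [evalPt_mk]⟩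
    · rintro ⟨a, b⟩
      exact ⟨a, by rwa [evalPt_mk] at b⟩
  rw [this]
  exact ⟨h3, h4.trans h2⟩

/-- The order of vanishing of an element along a formal branch is at most the colength of the
ideal it generates. -/
theorem le_finrank_of_X_pow_dvd {S : Type*} [CommRing S] [Algebra κ S]
    (φ : S →ₐ[κ] PowerSeries κ) (τ : S) (hτ : φ τ = PowerSeries.X) (s : S)
    [Module.Finite κ (S ⧸ Ideal.span {s})] {n : ℕ} (hn : PowerSeries.X ^ n ∣ φ s) :
    n ≤ Module.finrank κ (S ⧸ Ideal.span {s}) := by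
  have hli : LinearIndependent κ
      (fun i : Fin n => Ideal.Quotient.mk (Ideal.span {s}) (τ ^ (i : ℕ))) := by
    rw [Fintype.linearIndependent_iff]
    intro c hc i
    have h1 : Ideal.Quotient.mk (Ideal.span {s}) (∑ i : Fin n, c i • τ ^ (i : ℕ)) = 0 := by
      rw [map_sum]
      rw [← hc]
      rfl
    rw [Ideal.Quotient.eq_zero_iff_mem, Ideal.mem_span_singleton] at h1
    have h2 := hn.trans (map_dvd φ h1)
    rw [PowerSeries.X_pow_dvd_iff] at h2
    have h3 := h2 i i.2
    rw [map_sum, map_sum, Finset.sum_eq_single i] at h3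
    · rw [map_smul, map_pow, hτ] at h3
      simpa [PowerSeries.coeff_X_pow] using h3
    · intro j _ hj
      rw [map_smul, map_pow, hτ]
      have : (i : ℕ) ≠ j := fun h => hj (Fin.ext h.symm)
      simp [PowerSeries.coeff_X_pow, this]
    · simp
  simpa using hli.fintype_card_le_finrank

end Bezout

section Discriminant

variable {κ : Type*} [Field κ] {f : κ[X][X]} {d : ℕ}

/-- The discriminant, up to sign, of a bivariate polynomial in the second variable. -/
noncomputable def disc (f : κ[X][X]) : κ[X] :=
  Algebra.norm κ[X] (AdjoinRoot.mk f (derivative f))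

theorem natDegree_disc_le (hf : f.Monic) (hd : f.natDegree = d) (hfd : BiDeg d f) :
    (disc f).natDegree ≤ d * (d - 1) := by
  rw [mul_comm]
  exact natDegree_norm_le hf hd hfd hfd.derivative

theorem dvd_norm {A S ι : Type*} [CommRing A] [CommRing S] [Algebra A S] [Fintype ι]
    (b : Module.Basis ι A S) (s : S) : s ∣ algebraMap A S (Algebra.norm A s) := by
  classical
  set M := Algebra.leftMulMatrix b s with hM
  refine ⟨b.equivFun.symm (M.adjugate.mulVec (b.equivFun 1)), b.equivFun.injective ?_⟩
  have h2 : b.equivFun (s * b.equivFun.symm (M.adjugate.mulVec (b.equivFun 1))) =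
      M.mulVec (M.adjugate.mulVec (b.equivFun 1)) := by
    have := Algebra.leftMulMatrix_mulVec_repr b s
      (b.equivFun.symm (M.adjugate.mulVec (b.equivFun 1)))
    rw [← hM] at this
    have h3 := b.equivFun.apply_symm_apply (M.adjugate.mulVec (b.equivFun 1))
    rw [Module.Basis.equivFun_apply] at h3
    rw [h3] at this
    rw [this]
    rfl
  rw [h2, Matrix.mulVec_mulVec, Matrix.mul_adjugate, Algebra.algebraMap_eq_smul_one, map_smul,
    Matrix.smul_mulVec, Matrix.one_mulVec, Algebra.norm_eq_matrix_det b]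

theorem exists_disc_eq (hf : f.Monic) :
    ∃ a b : κ[X][X], C (disc f) = a * f + b * derivative f := by
  obtain ⟨r, hr⟩ : AdjoinRoot.mk f (derivative f) ∣ algebraMap κ[X] (AdjoinRoot f) (disc f) :=
    dvd_norm (AdjoinRoot.powerBasis' hf).basis _
  obtain ⟨b, rfl⟩ := AdjoinRoot.mk_surjective r
  have h2 : algebraMap κ[X] (AdjoinRoot f) (disc f) = AdjoinRoot.mk f (C (disc f)) := rfl
  rw [h2, ← map_mul, ← sub_eq_zero, ← map_sub, AdjoinRoot.mk_eq_zero] at hr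
  obtain ⟨a, ha⟩ := hr
  exact ⟨a, b, by linear_combination ha⟩

end Discriminant

end PlaneCurve

namespace PlaneCurve

open Polynomial

section FrobeniusIndependence

variable {κ : Type*} [Field κ]

theorem eq_zero_of_sum_mul_pow_char_eq_zero {p : ℕ} [Fact p.Prime] [CharP κ p] [PerfectRing κ p]
    {ι : Type*} [Fintype ι] {k : ℕ} (u w : ι → PowerSeries κ)
    (hu : ∀ c : ι → κ, PowerSeries.X ^ p ^ k ∣ ∑ i, c i • u i → ∑ i, c i • u i = 0)
    (hw : LinearIndependent κ w) (h : ∑ i, u i * w i ^ p ^ k = 0) (i : ι) : u i = 0 := by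
  have : CharP (PowerSeries κ) p := charP_of_injective_algebraMap
    (algebraMap κ (PowerSeries κ)).injective p
  set Q := p ^ k with hQ
  have htr : ∀ (n : ℕ) (s : PowerSeries κ), ∃ s' : PowerSeries κ,
      s ^ Q = ∑ j ∈ Finset.range n, PowerSeries.C (PowerSeries.coeff j s ^ Q) *
        PowerSeries.X ^ (j * Q) + PowerSeries.X ^ (n * Q) * s' := by
    intro n s
    induction n with
    | zero => exact ⟨s ^ Q, by simp⟩
    | succ n ih =>
      have h1 : PowerSeries.X ^ (n + 1) ∣
          s - ∑ j ∈ Finset.range (n + 1), PowerSeries.C (PowerSeries.coeff j s) *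
            PowerSeries.X ^ j := by
        rw [PowerSeries.X_pow_dvd_iff]
        intro m hm
        rw [map_sub, map_sum, Finset.sum_eq_single m]
        · simp [PowerSeries.coeff_X_pow]
        · intro b _ hb
          simp [PowerSeries.coeff_X_pow, Ne.symm hb]
        · intro hm'
          simp at hm'
          omega
      obtain ⟨t, ht⟩ := h1
      refine ⟨t ^ Q, ?_⟩
      rw [sub_eq_iff_eq_add] at ht
      conv_lhs => rw [ht]
      rw [hQ, add_pow_char_pow, mul_pow, ← pow_mul, sum_pow_char_pow, add_comm]
      congr 1
      refine Finset.sum_congr rfl fun j _ => ?_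
      rw [mul_pow, map_pow, ← pow_mul]
  have he : ∀ n : ℕ, ∑ i, (PowerSeries.coeff n (w i) ^ Q) • u i = 0 := by
    intro n
    induction n using Nat.strong_induction_on with
    | _ n ih =>
      apply hu
      choose s' hs' using fun i => htr (n + 1) (w i)
      have h2 : ∑ j ∈ Finset.range (n + 1), (∑ i, (PowerSeries.coeff j (w i) ^ Q) • u i) *
          PowerSeries.X ^ (j * Q) + PowerSeries.X ^ ((n + 1) * Q) * ∑ i, u i * s' i = 0 := by
        rw [← h]
        simp_rw [hs', Finset.sum_mul, mul_add, Finset.mul_sum]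
        rw [Finset.sum_comm, ← Finset.sum_add_distrib]
        refine Finset.sum_congr rfl fun i _ => ?_
        congr 1
        · refine Finset.sum_congr rfl fun j _ => ?_
          rw [PowerSeries.smul_eq_C_mul]
          ring
        · ring
      rw [Finset.sum_range_succ, Finset.sum_eq_zero, zero_add] at h2
      · have h3 : PowerSeries.X ^ (n * Q) * (∑ i, (PowerSeries.coeff n (w i) ^ Q) • u i +
            PowerSeries.X ^ Q * ∑ i, u i * s' i) = 0 := by
          rw [← h2]; ring
        have h4 := (mul_eq_zero.1 h3).resolve_left (pow_ne_zero _ PowerSeries.X_ne_zero)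
        exact ⟨-∑ i, u i * s' i, by linear_combination h4⟩
      · intro j hj
        rw [ih j (Finset.mem_range.1 hj), zero_mul]
  ext s
  have hcs : ∑ i, ((iterateFrobeniusEquiv κ p k).symm (PowerSeries.coeff s (u i))) • w i = 0 := by
    ext n
    have h5 := congrArg (PowerSeries.coeff s) (he n)
    rw [map_sum] at h5 ⊢
    simp only [PowerSeries.coeff_smul, smul_eq_mul, map_zero] at h5 ⊢
    apply (iterateFrobeniusEquiv κ p k).injective
    rw [map_sum, map_zero, ← h5]
    refine Finset.sum_congr rfl fun i _ => ?_
    rw [map_mul, RingEquiv.apply_symm_apply, iterateFrobeniusEquiv_apply, iterateFrobenius_def]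
    ring
  have := Fintype.linearIndependent_iff.1 hw _ hcs i
  simpa using this

end FrobeniusIndependence

section Branch

variable {κ : Type*} [Field κ] {f : κ[X][X]}

/-- A smooth point of the curve has a formal branch parametrised by the abscissa. -/
theorem exists_branch (hf : f.Monic) (x y : κ) (h0 : f.evalEval x y = 0)
    (h1 : (derivative f).evalEval x y ≠ 0) :
    ∃ φ : AdjoinRoot f →ₐ[κ] PowerSeries κ,
      φ (AdjoinRoot.mk f (C (X - C x))) = PowerSeries.X := by
  let ρ : κ[X] →ₐ[κ] PowerSeries κ := aeval (PowerSeries.C x + PowerSeries.X)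
  have hρ : ∀ a : κ[X], PowerSeries.constantCoeff (ρ a) = a.eval x := by
    intro a
    have : (PowerSeries.constantCoeff (R := κ)).comp (ρ : κ[X] →+* PowerSeries κ) =
        evalRingHom x := by
      ext <;> simp [ρ]
    exact RingHom.congr_fun this a
  have hev : ∀ P : κ[X][X], PowerSeries.constantCoeff
      ((P.map (ρ : κ[X] →+* PowerSeries κ)).eval (PowerSeries.C y)) = P.evalEval x y := by
    intro P
    rw [eval_map, ← coe_evalEvalRingHom, evalEvalRingHom_eq, coe_eval₂RingHom, hom_eval₂]
    congr 1
    ext <;> simp [ρ]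
  have hH : HenselianRing (PowerSeries κ) (Ideal.span {PowerSeries.X}) := inferInstance
  obtain ⟨a, ha, -⟩ := hH.is_henselian (f.map (ρ : κ[X] →+* PowerSeries κ)) (hf.map _)
    (PowerSeries.C y) (by
      rw [Ideal.mem_span_singleton, PowerSeries.X_dvd_iff, hev, h0]) (by
      rw [derivative_map]
      apply IsUnit.map
      rw [PowerSeries.isUnit_iff_constantCoeff, hev]
      exact isUnit_iff_ne_zero.2 h1)
  rw [IsRoot, eval_map] at ha
  refine ⟨{ AdjoinRoot.lift (ρ : κ[X] →+* PowerSeries κ) a ha with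
    commutes' := fun r => ?_ }, ?_⟩
  · have : algebraMap κ (AdjoinRoot f) r = AdjoinRoot.of f (C r) := rfl
    rw [this]
    exact (AdjoinRoot.lift_of ha).trans (by simp [ρ])
  · exact (AdjoinRoot.lift_of ha).trans (by simp [ρ])

theorem branch_injective (hf : f.Monic) (hirr : Irreducible f) (φ : AdjoinRoot f →ₐ[κ] PowerSeries κ) {τ : AdjoinRoot f}
    (hτ : φ τ = PowerSeries.X) : Function.Injective φ := by
  have := isDomain_adjoinRoot hirr
  rw [injective_iff_map_eq_zero]
  intro s hs
  by_contra h0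
  have := finite_quotient_span (AdjoinRoot.powerBasis' hf).basis h0
  have h1 := le_finrank_of_X_pow_dvd φ τ hτ s
    (n := Module.finrank κ (AdjoinRoot f ⧸ Ideal.span {s}) + 1) (by rw [hs]; exact dvd_zero _)
  omega

end Branch

end PlaneCurve

namespace PlaneCurve

open Polynomial

section Filtration

variable {κ : Type*} [Field κ] {f : κ[X][X]} {d : ℕ}

theorem BiDeg.smul {n : ℕ} {P : κ[X][X]} (hP : BiDeg n P) (c : κ) : BiDeg n (c • P) := by
  intro i hi
  rw [coeff_smul] at hi ⊢
  have h1 : P.coeff i ≠ 0 := fun h => hi (by rw [h, smul_zero])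
  have := hP i h1
  have := natDegree_smul_le c (P.coeff i)
  omega

theorem exists_biDeg (P : κ[X][X]) : ∃ n, BiDeg n P := by
  refine ⟨P.support.sup (fun i => (P.coeff i).natDegree + i), fun i hi => ?_⟩
  exact Finset.le_sup (f := fun i => (P.coeff i).natDegree + i) (mem_support_iff.2 hi)

/-- The classes of polynomials of total degree at most `n` on the curve `f = 0`. -/
def filDeg (f : κ[X][X]) (n : ℕ) : Submodule κ (AdjoinRoot f) where
  carrier := {r | ∃ h, BiDeg n h ∧ AdjoinRoot.mk f h = r}
  add_mem' := by
    rintro _ _ ⟨a, ha, rfl⟩ ⟨b, hb, rfl⟩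
    exact ⟨a + b, ha.add hb, map_add _ _ _⟩
  zero_mem' := ⟨0, BiDeg.zero n, map_zero _⟩
  smul_mem' := by
    rintro c _ ⟨a, ha, rfl⟩
    exact ⟨c • a, ha.smul c, rfl⟩

theorem mk_mem_filDeg {n : ℕ} {h : κ[X][X]} (hh : BiDeg n h) : AdjoinRoot.mk f h ∈ filDeg f n :=
  ⟨h, hh, rfl⟩

theorem filDeg_mono {n m : ℕ} (hnm : n ≤ m) : filDeg f n ≤ filDeg f m := by
  rintro _ ⟨a, ha, rfl⟩
  exact ⟨a, ha.mono hnm, rfl⟩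

theorem mul_mem_filDeg {n m : ℕ} {r s : AdjoinRoot f} (hr : r ∈ filDeg f n)
    (hs : s ∈ filDeg f m) : r * s ∈ filDeg f (n + m) := by
  obtain ⟨a, ha, rfl⟩ := hr
  obtain ⟨b, hb, rfl⟩ := hs
  exact ⟨a * b, ha.mul hb, map_mul _ _ _⟩

theorem pow_mem_filDeg {n : ℕ} {r : AdjoinRoot f} (hr : r ∈ filDeg f n) (k : ℕ) :
    r ^ k ∈ filDeg f (k * n) := by
  obtain ⟨a, ha, rfl⟩ := hr
  exact ⟨a ^ k, ha.pow k, map_pow _ _ _⟩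

theorem exists_mem_filDeg (r : AdjoinRoot f) : ∃ n, r ∈ filDeg f n := by
  obtain ⟨a, rfl⟩ := AdjoinRoot.mk_surjective r
  obtain ⟨n, hn⟩ := exists_biDeg a
  exact ⟨n, mk_mem_filDeg hn⟩

theorem natDegree_coeff_modByMonicHom_le (hf : f.Monic) (hd : f.natDegree = d) (hfd : BiDeg d f)
    {n : ℕ} {r : AdjoinRoot f} (hr : r ∈ filDeg f n) (i : ℕ) :
    ((AdjoinRoot.modByMonicHom hf r).coeff i).natDegree ≤ n := by
  obtain ⟨a, ha, rfl⟩ := hr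
  rw [AdjoinRoot.modByMonicHom_mk]
  by_cases h : (a %ₘ f).coeff i = 0
  · simp [h]
  · have := BiDeg.modByMonic hf hd hfd ha i h
    omega

theorem mk_modByMonicHom (hf : f.Monic) (r : AdjoinRoot f) :
    AdjoinRoot.mk f (AdjoinRoot.modByMonicHom hf r) = r :=
  AdjoinRoot.mk_leftInverse hf r

theorem eq_zero_of_coeffs (hf : f.Monic) (hd : f.natDegree = d) (hfd : BiDeg d f)
    {n : ℕ} {r : AdjoinRoot f} (hr : r ∈ filDeg f n)
    (h : ∀ i < d, ∀ s ≤ n, ((AdjoinRoot.modByMonicHom hf r).coeff i).coeff s = 0) : r = 0 := by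
  rw [← mk_modByMonicHom hf r]
  have : AdjoinRoot.modByMonicHom hf r = 0 := by
    ext i s
    rw [coeff_zero, coeff_zero]
    by_cases hi : i < d
    · by_cases hs : s ≤ n
      · exact h i hi s hs
      · apply coeff_eq_zero_of_natDegree_lt
        have := natDegree_coeff_modByMonicHom_le hf hd hfd hr i
        omega
    · obtain ⟨a, ha, rfl⟩ := hr
      rw [AdjoinRoot.modByMonicHom_mk]
      suffices hc : (a %ₘ f).coeff i = 0 by rw [hc, coeff_zero]
      apply coeff_eq_zero_of_degree_lt
      refine (degree_modByMonic_lt a hf).trans_le ?_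
      rw [degree_eq_natDegree hf.ne_zero, hd]
      exact_mod_cast not_lt.1 hi
  rw [this, map_zero]

theorem finrank_quotient_le_of_mem (hf : f.Monic) (hd : f.natDegree = d) (hfd : BiDeg d f)
    (hirr : Irreducible f) {n : ℕ} {r : AdjoinRoot f} (hr : r ∈ filDeg f n) (h0 : r ≠ 0) :
    Module.Finite κ (AdjoinRoot f ⧸ Ideal.span {r}) ∧
    Module.finrank κ (AdjoinRoot f ⧸ Ideal.span {r}) ≤ n * d := by
  obtain ⟨a, ha, rfl⟩ := hr
  exact finrank_quotient_le hf hd hfd hirr ha h0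

theorem linearIndependent_monomials (hf : f.Monic) (hd : f.natDegree = d) (L : ℕ) :
    LinearIndependent κ (fun i : Fin L × Fin d =>
      AdjoinRoot.mk f (C X) ^ (i.1 : ℕ) * AdjoinRoot.mk f X ^ (i.2 : ℕ)) := by
  rw [Fintype.linearIndependent_iff]
  intro c hc
  have h1 : AdjoinRoot.mk f (∑ i : Fin L × Fin d, c i • (C X ^ (i.1 : ℕ) * X ^ (i.2 : ℕ))) = 0 := by
    rw [← hc, map_sum]
    refine Finset.sum_congr rfl fun i _ => ?_
    have h2 : AdjoinRoot.mk f (c i • (C X ^ (i.1 : ℕ) * X ^ (i.2 : ℕ))) =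
      c i • AdjoinRoot.mk f (C X ^ (i.1 : ℕ) * X ^ (i.2 : ℕ)) := rfl
    rw [h2, map_mul, map_pow, map_pow]
  have hm : ∀ i : Fin L × Fin d, c i • ((C X : κ[X][X]) ^ (i.1 : ℕ) * X ^ (i.2 : ℕ)) =
      monomial (i.2 : ℕ) (monomial (i.1 : ℕ) (c i)) := by
    intro i
    rw [← C_pow, C_mul_X_pow_eq_monomial, smul_monomial, X_pow_eq_monomial, smul_monomial,
      smul_eq_mul, mul_one]
  simp_rw [hm] at h1
  rw [AdjoinRoot.mk_eq_zero] at h1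
  have h2 : (∑ i : Fin L × Fin d, monomial (i.2 : ℕ) (monomial (i.1 : ℕ) (c i))) = 0 := by
    by_contra h0
    refine hf.not_dvd_of_degree_lt h0 ?_ h1
    rw [degree_eq_natDegree hf.ne_zero, hd, degree_lt_iff_coeff_zero]
    intro m hm
    rw [finsetSum_coeff]
    refine Finset.sum_eq_zero fun i _ => ?_
    rw [coeff_monomial, if_neg]
    have := i.2.2
    omega
  intro i
  have h3 := congrArg (fun P : κ[X][X] => (P.coeff i.2).coeff i.1) h2
  simp only [finsetSum_coeff, coeff_zero] at h3
  rw [Finset.sum_eq_single i] at h3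
  · simpa using h3
  · intro j _ hj
    rw [coeff_monomial]
    split_ifs with h
    · rw [coeff_monomial, if_neg]
      intro h'
      exact hj (Prod.ext (Fin.ext h') (Fin.ext h))
    · simp
  · simp

end Filtration

end PlaneCurve

namespace PlaneCurve

open Polynomial

section Stepanov

variable {κ : Type*} [Field κ] {f : κ[X][X]} {d : ℕ}

theorem modByMonicHom_smul (hf : f.Monic) (c : κ) (r : AdjoinRoot f) :
    AdjoinRoot.modByMonicHom hf (c • r) = c • AdjoinRoot.modByMonicHom hf r := by
  have h1 : c • r = (C c : κ[X]) • r := by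
    obtain ⟨a, rfl⟩ := AdjoinRoot.mk_surjective r
    have h2 : c • AdjoinRoot.mk f a = AdjoinRoot.mk f (c • a) := rfl
    have h3 : (C c : κ[X]) • AdjoinRoot.mk f a = AdjoinRoot.mk f ((C c : κ[X]) • a) := rfl
    rw [h2, h3]
    congr 1
    ext i : 1
    rw [coeff_smul, coeff_smul, smul_eq_C_mul, smul_eq_mul]
  rw [h1, map_smul]
  ext i : 1
  rw [coeff_smul, coeff_smul, smul_eq_C_mul, smul_eq_mul]

theorem xi_mem_filDeg (f : κ[X][X]) (n : ℕ) : AdjoinRoot.mk f (C X) ^ n ∈ filDeg f n := by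
  simpa using pow_mem_filDeg (f := f) (mk_mem_filDeg biDeg_C_X) n

theorem eta_mem_filDeg (f : κ[X][X]) (n : ℕ) : AdjoinRoot.mk f X ^ n ∈ filDeg f n := by
  simpa using pow_mem_filDeg (f := f) (mk_mem_filDeg biDeg_X) n

theorem evalPt_xi (P : κ × κ) (hP : f.evalEval P.1 P.2 = 0) :
    evalPt f P hP (AdjoinRoot.mk f (C X)) = P.1 := by
  rw [evalPt_mk]; simp [evalEval]

theorem evalPt_eta (P : κ × κ) (hP : f.evalEval P.1 P.2 = 0) :
    evalPt f P hP (AdjoinRoot.mk f X) = P.2 := by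
  rw [evalPt_mk, evalEval_X]

/-- The points `(x, y)` of the curve with `x ^ Q = x` and `Ψ(x, y, y ^ Q) = 0`. -/
def frobPts (f : κ[X][X]) (Ψ : (AdjoinRoot f)[X]) (Q : ℕ) : Set (κ × κ) :=
  {P | ∃ hP : f.evalEval P.1 P.2 = 0, P.1 ^ Q = P.1 ∧
    (Ψ.map (evalPt f P hP : AdjoinRoot f →+* κ)).eval (P.2 ^ Q) = 0}

theorem pow_eq_sum_of_isRoot {Ψ : (AdjoinRoot f)[X]} (hΨ : Ψ.Monic)
    (ev : AdjoinRoot f →+* κ) {z : κ} (hz : (Ψ.map ev).eval z = 0) (b : ℕ) :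
    z ^ b = ∑ t : Fin Ψ.natDegree, ev ((X ^ b %ₘ Ψ).coeff t) * z ^ (t : ℕ) := by
  have h1 : ((X ^ b %ₘ Ψ).map ev).eval z = z ^ b := by
    have h2 := congrArg (fun P => (P.map ev).eval z) (modByMonic_add_div (X ^ b) Ψ)
    simpa [hz] using h2
  rw [← h1]
  by_cases h0 : Ψ.natDegree = 0
  · have : Ψ = 1 := hΨ.natDegree_eq_zero.1 h0
    simp [this]
  rw [eval_eq_sum_range' (n := Ψ.natDegree), Finset.sum_range]
  · simp
  · refine (natDegree_map_le).trans_lt ?_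
    apply natDegree_modByMonic_lt _ hΨ
    rintro rfl
    simp at h0

theorem exists_kernel_vector (hf : f.Monic) (hd : f.natDegree = d) (hfd : BiDeg d f)
    {ι : Type*} [Fintype ι] {D N : ℕ} (v : ι → ℕ → AdjoinRoot f)
    (hv : ∀ s t, v s t ∈ filDeg f N) (hcard : D * (d * (N + 1)) < Fintype.card ι) :
    ∃ γ : ι → κ, γ ≠ 0 ∧ ∀ t < D, ∑ s, γ s • v s t = 0 := by
  classical
  let A : Matrix (Fin D × Fin d × Fin (N + 1)) ι κ := fun x s =>
    ((AdjoinRoot.modByMonicHom hf (v s x.1)).coeff x.2.1).coeff x.2.2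
  have hker : LinearMap.ker A.mulVecLin ≠ ⊥ := by
    apply LinearMap.ker_ne_bot_of_finrank_lt
    simpa using hcard
  obtain ⟨γ, hγ, hγ0⟩ := (Submodule.ne_bot_iff _).1 hker
  refine ⟨γ, hγ0, fun t ht => ?_⟩
  refine eq_zero_of_coeffs hf hd hfd (n := N)
    (Submodule.sum_mem _ fun s _ => Submodule.smul_mem _ _ (hv s t)) fun i hi s hs => ?_
  have h1 := congrFun (LinearMap.mem_ker.1 hγ) (⟨t, ht⟩, ⟨i, hi⟩, ⟨s, by omega⟩)
  rw [map_sum, finsetSum_coeff, finsetSum_coeff]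
  rw [Matrix.mulVecLin_apply] at h1
  simp only [Matrix.mulVec, dotProduct, Pi.zero_apply] at h1
  rw [← h1]
  refine Finset.sum_congr rfl fun x _ => ?_
  rw [modByMonicHom_smul, coeff_smul, coeff_smul, smul_eq_mul, mul_comm]

variable {p : ℕ} [Fact p.Prime] [CharP κ p] [PerfectRing κ p]

theorem sum_mul_pow_ne_zero (hf : f.Monic) (hd : f.natDegree = d) (hfd : BiDeg d f)
    (hirr : Irreducible f) {x₁ y₁ : κ} (h0 : f.evalEval x₁ y₁ = 0)
    (h1 : (derivative f).evalEval x₁ y₁ ≠ 0) {ι : Type*} [Fintype ι] {m j : ℕ}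
    (hm : m * d < p ^ j)
    (β v : ι → AdjoinRoot f) (hβ : ∀ i, β i ∈ filDeg f m) (hv : LinearIndependent κ v)
    (hsum : ∑ i, β i * v i ^ p ^ j = 0) (i : ι) : β i = 0 := by
  obtain ⟨φ, hφ⟩ := exists_branch hf x₁ y₁ h0 h1
  have hinj := branch_injective hf hirr φ hφ
  have := eq_zero_of_sum_mul_pow_char_eq_zero (p := p) (k := j) (fun i => φ (β i))
    (fun i => φ (v i)) ?_ ?_ ?_ i
  · exact hinj (by rw [this, map_zero])
  · intro c hc
    have h2 : ∑ i, c i • φ (β i) = φ (∑ i, c i • β i) := by simp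
    rw [h2] at hc ⊢
    by_contra h3
    have h4 : ∑ i, c i • β i ≠ 0 := fun h => h3 (by rw [h, map_zero])
    obtain ⟨_, h6⟩ := finrank_quotient_le_of_mem hf hd hfd hirr
      (Submodule.sum_mem _ fun i _ => Submodule.smul_mem _ (c i) (hβ i)) h4
    have := le_finrank_of_X_pow_dvd φ _ hφ _ hc
    omega
  · exact hv.map' φ.toLinearMap (LinearMap.ker_eq_bot.2 hinj)
  · have h2 := congrArg φ hsum
    simpa using h2

theorem stepanov_aux (hf : f.Monic) (hd : f.natDegree = d) (hfd : BiDeg d f)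
    (hirr : Irreducible f) {x₁ y₁ : κ} (h0 : f.evalEval x₁ y₁ = 0)
    (h1 : (derivative f).evalEval x₁ y₁ ≠ 0) {Ψ : (AdjoinRoot f)[X]} {D : ℕ} (hΨ : Ψ.Monic)
    (hD : Ψ.natDegree = D) {w : ℕ} (hw : ∀ b < d, ∀ t, (X ^ b %ₘ Ψ).coeff t ∈ filDeg f w)
    {i j M L : ℕ} (hL : 0 < L) (hcount : D * ((M + d) * p ^ i + L + w) < M * L * d)
    (hord : (M + d) * d < p ^ j) :
    (frobPts f Ψ (p ^ i * p ^ j)).Finite ∧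
      (frobPts f Ψ (p ^ i * p ^ j)).ncard ≤ ((M + d) + p ^ j * (L + d)) * d := by
  set q₁ := p ^ i with hq₁
  set q₂ := p ^ j with hq₂
  set ξ := AdjoinRoot.mk f (C X) with hξ
  set η := AdjoinRoot.mk f X with hη
  have hd0 : 0 < d := by
    rcases Nat.eq_zero_or_pos d with h | h
    · simp [h] at hcount
    · exact h
  let I := (Fin M × Fin d) × (Fin L × Fin d)
  let mon : I → AdjoinRoot f := fun s =>
    ξ ^ ((s.1.1 : ℕ) * q₁ + s.2.1) * η ^ ((s.1.2 : ℕ) * q₁)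
  have hmon : ∀ s, mon s ∈ filDeg f ((M + d) * q₁ + L - 1) := by
    intro s
    refine filDeg_mono ?_ (mul_mem_filDeg (xi_mem_filDeg f _) (eta_mem_filDeg f _))
    have h2 : ((s.1.1 : ℕ) + s.1.2) * q₁ ≤ (M + d) * q₁ := by
      have := s.1.1.2
      have := s.1.2.2
      gcongr <;> omega
    have := s.2.1.2
    rw [add_mul] at h2
    omega
  obtain ⟨γ, hγ0, hγ⟩ := exists_kernel_vector hf hd hfd (D := D)
    (N := (M + d) * q₁ + L - 1 + w) (fun (s : I) t => mon s * (X ^ (s.2.2 : ℕ) %ₘ Ψ).coeff t)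
    (fun s t => mul_mem_filDeg (hmon s) (hw _ s.2.2.2 t)) (by
      have h2 : (M + d) * q₁ + L - 1 + w + 1 = (M + d) * q₁ + L + w := by omega
      rw [h2]
      simp only [I, Fintype.card_prod, Fintype.card_fin]
      nlinarith)
  let rt : I → κ := fun s => (iterateFrobeniusEquiv κ p i).symm (γ s)
  have hrt : ∀ s, rt s ^ q₁ = γ s := by
    intro s
    have := (iterateFrobeniusEquiv κ p i).apply_symm_apply (γ s)
    rwa [iterateFrobeniusEquiv_apply, iterateFrobenius_def] at this
  let β : Fin L × Fin d → AdjoinRoot f := fun ab =>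
    ∑ ce : Fin M × Fin d, rt (ce, ab) • (ξ ^ (ce.1 : ℕ) * η ^ (ce.2 : ℕ))
  let v : Fin L × Fin d → AdjoinRoot f := fun ab => ξ ^ (ab.1 : ℕ) * η ^ (ab.2 : ℕ)
  have hβ : ∀ ab, β ab ∈ filDeg f (M + d) := by
    intro ab
    refine Submodule.sum_mem _ fun ce _ => Submodule.smul_mem _ _ ?_
    refine filDeg_mono ?_ (mul_mem_filDeg (xi_mem_filDeg f _) (eta_mem_filDeg f _))
    have := ce.1.2
    have := ce.2.2
    omega
  have hv : ∀ ab, v ab ∈ filDeg f (L + d) := by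
    intro ab
    refine filDeg_mono ?_ (mul_mem_filDeg (xi_mem_filDeg f _) (eta_mem_filDeg f _))
    have := ab.1.2
    have := ab.2.2
    omega
  let g : AdjoinRoot f := ∑ ab, β ab * v ab ^ q₂
  have hg : g ∈ filDeg f ((M + d) + q₂ * (L + d)) :=
    Submodule.sum_mem _ fun ab _ => mul_mem_filDeg (hβ ab) (pow_mem_filDeg (hv ab) _)
  have hg0 : g ≠ 0 := by
    intro hg0
    apply hγ0
    have h2 := sum_mul_pow_ne_zero hf hd hfd hirr h0 h1 hord β v hβ
      (linearIndependent_monomials hf hd L) hg0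
    funext s
    have h3 := Fintype.linearIndependent_iff.1 (linearIndependent_monomials hf hd M)
      (fun ce => rt (ce, s.2)) (h2 s.2) s.1
    rw [← hrt s, show rt s = 0 from h3, zero_pow (pow_ne_zero _ (Fact.out : p.Prime).ne_zero)]
    rfl
  obtain ⟨hfin, hrank⟩ := finrank_quotient_le_of_mem hf hd hfd hirr hg hg0
  obtain ⟨h3, h4⟩ := finite_and_ncard_le_of_evalPt g
  have hsub : frobPts f Ψ (q₁ * q₂) ⊆
      {P : κ × κ | ∃ hP : f.evalEval P.1 P.2 = 0, evalPt f P hP g = 0} := by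
    rintro P ⟨hP, hx, hz⟩
    refine ⟨hP, ?_⟩
    have hxi : evalPt f P hP ξ = P.1 := evalPt_xi P hP
    have heta : evalPt f P hP η = P.2 := evalPt_eta P hP
    set ev := evalPt f P hP with hev
    have key : (ev g) ^ q₁ = 0 := by
      have e1 : (ev g) ^ q₁ = ∑ ab : Fin L × Fin d, ∑ ce : Fin M × Fin d, γ (ce, ab) *
          (ev (mon (ce, ab)) * (P.2 ^ (q₁ * q₂)) ^ (ab.2 : ℕ)) := by
        simp only [g, map_sum, map_mul, map_pow, β, map_smul, smul_eq_mul, v, mon, hxi, heta]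
        rw [hq₁, sum_pow_char_pow]
        refine Finset.sum_congr rfl fun ab _ => ?_
        rw [mul_pow, sum_pow_char_pow, Finset.sum_mul]
        refine Finset.sum_congr rfl fun ce _ => ?_
        rw [← hq₁, mul_pow, hrt]
        have hxa : ∀ z a, ((z ^ a) ^ q₂) ^ q₁ = (z ^ (q₁ * q₂)) ^ a := fun (z : κ) (a : ℕ) => by
          rw [← pow_mul, ← pow_mul, ← pow_mul]
          congr 1
          ring
        rw [mul_pow _ _ q₂, mul_pow _ _ q₁, mul_pow _ _ q₁, hxa, hxa, hx]
        simp only [pow_add, ← pow_mul]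
        ring
      rw [e1]
      have e2 := pow_eq_sum_of_isRoot hΨ (ev : AdjoinRoot f →+* κ) hz
      rw [Finset.sum_comm, ← Fintype.sum_prod_type' (f := fun ce ab => γ (ce, ab) *
          (ev (mon (ce, ab)) * (P.2 ^ (q₁ * q₂)) ^ (ab.2 : ℕ)))]
      rw [Finset.sum_congr rfl fun s _ => by rw [e2 s.2.2, Finset.mul_sum, Finset.mul_sum]]
      rw [Finset.sum_comm]
      refine Finset.sum_eq_zero fun t _ => ?_
      have e3 := congrArg ev (hγ t (hD ▸ t.2))
      rw [map_sum, map_zero] at e3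
      rw [← zero_mul ((P.2 ^ (q₁ * q₂)) ^ (t : ℕ)), ← e3, Finset.sum_mul]
      refine Finset.sum_congr rfl fun s _ => ?_
      rw [map_smul, map_mul ev (mon s), smul_eq_mul]
      simp only [RingHom.coe_coe]
      ring
    exact pow_eq_zero_iff (pow_ne_zero _ (Fact.out : p.Prime).ne_zero) |>.1 key
  exact ⟨h3.subset hsub, (Set.ncard_le_ncard hsub h3).trans (h4.trans hrank)⟩

end Stepanov

end PlaneCurve

namespace PlaneCurve

open Polynomial

section PointCount

variable {κ : Type*} [Field κ] {f : κ[X][X]} {d : ℕ}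

theorem disc_ne_zero (hf : f.Monic) (hirr : Irreducible f) (hder : derivative f ≠ 0) :
    disc f ≠ 0 := by
  have := isDomain_adjoinRoot hirr
  have hb := (AdjoinRoot.powerBasis' hf).basis
  rw [disc, Ne, Algebra.norm_eq_zero_iff_of_basis hb, AdjoinRoot.mk_eq_zero]
  intro h
  refine hder (eq_zero_of_dvd_of_degree_lt h ?_)
  exact degree_derivative_lt hf.ne_zero

theorem separable_fiber (hf : f.Monic) {x : κ} (hx : (disc f).eval x ≠ 0) :
    (f.map (evalRingHom x)).Separable := by
  obtain ⟨a, b, hab⟩ := exists_disc_eq hf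
  have h1 := congrArg (Polynomial.map (evalRingHom x)) hab
  simp only [Polynomial.map_add, Polynomial.map_mul, map_C, coe_evalRingHom] at h1
  refine ⟨C ((disc f).eval x)⁻¹ * a.map (evalRingHom x), C ((disc f).eval x)⁻¹ *
    b.map (evalRingHom x), ?_⟩
  rw [derivative_map, mul_assoc, mul_assoc, ← mul_add, ← h1, ← C_mul, inv_mul_cancel₀ hx, C_1]

theorem evalEval_eq_eval_fiber (h : κ[X][X]) (x y : κ) :
    h.evalEval x y = (h.map (evalRingHom x)).eval y := by
  rw [eval_map, ← coe_evalEvalRingHom, evalEvalRingHom_eq, coe_eval₂RingHom]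

variable [IsAlgClosed κ]

theorem card_fiber (hf : f.Monic) (hd : f.natDegree = d) {x : κ} (hx : (disc f).eval x ≠ 0)
    [DecidableEq κ] : (f.map (evalRingHom x)).roots.toFinset.card = d := by
  rw [Multiset.toFinset_card_of_nodup (nodup_roots (separable_fiber hf hx)),
    splits_iff_card_roots.1 (IsAlgClosed.splits _), hf.natDegree_map, hd]

theorem exists_smooth_point (hf : f.Monic) (hd : f.natDegree = d) (hd0 : 0 < d)
    (hirr : Irreducible f) (hder : derivative f ≠ 0) :
    ∃ x y : κ, f.evalEval x y = 0 ∧ (derivative f).evalEval x y ≠ 0 := by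
  classical
  obtain ⟨x, hx⟩ : ∃ x, (disc f).eval x ≠ 0 := by
    by_contra! h
    exact disc_ne_zero hf hirr hder (funext (by simpa using h))
  have h1 := card_fiber hf hd hx
  obtain ⟨y, hy⟩ := Finset.card_pos.1 (h1 ▸ hd0)
  have hy : (f.map (evalRingHom x)).eval y = 0 := by
    have := Multiset.mem_toFinset.1 hy
    exact (mem_roots'.1 this).2
  refine ⟨x, y, by rwa [evalEval_eq_eval_fiber], ?_⟩
  rw [evalEval_eq_eval_fiber, ← derivative_map]
  obtain ⟨a, b, hab⟩ := separable_fiber hf hx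
  intro h
  have := congrArg (eval y) hab
  rw [eval_add, eval_mul, eval_mul, hy, h] at this
  simp at this

variable {p : ℕ} [Fact p.Prime] [CharP κ p]

theorem stepanov (hf : f.Monic) (hd : f.natDegree = d) (hd0 : 0 < d) (hfd : BiDeg d f)
    (hirr : Irreducible f) (hder : derivative f ≠ 0) {Ψ : (AdjoinRoot f)[X]} (hΨ : Ψ.Monic) :
    ∃ K c : ℕ, ∀ i j, K * p ^ i < p ^ j →
      (frobPts f Ψ (p ^ i * p ^ j)).Finite ∧
      (frobPts f Ψ (p ^ i * p ^ j)).ncard ≤ Ψ.natDegree * (p ^ i * p ^ j) + c * p ^ j := by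
  obtain ⟨x₁, y₁, h0, h1⟩ := exists_smooth_point hf hd hd0 hirr hder
  set D := Ψ.natDegree with hD
  obtain ⟨w, hw⟩ : ∃ w, ∀ b < d, ∀ t, (X ^ b %ₘ Ψ).coeff t ∈ filDeg f w := by
    choose g hg using fun r : AdjoinRoot f => exists_mem_filDeg r
    refine ⟨(Finset.range d).sup fun b => (Finset.range ((X ^ b %ₘ Ψ).natDegree + 1)).sup
      fun t => g ((X ^ b %ₘ Ψ).coeff t), fun b hb t => ?_⟩
    by_cases ht : t ∈ Finset.range ((X ^ b %ₘ Ψ).natDegree + 1)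
    · refine filDeg_mono ?_ (hg _)
      refine le_trans ?_ (Finset.le_sup (f := fun b => (Finset.range ((X ^ b %ₘ Ψ).natDegree + 1)).sup
        fun t => g ((X ^ b %ₘ Ψ).coeff t)) (Finset.mem_range.2 hb))
      exact Finset.le_sup (f := fun t => g ((X ^ b %ₘ Ψ).coeff t)) ht
    · rw [coeff_eq_zero_of_natDegree_lt (by simpa using ht)]
      exact Submodule.zero_mem _
  refine ⟨(2 * d + 2 * D + 1 + w) * d, 1 + D + d + d * d, fun i j hij => ?_⟩
  have hq₁ : 0 < p ^ i := pow_pos (Fact.out : p.Prime).pos _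
  generalize hq : p ^ i = q₁ at *
  set L := (D * q₁ + D) / d + 1 with hL
  have hL1 : D * q₁ + D + 1 ≤ d * L := by
    rw [hL]
    exact Nat.lt_mul_div_succ (D * q₁ + D) hd0
  have hL2 : d * L ≤ D * q₁ + D + d := by
    have := Nat.mul_div_le (D * q₁ + D) d
    rw [hL, mul_add]
    omega
  have hL3 : L ≤ D * q₁ + D + 1 := by
    have := Nat.div_le_self (D * q₁ + D) d
    omega
  clear_value L
  have hL0 : 0 < L := by
    rcases Nat.eq_zero_or_pos L with h | h
    · simp [h] at hL1
    · exact h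
  have hM : (d * q₁ + L + w + d) ≤ (2 * d + 2 * D + 1 + w) * q₁ := by nlinarith
  have hord : (d * q₁ + L + w + d) * d < p ^ j := by
    refine lt_of_le_of_lt ?_ hij
    calc _ ≤ (2 * d + 2 * D + 1 + w) * q₁ * d := by gcongr
      _ = _ := by ring
  have hcount : D * ((d * q₁ + L + w + d) * p ^ i + L + w) < (d * q₁ + L + w) * L * d := by
    rw [hq]
    have : (d * q₁ + L + w) * (D * q₁ + D + 1) ≤ (d * q₁ + L + w) * (d * L) := by gcongr
    nlinarith
  obtain ⟨h2, h3⟩ := stepanov_aux hf hd hfd hirr h0 h1 hΨ hD.symm hw hL0 hcount hord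
  rw [hq] at h2 h3
  refine ⟨h2, h3.trans ?_⟩
  calc (d * q₁ + L + w + d + p ^ j * (L + d)) * d
      = (d * q₁ + L + w + d) * d + p ^ j * (d * L) + p ^ j * (d * d) := by ring
    _ ≤ p ^ j + p ^ j * (D * q₁ + D + d) + p ^ j * (d * d) := by gcongr
    _ = _ := by ring

/-- The points of the curve with coordinates fixed by the `Q`-power map. -/
def ratPts (f : κ[X][X]) (Q : ℕ) : Set (κ × κ) :=
  {P | f.evalEval P.1 P.2 = 0 ∧ P.1 ^ Q = P.1 ∧ P.2 ^ Q = P.2}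

theorem frobPts_linear (f : κ[X][X]) (Q : ℕ) :
    frobPts f (X - C (AdjoinRoot.root f)) Q = ratPts f Q := by
  ext P
  simp only [frobPts, ratPts, Set.mem_ofPred_eq]
  have h (hP : f.evalEval P.1 P.2 = 0) :
      evalPt f P hP (AdjoinRoot.root f) = P.2 := evalPt_eta P hP
  constructor
  · rintro ⟨hP, hx, hy⟩
    refine ⟨hP, hx, ?_⟩
    simpa [h hP, sub_eq_zero] using hy
  · rintro ⟨hP, hx, hy⟩
    refine ⟨hP, hx, ?_⟩
    simpa [h hP, sub_eq_zero] using hy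

theorem card_fixed_pow {m : ℕ} (hm : m ≠ 0) [DecidableEq κ] :
    (X ^ p ^ m - X : κ[X]).roots.toFinset.card = p ^ m := by
  have hp : 1 < p := (Fact.out : p.Prime).one_lt
  have h1 : 1 < p ^ m := Nat.one_lt_pow hm hp
  rw [Multiset.toFinset_card_of_nodup, splits_iff_card_roots.1 (IsAlgClosed.splits _),
    FiniteField.X_pow_card_sub_X_natDegree_eq κ h1]
  exact nodup_roots (galois_poly_separable p _ (dvd_pow_self p hm))

theorem mul_card_le_ncard (hf : f.Monic) (hd : f.natDegree = d) (hdisc : disc f ≠ 0)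
    {m : ℕ} (hm : m ≠ 0) {T : Set (κ × κ)} (hT : T.Finite)
    (hsub : ∀ x y : κ, f.evalEval x y = 0 → x ^ p ^ m = x → (x, y) ∈ T) :
    d * p ^ m ≤ T.ncard + d * (disc f).natDegree := by
  classical
  set A := (X ^ p ^ m - X : κ[X]).roots.toFinset \ (disc f).roots.toFinset with hA
  have h0 : ∀ x ∈ A, x ^ p ^ m = x ∧ (disc f).eval x ≠ 0 := by
    intro x hx
    simp only [hA, Finset.mem_sdiff, Multiset.mem_toFinset, mem_roots', IsRoot.def, eval_sub,
      eval_pow, eval_X, sub_eq_zero] at hx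
    exact ⟨hx.1.2, fun h => hx.2 ⟨hdisc, h⟩⟩
  have h1 : (A.sigma fun x => (f.map (evalRingHom x)).roots.toFinset).card ≤ T.ncard := by
    rw [Set.ncard_eq_toFinset_card T hT]
    refine Finset.card_le_card_of_injOn (fun s => (s.1, s.2)) ?_ ?_
    · intro s hs
      simp only [Finset.coe_sigma, Set.mem_sigma_iff, Finset.mem_coe] at hs
      have h2 := (mem_roots'.1 (Multiset.mem_toFinset.1 hs.2)).2
      simp only [Finset.mem_coe, Set.Finite.mem_toFinset]
      exact hsub _ _ (by rw [evalEval_eq_eval_fiber]; exact h2) (h0 _ hs.1).1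
    · rintro ⟨a, b⟩ _ ⟨a', b'⟩ _ h
      simp only [Prod.mk.injEq] at h
      obtain ⟨rfl, rfl⟩ := h
      rfl
  rw [Finset.card_sigma, Finset.sum_congr rfl fun x hx => card_fiber hf hd (h0 x hx).2,
    Finset.sum_const, smul_eq_mul] at h1
  have h2 : p ^ m ≤ A.card + (disc f).natDegree := by
    rw [← card_fixed_pow (κ := κ) (p := p) hm]
    have h3 := Finset.le_card_sdiff (disc f).roots.toFinset (X ^ p ^ m - X : κ[X]).roots.toFinset
    rw [← hA] at h3
    have h4 := Multiset.toFinset_card_le (disc f).roots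
    have h5 := card_roots' (disc f)
    omega
  nlinarith

theorem exists_abs_ncard_sub_le (hf : f.Monic) (hd : f.natDegree = d) (hd0 : 0 < d)
    (hfd : BiDeg d f) (hirr : Irreducible f) (hder : derivative f ≠ 0) :
    ∃ B : ℝ, ∀ m, m ≠ 0 →
      (∀ x y : κ, f.evalEval (x ^ p ^ m) (y ^ p ^ m) = f.evalEval x y ^ p ^ m) →
      |((ratPts f (p ^ m)).ncard : ℝ) - (p : ℝ) ^ m| ≤ B * √((p : ℝ) ^ m) := by
  have hp := (Fact.out : p.Prime)
  have := isDomain_adjoinRoot hirr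
  have hdvd : X - C (AdjoinRoot.root f) ∣ f.map (AdjoinRoot.of f) := by
    rw [dvd_iff_isRoot]
    exact AdjoinRoot.isRoot_root f
  obtain ⟨Φ, hΦ⟩ := hdvd
  have hmonic : Φ.Monic := (monic_X_sub_C _).of_mul_monic_left (hΦ ▸ hf.map _)
  have hdeg : Φ.natDegree + 1 = d := by
    rw [← hd, ← hf.natDegree_map (AdjoinRoot.of f), hΦ, (monic_X_sub_C _).natDegree_mul hmonic,
      natDegree_X_sub_C, add_comm]
  obtain ⟨K₀, c₀, h₀⟩ := stepanov (p := p) hf hd hd0 hfd hirr hder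
    (monic_X_sub_C (AdjoinRoot.root f))
  obtain ⟨K₁, c₁, h₁⟩ := stepanov (p := p) hf hd hd0 hfd hirr hder hmonic
  have hlow : ∀ i j, K₀ * p ^ i < p ^ j → K₁ * p ^ i < p ^ j → i + j ≠ 0 →
      (∀ x y : κ, f.evalEval (x ^ p ^ (i + j)) (y ^ p ^ (i + j)) = f.evalEval x y ^ p ^ (i + j)) →
      |((ratPts f (p ^ (i + j))).ncard : ℝ) - (p : ℝ) ^ (i + j)| ≤
        (c₀ + c₁ + d * (disc f).natDegree : ℕ) * (p : ℝ) ^ j := by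
    intro i j hi hj hij hfix
    obtain ⟨f0, b0⟩ := h₀ i j hi
    obtain ⟨f1, b1⟩ := h₁ i j hj
    rw [frobPts_linear, ← pow_add] at f0 b0
    rw [← pow_add] at f1 b1
    rw [natDegree_X_sub_C, one_mul] at b0
    have h2 := mul_card_le_ncard (p := p) hf hd (disc_ne_zero hf hirr hder) hij (f0.union f1) (by
      intro x y hxy hx
      have h3 : f.evalEval x (y ^ p ^ (i + j)) = 0 := by
        have := hfix x y
        rwa [hx, hxy, zero_pow (pow_ne_zero _ hp.ne_zero)] at this
      have h4 := congrArg (fun P => (P.map (evalPt f (x, y) hxy : AdjoinRoot f →+* κ)).eval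
        (y ^ p ^ (i + j))) hΦ
      have h5 : (evalPt f (x, y) hxy : AdjoinRoot f →+* κ).comp (AdjoinRoot.of f) =
          evalRingHom x := by
        ext a
        · have := evalPt_mk (x, y) hxy (C (C a))
          simpa [evalEval] using this
        · have := evalPt_mk (x, y) hxy (C X)
          simpa [evalEval] using this
      simp only [Polynomial.map_mul, eval_mul, Polynomial.map_map, h5] at h4
      rw [← evalEval_eq_eval_fiber, h3, eq_comm, mul_eq_zero] at h4
      rcases h4 with h4 | h4
      · left
        rw [← frobPts_linear]
        exact ⟨hxy, hx, h4⟩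
      · right
        exact ⟨hxy, hx, h4⟩)
    have h3 := Set.ncard_union_le (ratPts f (p ^ (i + j))) (frobPts f Φ (p ^ (i + j)))
    have hpj : 1 ≤ p ^ j := Nat.one_le_pow _ _ hp.pos
    rw [abs_le]
    generalize (disc f).natDegree = e at *
    generalize (ratPts f (p ^ (i + j))).ncard = A at *
    have h6 : p ^ (i + j) ≤ A + (c₁ + d * e) * p ^ j := by
      rw [← hdeg, add_mul] at h2
      have : (Φ.natDegree + 1) * e ≤ (Φ.natDegree + 1) * e * p ^ j := Nat.le_mul_of_pos_right _ hpj
      rw [← hdeg]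
      nlinarith
    have h7 : A ≤ p ^ (i + j) + (c₀ + c₁ + d * e) * p ^ j :=
      b0.trans (by gcongr; omega)
    have h8 : p ^ (i + j) ≤ A + (c₀ + c₁ + d * e) * p ^ j :=
      h6.trans (by gcongr; omega)
    have h7' : (A : ℝ) ≤ p ^ (i + j) + (c₀ + c₁ + d * e : ℕ) * p ^ j := by exact_mod_cast h7
    have h8' : (p : ℝ) ^ (i + j) ≤ A + (c₀ + c₁ + d * e : ℕ) * p ^ j := by exact_mod_cast h8
    constructor <;> linarith
  obtain ⟨t, ht⟩ : ∃ t, K₀ + K₁ < p ^ t := pow_unbounded_of_one_lt _ hp.one_lt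
  set c := c₀ + c₁ + d * (disc f).natDegree with hc
  have hpR : (1 : ℝ) ≤ p := by exact_mod_cast hp.one_lt.le
  set S := ∑ m ∈ Finset.range t, |((ratPts f (p ^ m)).ncard : ℝ) - (p : ℝ) ^ m| with hS
  have hS0 : 0 ≤ S := Finset.sum_nonneg fun _ _ => abs_nonneg _
  refine ⟨S + c * √((p : ℝ) ^ (t + 1)), fun m hm hfix => ?_⟩
  by_cases hmt : m < t
  · have h2 : |((ratPts f (p ^ m)).ncard : ℝ) - (p : ℝ) ^ m| ≤ S :=
      Finset.single_le_sum (f := fun m => |((ratPts f (p ^ m)).ncard : ℝ) - (p : ℝ) ^ m|)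
        (fun _ _ => abs_nonneg _) (Finset.mem_range.2 hmt)
    have h3 : 1 ≤ √((p : ℝ) ^ m) := Real.one_le_sqrt.2 (one_le_pow₀ hpR)
    have h4 : S ≤ S + c * √((p : ℝ) ^ (t + 1)) := by
      have : 0 ≤ c * √((p : ℝ) ^ (t + 1)) := by positivity
      linarith
    nlinarith
  · push Not at hmt
    obtain ⟨i, j, hij, h1, h2⟩ : ∃ i j, m = i + j ∧ i + t ≤ j ∧ 2 * j ≤ m + t + 1 :=
      ⟨(m - t) / 2, m - (m - t) / 2, by omega, by omega, by omega⟩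
    have h3 : ∀ K, K ≤ K₀ + K₁ → K * p ^ i < p ^ j := by
      intro K hK
      calc K * p ^ i < p ^ t * p ^ i := by
            have := pow_pos hp.pos i
            gcongr
            omega
        _ = p ^ (i + t) := by rw [mul_comm, pow_add]
        _ ≤ p ^ j := Nat.pow_le_pow_right hp.pos h1
    subst hij
    refine (hlow i j (h3 _ (by omega)) (h3 _ (by omega)) hm hfix).trans ?_
    have h4 : (p : ℝ) ^ j ≤ √((p : ℝ) ^ (t + 1)) * √((p : ℝ) ^ (i + j)) := by
      rw [← Real.sqrt_mul (by positivity), ← pow_add]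
      apply Real.le_sqrt_of_sq_le
      rw [← pow_mul]
      exact pow_le_pow_right₀ hpR (by omega)
    have h5 : 0 ≤ √((p : ℝ) ^ (i + j)) := by positivity
    calc (c : ℝ) * (p : ℝ) ^ j ≤ c * (√((p : ℝ) ^ (t + 1)) * √((p : ℝ) ^ (i + j))) := by gcongr
      _ ≤ _ := by nlinarith

end PointCount

end PlaneCurve

namespace PlaneCurve

section IdealCount

open UniqueFactorizationMonoid

variable (k : Type*) [Field k] {S : Type*} [CommRing S] [Algebra k S]

/-- The degree of an ideal. -/
noncomputable def ideg (I : Ideal S) : ℕ := Module.finrank k (S ⧸ I)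

variable [Finite k] [IsDedekindDomain S] [Ring.HasFiniteQuotients S]

theorem cardQuot_eq_pow {I : Ideal S} (hI : I ≠ ⊥) :
    Submodule.cardQuot I = Nat.card k ^ ideg k I := by
  have := Ring.HasFiniteQuotients.finiteQuotient hI
  rw [Submodule.cardQuot_apply]
  exact Module.natCard_eq_pow_finrank (K := k) (V := S ⧸ I)

omit [Finite k] in
theorem ideg_pos {I : Ideal S} (hI : I ≠ ⊥) (hI1 : I ≠ ⊤) : 0 < ideg k I := by
  have := Ring.HasFiniteQuotients.finiteQuotient hI
  have : Nontrivial (S ⧸ I) := Ideal.Quotient.nontrivial_iff.2 hI1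
  have : Module.Finite k (S ⧸ I) := Module.Finite.of_finite
  exact Module.finrank_pos

variable [Infinite S]

theorem ideg_mul {I J : Ideal S} (hI : I ≠ ⊥) (hJ : J ≠ ⊥) :
    ideg k (I * J) = ideg k I + ideg k J := by
  have h1 : Submodule.cardQuot (I * J) = Submodule.cardQuot I * Submodule.cardQuot J :=
    multiplicative_of_coprime (fun I : Ideal S => Submodule.cardQuot I) I J
      (Submodule.cardQuot_bot _ _)
      (fun {I J} hI => by simp [Ideal.isUnit_iff.mp hI, Ideal.mul_top])
      (fun {I} i hI =>
        have : Ideal.IsPrime I := Ideal.isPrime_of_prime hI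
        cardQuot_pow_of_prime hI.ne_zero)
      fun {I J} hIJ => cardQuot_mul_of_coprime <| Ideal.isCoprime_iff_sup_eq.mpr
        (Ideal.isUnit_iff.mp
          (hIJ (Ideal.dvd_iff_le.mpr le_sup_left) (Ideal.dvd_iff_le.mpr le_sup_right)))
  rw [cardQuot_eq_pow k hI, cardQuot_eq_pow k hJ, cardQuot_eq_pow k (mul_ne_zero hI hJ),
    ← pow_add] at h1
  exact Nat.pow_right_injective Finite.one_lt_card h1

omit [Infinite S] [Finite k] in
theorem ideg_top : ideg k (⊤ : Ideal S) = 0 := by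
  have : Subsingleton (S ⧸ (⊤ : Ideal S)) := Ideal.Quotient.subsingleton_iff.2 rfl
  exact Module.finrank_zero_of_subsingleton

theorem ideg_pow {I : Ideal S} (hI : I ≠ ⊥) (n : ℕ) : ideg k (I ^ n) = n * ideg k I := by
  induction n with
  | zero => rw [pow_zero, Ideal.one_eq_top, ideg_top, zero_mul]
  | succ n ih => rw [pow_succ, ideg_mul k (pow_ne_zero _ hI) hI, ih, add_mul, one_mul]

theorem ideg_eq_sum_normalizedFactors {I : Ideal S} (hI : I ≠ ⊥) :
    ideg k I = ((normalizedFactors I).map (ideg k)).sum := by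
  have h : ∀ s : Multiset (Ideal S), (∀ P ∈ s, P ≠ ⊥) → ideg k s.prod = (s.map (ideg k)).sum := by
    intro s
    induction s using Multiset.induction with
    | empty => intro _; simp [Ideal.one_eq_top, ideg_top]
    | cons P s ih =>
      intro hs
      rw [Multiset.prod_cons, Multiset.map_cons, Multiset.sum_cons, ideg_mul k, ih]
      · exact fun P hP => hs P (Multiset.mem_cons_of_mem hP)
      · exact hs P (Multiset.mem_cons_self _ _)
      · exact Multiset.prod_ne_zero fun h => hs _ (Multiset.mem_cons_of_mem h) rfl
  rw [← h _ fun P hP => (prime_of_normalized_factor P hP).ne_zero,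
    associated_iff_eq.1 (prod_normalizedFactors hI)]

theorem finite_ideg_le (S : Type*) [CommRing S] [Algebra k S] [IsDedekindDomain S]
    [Ring.HasFiniteQuotients S] (n : ℕ) : {I : Ideal S | I ≠ ⊥ ∧ ideg k I ≤ n}.Finite := by
  refine (Ring.HasFiniteQuotients.finite_cardQuot_le (R := S) (Nat.card k ^ n)).subset ?_
  rintro I ⟨hI, h⟩
  simp only [Set.mem_ofPred_eq]
  rw [cardQuot_eq_pow k hI]
  exact Nat.pow_le_pow_right Nat.card_pos h

variable (S) in
/-- The ideals of degree `n`. -/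
noncomputable def idealsOfDeg (n : ℕ) : Finset (Ideal S) :=
  Set.Finite.toFinset (s := {I | I ≠ ⊥ ∧ ideg k I = n})
    ((finite_ideg_le k S n).subset fun _ h => ⟨h.1, h.2.le⟩)

omit [Infinite S] in
theorem mem_idealsOfDeg {n : ℕ} {I : Ideal S} :
    I ∈ idealsOfDeg k S n ↔ I ≠ ⊥ ∧ ideg k I = n := by
  simp [idealsOfDeg]

variable (S) in
/-- The nonzero primes of degree at most `n`. -/
noncomputable def primesOfDegLE (n : ℕ) : Finset (Ideal S) :=
  Set.Finite.toFinset (s := {I | I ≠ ⊥ ∧ I.IsPrime ∧ ideg k I ≤ n})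
    ((finite_ideg_le k S n).subset fun _ h => ⟨h.1, h.2.2⟩)

omit [Infinite S] in
theorem mem_primesOfDegLE {n : ℕ} {I : Ideal S} :
    I ∈ primesOfDegLE k S n ↔ I ≠ ⊥ ∧ I.IsPrime ∧ ideg k I ≤ n := by
  simp [primesOfDegLE]

variable (S) in
/-- The number of points of degree dividing `r`, counted geometrically. -/
noncomputable def primeSum (r : ℕ) : ℕ :=
  ∑ P ∈ primesOfDegLE k S r with ideg k P ∣ r, ideg k P

open scoped Classical in
theorem sum_dvd_prime_pow {n : ℕ} {I : Ideal S} (hI : I ∈ idealsOfDeg k S n) :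
    n = ∑ P ∈ primesOfDegLE k S n, ∑ j ∈ Finset.Icc 1 n, if P ^ j ∣ I then ideg k P else 0 := by
  obtain ⟨hI0, hn⟩ := (mem_idealsOfDeg k).1 hI
  have hmem : ∀ P, P ∈ (normalizedFactors I).toFinset → P ∈ primesOfDegLE k S n := by
    intro P hP
    rw [Multiset.mem_toFinset] at hP
    have hp := prime_of_normalized_factor P hP
    obtain ⟨J, rfl⟩ := dvd_of_mem_normalizedFactors hP
    rw [mem_primesOfDegLE]
    refine ⟨hp.ne_zero, Ideal.isPrime_of_prime hp, ?_⟩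
    rw [ideg_mul k hp.ne_zero (right_ne_zero_of_mul hI0)] at hn
    omega
  conv_lhs => rw [← hn, ideg_eq_sum_normalizedFactors k hI0, Finset.sum_multiset_map_count]
  rw [← Finset.sum_subset hmem]
  · refine Finset.sum_congr rfl fun P hP => ?_
    rw [Multiset.mem_toFinset] at hP
    have hp := prime_of_normalized_factor P hP
    have h1 : ∀ j, P ^ j ∣ I ↔ j ≤ (normalizedFactors I).count P := by
      intro j
      rw [dvd_iff_normalizedFactors_le_normalizedFactors (pow_ne_zero _ hp.ne_zero) hI0,
        normalizedFactors_pow, normalizedFactors_irreducible hp.irreducible, normalize_eq,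
        Multiset.nsmul_singleton, Multiset.le_count_iff_replicate_le]
    have h2 : (normalizedFactors I).count P ≤ n := by
      obtain ⟨J, hJ⟩ := (h1 _).2 le_rfl
      have hJ0 : J ≠ ⊥ := right_ne_zero_of_mul (hJ ▸ hI0)
      have h3 := ideg_mul k (pow_ne_zero ((normalizedFactors I).count P) hp.ne_zero) hJ0
      rw [← hJ, hn, ideg_pow k hp.ne_zero] at h3
      have h4 := ideg_pos k hp.ne_zero (Ideal.isPrime_of_prime hp).ne_top
      nlinarith
    simp_rw [h1]
    rw [← Finset.sum_filter, Finset.sum_const, smul_eq_mul, smul_eq_mul]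
    congr 1
    have : {j ∈ Finset.Icc 1 n | j ≤ (normalizedFactors I).count P} =
        Finset.Icc 1 ((normalizedFactors I).count P) := by
      ext j
      simp only [Finset.mem_filter, Finset.mem_Icc]
      omega
    rw [this, Nat.card_Icc, Nat.add_sub_cancel]
  · intro P hP hP'
    obtain ⟨hP0, hPp, -⟩ := (mem_primesOfDegLE k).1 hP
    refine Finset.sum_eq_zero fun j hj => if_neg fun hdvd => hP' ?_
    rw [Multiset.mem_toFinset, mem_normalizedFactors_iff' hI0]
    refine ⟨(Ideal.prime_of_isPrime hP0 hPp).irreducible, normalize_eq P, ?_⟩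
    exact (dvd_pow_self P (by have := Finset.mem_Icc.1 hj; omega)).trans hdvd

theorem card_filter_dvd {n : ℕ} {J : Ideal S} (hJ : J ≠ ⊥) [DecidablePred (J ∣ ·)] :
    {I ∈ idealsOfDeg k S n | J ∣ I}.card =
      if ideg k J ≤ n then (idealsOfDeg k S (n - ideg k J)).card else 0 := by
  split_ifs with h
  · symm
    refine Finset.card_bij (fun I _ => J * I) ?_ ?_ ?_
    · intro I hI
      obtain ⟨hI0, hn⟩ := (mem_idealsOfDeg k).1 hI
      rw [Finset.mem_filter, mem_idealsOfDeg, ideg_mul k hJ hI0]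
      exact ⟨⟨mul_ne_zero hJ hI0, by omega⟩, dvd_mul_right _ _⟩
    · intro I _ I' _ h
      exact mul_left_cancel₀ hJ h
    · intro I hI
      obtain ⟨h1, I', rfl⟩ := Finset.mem_filter.1 hI
      obtain ⟨hI0, hn⟩ := (mem_idealsOfDeg k).1 h1
      have h0 : I' ≠ ⊥ := right_ne_zero_of_mul hI0
      rw [ideg_mul k hJ h0] at hn
      exact ⟨I', (mem_idealsOfDeg k).2 ⟨h0, by omega⟩, rfl⟩
  · rw [Finset.card_eq_zero, Finset.filter_eq_empty_iff]
    rintro I hI ⟨I', rfl⟩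
    obtain ⟨hI0, hn⟩ := (mem_idealsOfDeg k).1 hI
    rw [ideg_mul k hJ (right_ne_zero_of_mul hI0)] at hn
    omega

theorem mul_card_idealsOfDeg (n : ℕ) :
    n * (idealsOfDeg k S n).card =
      ∑ r ∈ Finset.Icc 1 n, primeSum k S r * (idealsOfDeg k S (n - r)).card := by
  classical
  have h1 : n * (idealsOfDeg k S n).card = ∑ P ∈ primesOfDegLE k S n, ∑ j ∈ Finset.Icc 1 n,
      ∑ I ∈ idealsOfDeg k S n, if P ^ j ∣ I then ideg k P else 0 := by
    rw [mul_comm, ← smul_eq_mul, ← Finset.sum_const,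
      Finset.sum_congr rfl fun (I : Ideal S) hI => sum_dvd_prime_pow k hI, Finset.sum_comm]
    exact Finset.sum_congr rfl fun P _ => Finset.sum_comm
  have h2 : ∀ r ∈ Finset.Icc 1 n, primeSum k S r * (idealsOfDeg k S (n - r)).card =
      ∑ P ∈ primesOfDegLE k S n,
        if ideg k P ∣ r then ideg k P * (idealsOfDeg k S (n - r)).card else 0 := by
    intro r hr
    rw [Finset.mem_Icc] at hr
    rw [primeSum, Finset.sum_mul, ← Finset.sum_filter]
    refine Finset.sum_congr ?_ fun _ _ => rfl
    ext P
    simp only [Finset.mem_filter, mem_primesOfDegLE]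
    constructor
    · rintro ⟨⟨a, b, c⟩, e⟩
      exact ⟨⟨a, b, by omega⟩, e⟩
    · rintro ⟨⟨a, b, c⟩, e⟩
      exact ⟨⟨a, b, Nat.le_of_dvd (by omega) e⟩, e⟩
  rw [h1, Finset.sum_congr rfl h2, Finset.sum_comm (s := Finset.Icc 1 n)]
  refine Finset.sum_congr rfl fun P hP => ?_
  obtain ⟨hP0, hPp, -⟩ := (mem_primesOfDegLE k).1 hP
  have hpos := ideg_pos k hP0 hPp.ne_top
  have h3 : ∀ j ∈ Finset.Icc 1 n, (∑ I ∈ idealsOfDeg k S n, if P ^ j ∣ I then ideg k P else 0) =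
      if j * ideg k P ≤ n then ideg k P * (idealsOfDeg k S (n - j * ideg k P)).card else 0 := by
    intro j _
    rw [← Finset.sum_filter, Finset.sum_const, card_filter_dvd k (pow_ne_zero _ hP0),
      ideg_pow k hP0]
    split_ifs <;> simp [mul_comm]
  rw [Finset.sum_congr rfl h3, ← Finset.sum_filter, ← Finset.sum_filter]
  refine Finset.sum_bij (fun j _ => j * ideg k P) ?_ ?_ ?_ ?_
  · intro j hj
    simp only [Finset.mem_filter, Finset.mem_Icc] at hj ⊢
    exact ⟨⟨Nat.mul_pos (by omega) hpos, hj.2⟩, dvd_mul_left _ _⟩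
  · intro j _ j' _ h
    exact Nat.eq_of_mul_eq_mul_right hpos h
  · intro r hr
    simp only [Finset.mem_filter, Finset.mem_Icc] at hr
    obtain ⟨⟨h4, h5⟩, j, rfl⟩ := hr
    refine ⟨j, ?_, mul_comm _ _⟩
    simp only [Finset.mem_filter, Finset.mem_Icc]
    refine ⟨⟨Nat.pos_of_ne_zero ?_, ?_⟩, by rwa [mul_comm]⟩
    · rintro rfl
      simp at h4
    · nlinarith
  · intro j _
    rfl

theorem sum_ideg_le_of_mem {a : S} (ha : a ≠ 0) (s : Finset (Ideal S))
    (hs : ∀ P ∈ s, P ≠ ⊥ ∧ P.IsPrime ∧ a ∈ P) :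
    ∑ P ∈ s, ideg k P ≤ ideg k (Ideal.span {a}) := by
  classical
  have h0 : Ideal.span {a} ≠ ⊥ := by simpa using ha
  have h1 : (∏ P ∈ s, P) ∣ Ideal.span {a} := by
    refine Finset.prod_primes_dvd _ (fun P hP => Ideal.prime_of_isPrime (hs P hP).1 (hs P hP).2.1)
      fun P hP => ?_
    rw [Ideal.dvd_span_singleton]
    exact (hs P hP).2.2
  have h2 : ideg k (∏ P ∈ s, P) = ∑ P ∈ s, ideg k P := by
    clear h1
    induction s using Finset.induction_on with
    | empty => simp [Ideal.one_eq_top, ideg_top]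
    | insert P s hP ih =>
      rw [Finset.prod_insert hP, Finset.sum_insert hP, ideg_mul k,
        ih fun P hP => hs P (Finset.mem_insert_of_mem hP)]
      · exact (hs P (Finset.mem_insert_self _ _)).1
      · exact Finset.prod_ne_zero_iff.2 fun P hP => (hs P (Finset.mem_insert_of_mem hP)).1
  obtain ⟨J, hJ⟩ := h1
  have hJ0 : (∏ P ∈ s, P) * J ≠ 0 := hJ ▸ h0
  rw [hJ, ideg_mul k (left_ne_zero_of_mul hJ0) (right_ne_zero_of_mul hJ0), h2]
  omega

end IdealCount

end PlaneCurve

namespace PlaneCurve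

open Polynomial

section Zeta

variable {M : Type*} [CommMonoid M] {deg : M → ℕ} {S : ℕ → Type*} {div : ∀ m, S m → M}
  {d p q : ℕ} {c : ℝ}

theorem card_sigma_dvd_le [∀ m, Finite (S m)] (hdeg : ∀ a b, deg (a * b) = deg a + deg b)
    (hcancel : ∀ a b c : M, a * b = a * c → b = c) (hfin : ∀ n, {D | deg D = n}.Finite)
    (hdiv : ∀ m s, deg (div m s) = m * d) (D₀ : M) {m n n' : ℕ} (h : n + n' + deg D₀ = m * d) :
    Nat.card (Σ D : {D // deg D = n}, {s // D₀ * D.1 ∣ div m s}) ≤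
      Nat.card (Σ D : {D // deg D = n'}, {s // D₀ * D.1 ∣ div m s}) := by
  have : Finite {D // deg D = n'} := hfin n'
  have key : ∀ x : (Σ D : {D // deg D = n}, {s // D₀ * D.1 ∣ div m s}), ∃ E : M,
      div m x.2.1 = D₀ * x.1.1 * E ∧ deg E = n' := by
    rintro ⟨⟨D, hD⟩, s, E, hE⟩
    refine ⟨E, hE, ?_⟩
    have := hdiv m s
    rw [hE, hdeg, hdeg] at this
    simp only at this
    omega
  choose E hE hE' using key
  refine Nat.card_le_card_of_injective
    (fun x => ⟨⟨E x, hE' x⟩, x.2.1, ⟨x.1.1, by rw [hE x]; ring_nf; rw [mul_right_comm]⟩⟩) ?_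
  rintro ⟨⟨D, hD⟩, s, hs⟩ ⟨⟨D', hD'⟩, s', hs'⟩ hxx
  have h1 := congrArg (fun z => z.1.1) hxx
  have h2 := congrArg (fun z => z.2.1) hxx
  simp only at h1 h2
  subst h2
  have h3 := hE ⟨⟨D, hD⟩, s, hs⟩
  rw [h1] at h3
  have h4 := h3.symm.trans (hE ⟨⟨D', hD'⟩, s, hs'⟩)
  simp only at h4
  rw [mul_right_comm, mul_right_comm D₀ D'] at h4
  have := hcancel _ _ _ h4
  subst this
  rfl

theorem ncard_deg_mul_eq [∀ m, Finite (S m)] (hdeg : ∀ a b, deg (a * b) = deg a + deg b)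
    (hcancel : ∀ a b c : M, a * b = a * c → b = c) (hfin : ∀ n, {D | deg D = n}.Finite)
    (hdiv : ∀ m s, deg (div m s) = m * d)
    (hcard : ∀ m D, deg D + 2 * p ≤ m * d + 1 →
      (Nat.card {s : S m // D ∣ div m s} : ℝ) = c * q ^ (m * d + 1 - deg D) - 1)
    (hd : 0 < d) (hlarge : ∃ R, ∀ r ≥ R, ∃ D, deg D = r)
    {n n' : ℕ} (hn : 2 * p ≤ n + 1) (hn' : 2 * p ≤ n' + 1) :
    ({D | deg D = n}.ncard : ℝ) * (c * q ^ (n' + 1) - 1) =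
      {D | deg D = n'}.ncard * (c * q ^ (n + 1) - 1) := by
  obtain ⟨R, hR⟩ := hlarge
  set m := n + n' + R with hm
  have hmd : m ≤ m * d := Nat.le_mul_of_pos_right _ hd
  obtain ⟨D₀, hD₀⟩ := hR (m * d - n - n') (by omega)
  have key : ∀ {n n' : ℕ}, n + n' + deg D₀ = m * d → 2 * p ≤ n' + 1 →
      (Nat.card (Σ D : {D // deg D = n}, {s // D₀ * D.1 ∣ div m s}) : ℝ) =
      ({D | deg D = n}.ncard : ℝ) * (c * q ^ (n' + 1) - 1) := by
    intro n n' h hn'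
    have : Finite {D // deg D = n} := hfin n
    have := Fintype.ofFinite {D // deg D = n}
    rw [Nat.card_sigma, Nat.cast_sum, Finset.sum_congr rfl
      (g := fun _ => c * (q : ℝ) ^ (n' + 1) - 1), Finset.sum_const, nsmul_eq_mul]
    · congr 2
      rw [Finset.card_univ, ← Nat.card_eq_fintype_card]
      rfl
    · rintro ⟨D, hD⟩ -
      rw [hcard, hdeg, hD]
      · congr 3
        omega
      · rw [hdeg, hD]
        omega
  rw [← key (by omega) hn', ← key (n := n') (n' := n) (by omega) hn]
  exact_mod_cast le_antisymm (card_sigma_dvd_le hdeg hcancel hfin hdiv D₀ (by omega))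
    (card_sigma_dvd_le hdeg hcancel hfin hdiv D₀ (by omega))

/-- Beyond the degree bound, the divisor counts are given by a two-term exponential formula. -/
theorem exists_ncard_deg_eq [∀ m, Finite (S m)] (hdeg : ∀ a b, deg (a * b) = deg a + deg b)
    (hcancel : ∀ a b c : M, a * b = a * c → b = c) (hfin : ∀ n, {D | deg D = n}.Finite)
    (hdiv : ∀ m s, deg (div m s) = m * d)
    (hcard : ∀ m D, deg D + 2 * p ≤ m * d + 1 →
      (Nat.card {s : S m // D ∣ div m s} : ℝ) = c * q ^ (m * d + 1 - deg D) - 1)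
    (hd : 0 < d) (hlarge : ∃ R, ∀ r ≥ R, ∃ D, deg D = r) (hq : 1 < q) (hc : 0 < c) :
    ∃ C : ℝ, (∀ n, 2 * p ≤ n + 1 → ({D | deg D = n}.ncard : ℝ) = C * (c * q ^ (n + 1) - 1)) ∧
      (p = 0 → c = 1) := by
  have hq' : (1 : ℝ) < q := by exact_mod_cast hq
  obtain ⟨N, hN⟩ := pow_unbounded_of_one_lt (1 / c) hq'
  have hN' : 0 < c * (q : ℝ) ^ (2 * p + N + 1) - 1 := by
    have : (q : ℝ) ^ N ≤ q ^ (2 * p + N + 1) := pow_le_pow_right₀ hq'.le (by omega)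
    rw [div_lt_iff₀ hc] at hN
    nlinarith
  refine ⟨{D | deg D = 2 * p + N}.ncard / (c * q ^ (2 * p + N + 1) - 1), fun n hn => ?_, ?_⟩
  · rw [div_mul_eq_mul_div, eq_div_iff hN'.ne']
    exact ncard_deg_mul_eq hdeg hcancel hfin hdiv hcard hd hlarge hn (by omega)
  · rintro rfl
    obtain ⟨R, hR⟩ := hlarge
    obtain ⟨D, hD⟩ := hR (R * d + 1) (by nlinarith)
    have h1 := hcard R D (by omega)
    have : IsEmpty {s : S R // D ∣ div R s} := by
      refine ⟨?_⟩
      rintro ⟨s, E, hE⟩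
      have := hdiv R s
      rw [hE, hdeg] at this
      omega
    rw [Nat.card_of_isEmpty, hD, Nat.sub_self] at h1
    push_cast at h1
    linarith

end Zeta

section LogDeriv

open scoped PowerSeries

theorem X_mul_derivative_mul {F₁ F₂ N₁ N₂ : PowerSeries ℂ}
    (h₁ : PowerSeries.X * d⁄dX ℂ F₁ = N₁ * F₁) (h₂ : PowerSeries.X * d⁄dX ℂ F₂ = N₂ * F₂) :
    PowerSeries.X * d⁄dX ℂ (F₁ * F₂) = (N₁ + N₂) * (F₁ * F₂) := by
  rw [Derivation.leibniz, smul_eq_mul, smul_eq_mul]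
  linear_combination F₁ * h₂ + F₂ * h₁

/-- The power series `∑_{r ≥ 1} ω ^ r X ^ r`. -/
noncomputable def geomTail (ω : ℂ) : PowerSeries ℂ :=
  PowerSeries.mk fun r => if r = 0 then 0 else ω ^ r

theorem geomTail_mul (ω : ℂ) :
    geomTail ω * (1 - PowerSeries.C ω * PowerSeries.X) = PowerSeries.C ω * PowerSeries.X := by
  ext n
  rw [mul_sub, mul_one, map_sub, ← mul_assoc]
  rcases n with - | n
  · simp [geomTail]
  · rw [PowerSeries.coeff_succ_mul_X, PowerSeries.coeff_succ_mul_X, mul_comm,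
      PowerSeries.coeff_C_mul, PowerSeries.coeff_C]
    simp only [geomTail, PowerSeries.coeff_mk]
    rcases n with - | n
    · simp
    · simp
      ring

theorem X_mul_derivative_one_sub (ω : ℂ) :
    PowerSeries.X * d⁄dX ℂ (1 - PowerSeries.C ω * PowerSeries.X) =
      (-geomTail ω) * (1 - PowerSeries.C ω * PowerSeries.X) := by
  rw [neg_mul, geomTail_mul, map_sub, Derivation.leibniz]
  simp [PowerSeries.derivative_C, PowerSeries.derivative_X]
  ring

theorem X_mul_derivative_prod (s : Multiset ℂ) :
    PowerSeries.X * d⁄dX ℂ (s.map fun ω => 1 - PowerSeries.C ω * PowerSeries.X).prod =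
      (-(s.map geomTail).sum) * (s.map fun ω => 1 - PowerSeries.C ω * PowerSeries.X).prod := by
  induction s using Multiset.induction with
  | empty => simp
  | cons ω s ih =>
    rw [Multiset.map_cons, Multiset.prod_cons, Multiset.map_cons, Multiset.sum_cons, neg_add]
    exact X_mul_derivative_mul (X_mul_derivative_one_sub ω) ih

theorem exists_prod_one_sub (P : ℂ[X]) (h0 : P.coeff 0 = 1) {n : ℕ} (hn : P.natDegree ≤ n) :
    ∃ s : Multiset ℂ, s.card ≤ n ∧
      (P : PowerSeries ℂ) = (s.map fun ω => 1 - PowerSeries.C ω * PowerSeries.X).prod := by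
  have hP0 : P ≠ 0 := by rintro rfl; simp at h0
  have hs : P.Splits := IsAlgClosed.splits P
  have hne : ∀ a ∈ P.roots, a ≠ 0 := by
    rintro a ha rfl
    have := (mem_roots hP0).1 ha
    rw [IsRoot.def, ← coeff_zero_eq_eval_zero, h0] at this
    exact one_ne_zero this
  refine ⟨P.roots.map fun a => a⁻¹, by
    rw [Multiset.card_map]; exact (card_roots' P).trans hn, ?_⟩
  have h1 : P = C P.leadingCoeff * (P.roots.map fun a => X - C a).prod := hs.eq_prod_roots
  have h2 : ∀ s : Multiset ℂ, (∀ a ∈ s, a ≠ 0) → (s.map fun a => X - C a).prod =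
      C ((s.map fun a => -a).prod) * (s.map fun a => 1 - C a⁻¹ * X).prod := by
    intro s
    induction s using Multiset.induction with
    | empty => simp
    | cons a s ih =>
      intro h
      simp only [Multiset.map_cons, Multiset.prod_cons]
      rw [ih fun b hb => h b (Multiset.mem_cons_of_mem hb), C_mul]
      have : (X : ℂ[X]) - C a = C (-a) * (1 - C a⁻¹ * X) := by
        rw [mul_sub, ← mul_assoc, ← C_mul, neg_mul, mul_inv_cancel₀ (h a (by simp))]
        simp
        ring
      rw [this]
      ring
  rw [h2 _ hne, ← mul_assoc, ← C_mul] at h1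
  set b := P.leadingCoeff * (P.roots.map fun a => -a).prod
  have h3 : b = 1 := by
    have h4 := congrArg (fun Q : ℂ[X] => Q.coeff 0) h1
    simp only [h0, coeff_zero_eq_eval_zero, eval_mul, eval_C, eval_multiset_prod,
      Multiset.map_map] at h4
    have h5 : (P.roots.map (eval 0 ∘ fun a => 1 - C a⁻¹ * X)).prod = 1 := by
      simp
    rw [h5, mul_one] at h4
    exact h4.symm
  rw [h3, C_1, one_mul] at h1
  have := map_multiset_prod (Polynomial.coeToPowerSeries.ringHom (R := ℂ))
    (P.roots.map fun a => 1 - C a⁻¹ * X)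
  rw [Polynomial.coeToPowerSeries.ringHom_apply] at this
  rw [← h1] at this
  rw [this, Multiset.map_map, Multiset.map_map]
  refine congrArg _ (Multiset.map_congr rfl fun a _ => ?_)
  rw [Function.comp_apply, Function.comp_apply, map_sub, map_mul, map_one]
  simp only [Polynomial.coeToPowerSeries.ringHom_apply, Polynomial.coe_C, Polynomial.coe_X]

theorem X_mul_derivative_mk {a N : ℕ → ℕ}
    (hN : ∀ n, n * a n = ∑ r ∈ Finset.Icc 1 n, N r * a (n - r)) :
    PowerSeries.X * d⁄dX ℂ (PowerSeries.mk fun n => (a n : ℂ)) =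
      (PowerSeries.mk fun n => if n = 0 then 0 else (N n : ℂ)) *
        (PowerSeries.mk fun n => (a n : ℂ)) := by
  ext n
  rcases n with - | n
  · simp
  · rw [PowerSeries.coeff_succ_X_mul, PowerSeries.coeff_derivative, PowerSeries.coeff_mul,
      Finset.Nat.sum_antidiagonal_eq_sum_range_succ_mk, Finset.sum_range_succ']
    simp only [PowerSeries.coeff_mk]
    have h1 := congrArg (fun z : ℕ => (z : ℂ)) (hN (n + 1))
    simp only [Nat.cast_mul, Nat.cast_sum] at h1
    have h2 : Finset.Icc 1 (n + 1) = Finset.Ico 1 (n + 1 + 1) := by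
      ext
      simp only [Finset.mem_Icc, Finset.mem_Ico]
      omega
    rw [h2, Finset.sum_Ico_eq_sum_range] at h1
    rw [if_pos trivial, zero_mul, add_zero]
    refine Eq.trans ?_ (h1.trans ?_)
    · push_cast
      ring
    · refine Finset.sum_congr (by simp) fun i _ => ?_
      rw [if_neg (by omega), add_comm 1 i]

/-- From a two-term formula for the coefficients and the logarithmic derivative relation
one gets exponential sum expressions for the numbers `N r`. -/
theorem exists_eq_sum_pow {a N : ℕ → ℕ} {q p : ℕ} {C c : ℝ} (h0 : a 0 = 1)
    (ha : ∀ n, 2 * p ≤ n + 1 → (a n : ℝ) = C * (c * q ^ (n + 1) - 1)) (hp : p = 0 → c = 1)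
    (hZW : PowerSeries.X * d⁄dX ℂ (PowerSeries.mk fun n => (a n : ℂ)) =
      (PowerSeries.mk fun n => if n = 0 then 0 else (N n : ℂ)) *
        (PowerSeries.mk fun n => (a n : ℂ))) :
    ∃ s : Multiset ℂ, s.card ≤ 2 * p ∧
      ∀ r ≠ 0, (N r : ℂ) = (q : ℂ) ^ r + 1 - (s.map fun ω => ω ^ r).sum := by
  have hqc : ∀ n, 2 * p ≤ n + 1 → (a n : ℂ) = C * (c * q ^ (n + 1) - 1) := by
    intro n hn
    exact_mod_cast congrArg (fun z : ℝ => (z : ℂ)) (ha n hn)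
  set Z : PowerSeries ℂ := PowerSeries.mk fun n => (a n : ℂ) with hZ
  set W : PowerSeries ℂ := PowerSeries.mk fun n => if n = 0 then 0 else (N n : ℂ) with hW
  set F : PowerSeries ℂ := Z * (1 - PowerSeries.C 1 * PowerSeries.X) *
    (1 - PowerSeries.C (q : ℂ) * PowerSeries.X) with hF
  have hFW := X_mul_derivative_mul (X_mul_derivative_mul hZW (X_mul_derivative_one_sub 1))
    (X_mul_derivative_one_sub (q : ℂ))
  rw [← hF] at hFW
  have hF' : F = Z - PowerSeries.C ((q : ℂ) + 1) * (Z * PowerSeries.X) +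
      PowerSeries.C (q : ℂ) * (Z * PowerSeries.X * PowerSeries.X) := by
    rw [hF, map_add, map_one]
    ring
  have hF0 : PowerSeries.coeff 0 F = 1 := by
    rw [hF']
    simp [hZ, h0]
  have hFv : ∀ n, 2 * p + 1 ≤ n → PowerSeries.coeff n F = 0 := by
    intro n hn
    obtain ⟨n, rfl⟩ : ∃ n', n = n' + 1 := ⟨n - 1, by omega⟩
    rw [hF', map_add, map_sub, PowerSeries.coeff_C_mul, PowerSeries.coeff_C_mul,
      PowerSeries.coeff_succ_mul_X, PowerSeries.coeff_succ_mul_X]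
    rcases n with - | n
    · have hp0 : p = 0 := by omega
      have := hqc 0 (by omega)
      have h3 := hqc 1 (by omega)
      simp only [hZ, PowerSeries.coeff_mk, PowerSeries.coeff_zero_mul_X]
      rw [zero_add, h3, this, hp hp0]
      push_cast
      ring
    · rw [PowerSeries.coeff_succ_mul_X]
      simp only [hZ, PowerSeries.coeff_mk]
      rw [hqc n (by omega), hqc (n + 1) (by omega), hqc (n + 1 + 1) (by omega)]
      ring
  set P := PowerSeries.trunc (2 * p + 1) F with hP
  have hPF : (P : PowerSeries ℂ) = F := by
    ext n
    rw [Polynomial.coeff_coe, hP, PowerSeries.coeff_trunc]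
    split_ifs with h
    · rfl
    · exact (hFv n (by omega)).symm
  obtain ⟨s, hs, hsP⟩ := exists_prod_one_sub P (n := 2 * p)
    (by rw [← Polynomial.coeff_coe, hPF, hF0])
    (Nat.lt_succ_iff.1 (PowerSeries.natDegree_trunc_lt F (2 * p)))
  refine ⟨s, hs, fun r hr => ?_⟩
  have hF1 : F ≠ 0 := by
    intro h
    rw [h] at hF0
    simp at hF0
  have h5 := X_mul_derivative_prod s
  rw [← hsP, hPF, hFW] at h5
  have h6 := congrArg (PowerSeries.coeff r) (mul_right_cancel₀ hF1 h5)
  have h7 : ∀ s : Multiset ℂ, PowerSeries.coeff r (s.map geomTail).sum =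
      (s.map fun ω => ω ^ r).sum := by
    intro s
    induction s using Multiset.induction with
    | empty => simp
    | cons ω s ih => simp [ih, geomTail, hr]
  rw [map_neg, h7] at h6
  simp only [hW, geomTail, map_add, map_neg, PowerSeries.coeff_mk, if_neg hr, one_pow] at h6
  linear_combination h6

end LogDeriv

end PlaneCurve

namespace PlaneCurve

section PowerSums

open Filter

/-- Simultaneous recurrence: some arbitrarily large power of finitely many complex numbers
points in the positive direction. -/
theorem exists_re_pow_ge (s : Finset ℂ) (N : ℕ) :
    ∃ r > N, ∀ ω ∈ s, ‖ω‖ ^ r / 2 ≤ (ω ^ r).re := by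
  set v : ℕ → (s → ℂ) := fun n ω => ((ω : ℂ) / ‖(ω : ℂ)‖) ^ n with hv
  have hu : ∀ ω : ℂ, ‖ω / ‖ω‖‖ ≤ 1 := by
    intro ω
    rw [norm_div, Complex.norm_real, norm_norm]
    exact div_self_le_one _
  have hmem : ∀ n, v n ∈ Metric.closedBall (0 : s → ℂ) 1 := by
    intro n
    rw [mem_closedBall_zero_iff, pi_norm_le_iff_of_nonneg zero_le_one]
    intro ω
    rw [hv, norm_pow]
    exact pow_le_one₀ (norm_nonneg _) (hu _)
  obtain ⟨a, -, φ, hφ, hlim⟩ := (isCompact_closedBall (0 : s → ℂ) 1).tendsto_subseq hmem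
  obtain ⟨i, hi⟩ := Metric.cauchySeq_iff'.1 hlim.cauchySeq (1 / 2) (by norm_num)
  have hi := hi (i + (N + 1)) (by omega)
  have hlt : φ i + N < φ (i + (N + 1)) := by
    have : ∀ t, φ i + t ≤ φ (i + t) := by
      intro t
      induction t with
      | zero => exact le_rfl
      | succ t ih =>
        have := hφ (show i + t < i + (t + 1) by omega)
        omega
    have := this (N + 1)
    omega
  refine ⟨φ (i + (N + 1)) - φ i, by omega, fun ω hω => ?_⟩
  set r := φ (i + (N + 1)) - φ i with hr
  have hr' : φ (i + (N + 1)) = φ i + r := by omega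
  rcases eq_or_ne ω 0 with rfl | h0
  · have : r ≠ 0 := by omega
    simp [this]
  have hn : (0 : ℝ) < ‖ω‖ := norm_pos_iff.2 h0
  set u := ω / (‖ω‖ : ℂ) with hudef
  have hu1 : ‖u‖ = 1 := by
    rw [hudef, norm_div, Complex.norm_real, norm_norm, div_self hn.ne']
  have h1 : ‖u ^ r - 1‖ < 1 / 2 := by
    have h2 := (dist_pi_lt_iff (by norm_num)).1 hi ⟨ω, hω⟩
    rw [dist_eq_norm] at h2
    simp only [Function.comp_apply, hv, hr'] at h2
    have h3 : u ^ (φ i + r) - u ^ φ i = u ^ φ i * (u ^ r - 1) := by ring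
    rw [← hudef, h3, norm_mul, norm_pow, hu1, one_pow, one_mul] at h2
    exact h2
  have h2 : 1 / 2 ≤ (u ^ r).re := by
    have := (abs_lt.1 ((Complex.abs_re_le_norm _).trans_lt h1)).1
    rw [Complex.sub_re, Complex.one_re] at this
    linarith
  have h3 : ω ^ r = ((‖ω‖ ^ r : ℝ) : ℂ) * u ^ r := by
    rw [hudef, div_pow, Complex.ofReal_pow, mul_div_cancel₀]
    exact pow_ne_zero _ (by exact_mod_cast hn.ne')
  rw [h3, Complex.re_ofReal_mul]
  have := pow_pos hn r
  nlinarith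

theorem norm_le_of_norm_sum_pow_le {s : Multiset ℂ} {C R : ℝ} (hR : 0 < R)
    (h : ∀ r ≠ 0, ‖(s.map fun ω => ω ^ r).sum‖ ≤ C * R ^ r) : ∀ ω ∈ s, ‖ω‖ ≤ R := by
  classical
  intro ω hω
  by_contra! hlt
  obtain ⟨N, hN⟩ := pow_unbounded_of_one_lt (2 * C) ((one_lt_div hR).2 hlt)
  obtain ⟨r, hr, hre⟩ := exists_re_pow_ge s.toFinset N
  have h1 : ‖ω‖ ^ r / 2 ≤ (s.map fun ω => ω ^ r).sum.re := by
    obtain ⟨t, rfl⟩ := Multiset.exists_cons_of_mem hω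
    have h2 : ∀ t : Multiset ℂ, (∀ ω ∈ t, ‖ω‖ ^ r / 2 ≤ (ω ^ r).re) →
        0 ≤ (t.map fun ω => ω ^ r).sum.re := by
      intro t
      induction t using Multiset.induction with
      | empty => simp
      | cons a t ih =>
        intro ht
        rw [Multiset.map_cons, Multiset.sum_cons, Complex.add_re]
        have h3 := ht a (by simp)
        have h4 := ih fun b hb => ht b (by simp [hb])
        have : 0 ≤ ‖a‖ ^ r / 2 := by positivity
        linarith
    rw [Multiset.map_cons, Multiset.sum_cons, Complex.add_re]
    have h3 := hre ω (by simp)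
    have h4 := h2 t fun b hb => hre b (by simp [hb])
    linarith
  have h2 := (h1.trans (Complex.re_le_norm _)).trans
    (h r (by omega))
  have h3 : (‖ω‖ / R) ^ r ≤ 2 * C := by
    rw [div_pow, div_le_iff₀ (pow_pos hR r)]
    linarith
  have h4 : (‖ω‖ / R) ^ N ≤ (‖ω‖ / R) ^ r :=
    pow_le_pow_right₀ ((one_lt_div hR).2 hlt).le hr.le
  linarith

theorem norm_sum_pow_one_le {s : Multiset ℂ} {R : ℝ} {n : ℕ} (hs : s.card ≤ n)
    (h : ∀ ω ∈ s, ‖ω‖ ≤ R) (hR : 0 ≤ R) : ‖s.sum‖ ≤ n * R := by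
  have h1 : ‖s.sum‖ ≤ s.card * R := by
    induction s using Multiset.induction with
    | empty => simp
    | cons a t ih =>
      rw [Multiset.sum_cons, Multiset.card_cons]
      have h2 := h a (by simp)
      have h3 := ih (by rw [Multiset.card_cons] at hs; omega) fun b hb => h b (by simp [hb])
      push_cast
      linarith [norm_add_le a t.sum]
  exact h1.trans (mul_le_mul_of_nonneg_right (by exact_mod_cast hs) hR)

end PowerSums

end PlaneCurve

namespace PlaneCurve

section Chi

variable {V : Type*} [AddCommGroup V] {X X' Y Y' : AddSubgroup V} {c c' : ℝ}

/-- The multiplicative Euler characteristic of a pair of subgroups: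
`|X ∩ Y| / [V : X + Y] = c`, both numbers being finite. -/
def HasChi (X Y : AddSubgroup V) (c : ℝ) : Prop :=
  Nat.card ↥(X ⊓ Y) ≠ 0 ∧ (X ⊔ Y).index ≠ 0 ∧ (Nat.card ↥(X ⊓ Y) : ℝ) = c * (X ⊔ Y).index

theorem HasChi.symm (h : HasChi X Y c) : HasChi Y X c := by
  rwa [HasChi, inf_comm, sup_comm]

theorem HasChi.pos (h : HasChi X Y c) : 0 < c := by
  obtain ⟨h1, h2, h3⟩ := h
  have h4 : (0 : ℝ) < Nat.card ↥(X ⊓ Y) := by exact_mod_cast Nat.pos_of_ne_zero h1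
  have h5 : (0 : ℝ) < (X ⊔ Y).index := by exact_mod_cast Nat.pos_of_ne_zero h2
  rw [h3] at h4
  exact pos_of_mul_pos_left h4 h5.le

theorem HasChi.unique (h : HasChi X Y c) (h' : HasChi X Y c') : c = c' := by
  have h5 : ((X ⊔ Y).index : ℝ) ≠ 0 := by exact_mod_cast h.2.1
  exact mul_right_cancel₀ h5 (h.2.2.symm.trans h'.2.2)

theorem relIndex_inf_mul_relIndex_sup (hX : X ≤ X') :
    (X ⊓ Y).relIndex (X' ⊓ Y) * (X ⊔ Y).relIndex (X' ⊔ Y) = X.relIndex X' := by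
  have h1 : (X ⊓ Y).relIndex (X' ⊓ Y) = X.relIndex (X ⊔ X' ⊓ Y) := by
    rw [sup_comm, AddSubgroup.relIndex_sup_right, ← AddSubgroup.inf_relIndex_right X (X' ⊓ Y),
      ← inf_assoc, inf_eq_left.2 hX]
  have h2 : (X ⊔ Y).relIndex (X' ⊔ Y) = (X ⊔ X' ⊓ Y).relIndex X' := by
    have h3 : X' ⊔ Y = X' ⊔ (X ⊔ Y) := by rw [← sup_assoc, sup_eq_left.2 hX]
    rw [h3, AddSubgroup.relIndex_sup_right, ← AddSubgroup.inf_relIndex_right,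
      sup_inf_assoc_of_le Y hX, inf_comm]
  rw [h1, h2]
  exact AddSubgroup.relIndex_mul_relIndex _ _ _ le_sup_left (sup_le hX inf_le_left)

theorem hasChi_iff_of_le (hX : X ≤ X') (h0 : X.relIndex X' ≠ 0) :
    HasChi X' Y (X.relIndex X' * c) ↔ HasChi X Y c := by
  have h1 := relIndex_inf_mul_relIndex_sup (Y := Y) hX
  have h2 : Nat.card ↥(X ⊓ Y) * (X ⊓ Y).relIndex (X' ⊓ Y) = Nat.card ↥(X' ⊓ Y) := by
    rw [← AddSubgroup.relIndex_bot_left, ← AddSubgroup.relIndex_bot_left]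
    exact AddSubgroup.relIndex_mul_relIndex _ _ _ bot_le (inf_le_inf_right _ hX)
  have h3 : (X ⊔ Y).relIndex (X' ⊔ Y) * (X' ⊔ Y).index = (X ⊔ Y).index :=
    AddSubgroup.relIndex_mul_index (sup_le_sup_right hX _)
  rw [HasChi, HasChi, ← h2, ← h3, ← h1]
  rw [← h1] at h0
  set u := (X ⊓ Y).relIndex (X' ⊓ Y)
  set v := (X ⊔ Y).relIndex (X' ⊔ Y)
  have hu : u ≠ 0 := left_ne_zero_of_mul h0
  have hv : v ≠ 0 := right_ne_zero_of_mul h0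
  have hu' : (u : ℝ) ≠ 0 := by exact_mod_cast hu
  simp only [ne_eq, mul_eq_zero, hu, hv, or_false, false_or]
  refine and_congr_right fun _ => and_congr_right fun _ => ?_
  push_cast
  constructor
  · intro h
    refine mul_right_cancel₀ hu' ?_
    linear_combination h
  · intro h
    linear_combination (u : ℝ) * h

theorem HasChi.of_le (h : HasChi X Y c) (hX : X ≤ X') (h0 : X.relIndex X' ≠ 0) :
    HasChi X' Y (X.relIndex X' * c) :=
  (hasChi_iff_of_le hX h0).2 h

theorem HasChi.of_ge (h : HasChi X' Y c) (hX : X ≤ X') (h0 : X.relIndex X' ≠ 0) :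
    HasChi X Y (c / X.relIndex X') := by
  refine (hasChi_iff_of_le hX h0).1 ?_
  have : (X.relIndex X' : ℝ) ≠ 0 := by exact_mod_cast h0
  rwa [mul_div_cancel₀ _ this]

theorem HasChi.map_equiv (h : HasChi X Y c) (e : V ≃+ V) :
    HasChi (X.map e.toAddMonoidHom) (Y.map e.toAddMonoidHom) c := by
  have h1 : Nat.card ↥(X.map e.toAddMonoidHom ⊓ Y.map e.toAddMonoidHom) =
      Nat.card ↥(X ⊓ Y) := by
    rw [← AddSubgroup.map_inf_eq _ _ _ e.injective]
    exact (Nat.card_congr ((X ⊓ Y).equivMapOfInjective _ e.injective).toEquiv).symm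
  have h2 : (X.map e.toAddMonoidHom ⊔ Y.map e.toAddMonoidHom).index = (X ⊔ Y).index := by
    rw [← AddSubgroup.map_sup]
    exact AddSubgroup.index_map_equiv _ e
  rw [HasChi, h1, h2]
  exact h

end Chi

end PlaneCurve

namespace PlaneCurve

section TwoChart

/-- Multiplication by a nonzero field element. -/
def mulEquiv {K : Type*} [Field K] (s : K) (hs : s ≠ 0) : K ≃+ K :=
  { Equiv.mulLeft₀ s hs with map_add' := mul_add s }

/-- The additive subgroup `s • X`. -/
def scale {K : Type*} [Field K] (s : K) (hs : s ≠ 0) (X : AddSubgroup K) : AddSubgroup K :=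
  X.map (mulEquiv s hs).toAddMonoidHom

theorem mem_scale {K : Type*} [Field K] {s : K} {hs : s ≠ 0} {X : AddSubgroup K} {t : K} :
    t ∈ scale s hs X ↔ ∃ u ∈ X, s * u = t := Iff.rfl

theorem scale_mono {K : Type*} [Field K] {s : K} {hs : s ≠ 0} {X Y : AddSubgroup K} (h : X ≤ Y) :
    scale s hs X ≤ scale s hs Y := AddSubgroup.map_mono h

theorem relIndex_scale {K : Type*} [Field K] {s : K} {hs : s ≠ 0} (X Y : AddSubgroup K) :
    (scale s hs X).relIndex (scale s hs Y) = X.relIndex Y :=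
  AddSubgroup.relIndex_map_map_of_injective _ _ (mulEquiv s hs).injective

/-- The image of an ideal in an overfield. -/
def img (K : Type*) [Field K] {B : Type*} [CommRing B] [Algebra B K] (I : Ideal B) :
    AddSubgroup K :=
  I.toAddSubgroup.map (algebraMap B K).toAddMonoidHom

theorem mem_img {K : Type*} [Field K] {B : Type*} [CommRing B] [Algebra B K] {I : Ideal B}
    {t : K} : t ∈ img K I ↔ ∃ b ∈ I, algebraMap B K b = t := Iff.rfl

theorem img_mono {K : Type*} [Field K] {B : Type*} [CommRing B] [Algebra B K] {I J : Ideal B}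
    (h : I ≤ J) : img K I ≤ img K J := AddSubgroup.map_mono h

theorem scale_img_span {K : Type*} [Field K] {B : Type*} [CommRing B] [Algebra B K] (b : B)
    {s t : K} (hs : s ≠ 0) (ht : t ≠ 0) (h : s * algebraMap B K b = t) :
    scale s hs (img K (Ideal.span {b})) = scale t ht (img K (⊤ : Ideal B)) := by
  ext u
  simp only [mem_scale, mem_img]
  constructor
  · rintro ⟨_, ⟨c, hc, rfl⟩, rfl⟩
    obtain ⟨c, rfl⟩ := Ideal.mem_span_singleton'.1 hc
    exact ⟨_, ⟨c, trivial, rfl⟩, by rw [← h, map_mul]; ring⟩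
  · rintro ⟨_, ⟨c, -, rfl⟩, rfl⟩
    exact ⟨_, ⟨b * c, Ideal.mul_mem_right _ _ (Ideal.mem_span_singleton_self b), rfl⟩, by
      rw [← h, map_mul]; ring⟩

theorem scale_one {K : Type*} [Field K] (X : AddSubgroup K) : scale 1 one_ne_zero X = X := by
  ext t
  simp [mem_scale]

/-- The data of a projective curve covered by two affine pieces, one of them semilocal,
together with the Riemann-Roch type facts on which the count of divisors rests. -/
structure TwoChart (k : Type*) [Field k] {B C K : Type*} [CommRing B] [CommRing C] [Field K]
    [Algebra k B] [Algebra k C] [Algebra B K] [Algebra C K] (x : K) (hx : x ≠ 0) (w : C)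
    (d p : ℕ) (γ : ℝ) : Prop where
  injB : Function.Injective (algebraMap B K)
  injC : Function.Injective (algebraMap C K)
  hw : x * algebraMap C K w = 1
  hd : ideg k (Ideal.span {w}) = d
  chi : HasChi (img K (⊤ : Ideal B)) (img K (⊤ : Ideal C)) γ
  le_chi : (Nat.card k : ℝ) ≤ γ * (Nat.card k : ℝ) ^ p
  vanish : ∀ (I : Ideal B) (J : Ideal C) (m : ℕ), I ≠ ⊥ → J ≠ ⊥ →
    img K I ⊔ scale (x ^ m) (pow_ne_zero m hx) (img K J) ≠ ⊤ →
      Nat.card ↥(img K I ⊓ scale (x ^ m) (pow_ne_zero m hx) (img K J)) ≤ Nat.card k ^ p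

theorem relIndex_img_top {k : Type*} [Field k] {K B : Type*} [Field K] [CommRing B] [Algebra B K]
    [Algebra k B] [Finite k] [IsDedekindDomain B] [Ring.HasFiniteQuotients B]
    (h : Function.Injective (algebraMap B K)) {I : Ideal B} (hI : I ≠ ⊥) :
    (img K I).relIndex (img K (⊤ : Ideal B)) = Nat.card k ^ ideg k I := by
  rw [← cardQuot_eq_pow k hI, img, img, AddSubgroup.relIndex_map_map_of_injective]
  · exact AddSubgroup.relIndex_top_right _
  · exact h

namespace TwoChart

variable {k : Type*} [Field k] {B C K : Type*} [CommRing B] [CommRing C] [Field K]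
  [Algebra k B] [Algebra k C] [Algebra B K] [Algebra C K] {x : K} {hx : x ≠ 0} {w : C}
  {d p : ℕ} {γ : ℝ} [Finite k] [IsDedekindDomain B] [Ring.HasFiniteQuotients B]
  [IsDedekindDomain C] [Ring.HasFiniteQuotients C] [Infinite C]

theorem hasChi (h : TwoChart k (B := B) x hx w d p γ) {I : Ideal B} {J : Ideal C} (hI : I ≠ ⊥)
    (hJ : J ≠ ⊥) (m : ℕ) :
    HasChi (img K I) (scale (x ^ m) (pow_ne_zero m hx) (img K J))
      (γ * (Nat.card k : ℝ) ^ (m * d) / (Nat.card k : ℝ) ^ (ideg k I + ideg k J)) := by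
  have hq : Nat.card k ≠ 0 := Nat.card_pos.ne'
  have hw0 : w ≠ 0 := by
    rintro rfl
    simpa using h.hw
  have h1 : scale (x ^ m) (pow_ne_zero m hx) (img K (Ideal.span {w ^ m})) =
      img K (⊤ : Ideal C) := by
    rw [scale_img_span (w ^ m) (pow_ne_zero m hx) one_ne_zero, scale_one]
    rw [map_pow, ← mul_pow, h.hw, one_pow]
  have hwm : Ideal.span {w ^ m} ≠ ⊥ := by simpa using pow_ne_zero m hw0
  have h2 : (img K (⊤ : Ideal C)).relIndex (scale (x ^ m) (pow_ne_zero m hx)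
      (img K (⊤ : Ideal C))) = Nat.card k ^ (m * d) := by
    have h3 := relIndex_scale (hs := pow_ne_zero m hx) (img K (Ideal.span {w ^ m}))
      (img K (⊤ : Ideal C))
    rw [h1] at h3
    rw [h3, relIndex_img_top (k := k) h.injC hwm, ← Ideal.span_singleton_pow,
      ideg_pow, h.hd]
    simpa using hw0
  have h3 := h.chi.symm.of_le (X' := scale (x ^ m) (pow_ne_zero m hx) (img K (⊤ : Ideal C)))
    (h1.symm.le.trans (scale_mono (img_mono le_top))) (by rw [h2]; exact pow_ne_zero _ hq)
  have h4 := h3.of_ge (X := scale (x ^ m) (pow_ne_zero m hx) (img K J))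
    (scale_mono (img_mono le_top))
    (by rw [relIndex_scale, relIndex_img_top (k := k) h.injC hJ]; exact pow_ne_zero _ hq)
  have h5 := h4.symm.of_ge (X := img K I) (img_mono le_top)
    (by rw [relIndex_img_top (k := k) h.injB hI]; exact pow_ne_zero _ hq)
  rw [relIndex_scale, relIndex_img_top (k := k) h.injC hJ,
    relIndex_img_top (k := k) h.injB hI, h2] at h5
  convert h5 using 1
  push_cast
  rw [pow_add, div_div, mul_comm γ, mul_comm (_ ^ ideg k I)]

theorem card_eq (h : TwoChart k (B := B) x hx w d p γ) {I : Ideal B} {J : Ideal C} (hI : I ≠ ⊥)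
    (hJ : J ≠ ⊥) (m : ℕ) (hm : ideg k I + ideg k J + 2 * p ≤ m * d + 1) :
    (Nat.card ↥(img K I ⊓ scale (x ^ m) (pow_ne_zero m hx) (img K J)) : ℝ) =
      γ / Nat.card k * (Nat.card k : ℝ) ^ (m * d + 1 - (ideg k I + ideg k J)) := by
  have hq : (1 : ℝ) < Nat.card k := by exact_mod_cast Finite.one_lt_card (α := k)
  have hq0 : (0 : ℝ) < Nat.card k := by linarith
  have h1 := h.hasChi hI hJ m
  set e := m * d + 1 - (ideg k I + ideg k J) with he
  have h2 : γ * (Nat.card k : ℝ) ^ (m * d) / (Nat.card k : ℝ) ^ (ideg k I + ideg k J) =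
      γ / Nat.card k * (Nat.card k : ℝ) ^ e := by
    rw [div_mul_eq_mul_div, div_eq_div_iff (by positivity) (by positivity), mul_assoc, mul_assoc,
      ← pow_succ, ← pow_add]
    congr 2
    omega
  rw [h2] at h1
  obtain ⟨h3, h4, h5⟩ := h1
  by_cases htop : img K I ⊔ scale (x ^ m) (pow_ne_zero m hx) (img K J) = ⊤
  · rw [h5, htop, AddSubgroup.index_top, Nat.cast_one, mul_one]
  exfalso
  have h6 := h.vanish I J m hI hJ htop
  have h7 : 2 ≤ (img K I ⊔ scale (x ^ m) (pow_ne_zero m hx) (img K J)).index := by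
    have : (img K I ⊔ scale (x ^ m) (pow_ne_zero m hx) (img K J)).index ≠ 1 :=
      fun h => htop (AddSubgroup.index_eq_one.1 h)
    omega
  have h8 : (Nat.card ↥(img K I ⊓ scale (x ^ m) (pow_ne_zero m hx) (img K J)) : ℝ) ≤
      (Nat.card k : ℝ) ^ p := by exact_mod_cast h6
  have h9 : (2 : ℝ) ≤ (img K I ⊔ scale (x ^ m) (pow_ne_zero m hx) (img K J)).index := by
    exact_mod_cast h7
  have h10 : (Nat.card k : ℝ) ^ p ≤ γ / Nat.card k * (Nat.card k : ℝ) ^ e := by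
    calc (Nat.card k : ℝ) ^ p ≤ γ * (Nat.card k : ℝ) ^ p / Nat.card k * (Nat.card k : ℝ) ^ p := by
          refine le_mul_of_one_le_left (by positivity) ?_
          rw [one_le_div hq0]
          exact h.le_chi
      _ = γ / Nat.card k * (Nat.card k : ℝ) ^ (2 * p) := by ring
      _ ≤ _ := by
          refine mul_le_mul_of_nonneg_left (pow_le_pow_right₀ hq.le (by omega)) ?_
          exact div_nonneg h.chi.pos.le hq0.le
  have h11 : 0 < (Nat.card k : ℝ) ^ p := by positivity
  rw [h5] at h8
  nlinarith

theorem ideg_add_ideg (h : TwoChart k (B := B) x hx w d p γ) {b : B} {c : C} {m : ℕ}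
    (hb : b ≠ 0) (hbc : algebraMap B K b = x ^ m * algebraMap C K c) :
    ideg k (Ideal.span {b}) + ideg k (Ideal.span {c}) = m * d := by
  have hs : algebraMap B K b ≠ 0 := fun h0 => hb (h.injB (h0.trans (map_zero _).symm))
  have hc : c ≠ 0 := by
    rintro rfl
    rw [map_zero, mul_zero] at hbc
    exact hs hbc
  have h1 := h.chi.map_equiv (mulEquiv _ hs)
  have h2 := h.hasChi (I := Ideal.span {b}) (J := Ideal.span {c}) (by simpa using hb)
    (by simpa using hc) m
  rw [scale_img_span c (pow_ne_zero m hx) hs hbc.symm, ← scale_one (img K (Ideal.span {b})),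
    scale_img_span b one_ne_zero hs (one_mul _)] at h2
  have h3 := h1.unique h2
  have hq : (1 : ℝ) < Nat.card k := by exact_mod_cast Finite.one_lt_card (α := k)
  have h4 := h.chi.pos
  rw [eq_div_iff (by positivity)] at h3
  have h5 := mul_left_cancel₀ h4.ne' h3
  exact Nat.pow_right_injective (Finite.one_lt_card (α := k)) (by exact_mod_cast h5)

end TwoChart

end TwoChart

end PlaneCurve

namespace PlaneCurve

open scoped nonZeroDivisors

section DivisorCount

variable {k : Type*} [Field k] {B C K : Type*} [CommRing B] [CommRing C] [Field K]
  [Algebra k B] [Algebra k C] [Algebra B K] [Algebra C K] {x : K} {hx : x ≠ 0} {w : C}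
  {d p : ℕ} {γ : ℝ} [Finite k] [IsDedekindDomain B] [Ring.HasFiniteQuotients B]
  [IsDedekindDomain C] [Ring.HasFiniteQuotients C] [Infinite C] [Infinite B]

variable (k) in
/-- The degree of an effective divisor, given as a pair of nonzero ideals. -/
noncomputable def divDeg (D : (Ideal B)⁰ × (Ideal C)⁰) : ℕ :=
  ideg k (D.1 : Ideal B) + ideg k (D.2 : Ideal C)

theorem divDeg_mul (D E : (Ideal B)⁰ × (Ideal C)⁰) :
    divDeg k (D * E) = divDeg k D + divDeg k E := by
  simp only [divDeg, Prod.fst_mul, Prod.snd_mul, Submonoid.coe_mul]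
  rw [ideg_mul k (nonZeroDivisors.coe_ne_zero D.1) (nonZeroDivisors.coe_ne_zero E.1),
    ideg_mul k (nonZeroDivisors.coe_ne_zero D.2) (nonZeroDivisors.coe_ne_zero E.2)]
  ring

theorem div_mul_left_cancel (D E F : (Ideal B)⁰ × (Ideal C)⁰) (h : D * E = D * F) : E = F := by
  obtain ⟨h1, h2⟩ := Prod.ext_iff.1 h
  refine Prod.ext (Subtype.ext ?_) (Subtype.ext ?_)
  · exact mul_left_cancel₀ (nonZeroDivisors.coe_ne_zero D.1) (congrArg Subtype.val h1)
  · exact mul_left_cancel₀ (nonZeroDivisors.coe_ne_zero D.2) (congrArg Subtype.val h2)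

omit [Infinite C] [Infinite B] in
theorem finite_and_ncard_divDeg (n : ℕ) :
    {D : (Ideal B)⁰ × (Ideal C)⁰ | divDeg k D = n}.Finite ∧
    {D : (Ideal B)⁰ × (Ideal C)⁰ | divDeg k D = n}.ncard = ∑ ij ∈ Finset.HasAntidiagonal.antidiagonal n,
      (idealsOfDeg k B ij.1).card * (idealsOfDeg k C ij.2).card := by
  classical
  set ι := fun D : (Ideal B)⁰ × (Ideal C)⁰ => ((D.1 : Ideal B), (D.2 : Ideal C))
  have hι : Function.Injective ι := fun D E h => by
    obtain ⟨h1, h2⟩ := Prod.ext_iff.1 h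
    exact Prod.ext (Subtype.ext h1) (Subtype.ext h2)
  have himg : ι '' {D | divDeg k D = n} = ((Finset.HasAntidiagonal.antidiagonal n).biUnion
      fun ij => idealsOfDeg k B ij.1 ×ˢ idealsOfDeg k C ij.2 : Finset (Ideal B × Ideal C)) := by
    ext ⟨I, J⟩
    simp only [Set.mem_image, Finset.coe_biUnion, Set.mem_iUnion, Finset.mem_coe,
      Finset.mem_product, mem_idealsOfDeg, Finset.HasAntidiagonal.mem_antidiagonal, Set.mem_ofPred_eq]
    constructor
    · rintro ⟨D, hD, h⟩
      obtain ⟨rfl, rfl⟩ := Prod.ext_iff.1 h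
      exact ⟨(_, _), hD, ⟨nonZeroDivisors.coe_ne_zero D.1, rfl⟩,
        ⟨nonZeroDivisors.coe_ne_zero D.2, rfl⟩⟩
    · rintro ⟨⟨i, j⟩, hij, ⟨hI, rfl⟩, ⟨hJ, rfl⟩⟩
      exact ⟨(⟨I, mem_nonZeroDivisors_of_ne_zero hI⟩, ⟨J, mem_nonZeroDivisors_of_ne_zero hJ⟩),
        hij, rfl⟩
  refine ⟨Set.Finite.of_finite_image (himg ▸ Finset.finite_toSet _) hι.injOn, ?_⟩
  rw [← Set.ncard_image_of_injective _ hι, himg, Set.ncard_coe_finset, Finset.card_biUnion]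
  · exact Finset.sum_congr rfl fun _ _ => Finset.card_product _ _
  · intro a _ b _ hab
    rw [Function.onFun, Finset.disjoint_left]
    rintro ⟨I, J⟩ h1 h2
    simp only [Finset.mem_product, mem_idealsOfDeg] at h1 h2
    exact hab (Prod.ext (h1.1.2.symm.trans h2.1.2) (h1.2.2.symm.trans h2.2.2))

omit [Infinite C] [Infinite B] in
theorem ncard_divDeg_zero : {D : (Ideal B)⁰ × (Ideal C)⁰ | divDeg k D = 0}.ncard = 1 := by
  rw [Set.ncard_eq_one]
  refine ⟨1, Set.eq_singleton_iff_unique_mem.2 ⟨?_, fun D hD => ?_⟩⟩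
  · simp [divDeg, Ideal.one_eq_top, ideg_top]
  · simp only [Set.mem_ofPred_eq, divDeg, Nat.add_eq_zero_iff] at hD
    refine Prod.ext (Subtype.ext ?_) (Subtype.ext ?_)
    · by_contra h
      exact (ideg_pos k (nonZeroDivisors.coe_ne_zero D.1)
        fun ht => h (ht.trans Ideal.one_eq_top.symm)).ne' hD.1
    · by_contra h
      exact (ideg_pos k (nonZeroDivisors.coe_ne_zero D.2)
        fun ht => h (ht.trans Ideal.one_eq_top.symm)).ne' hD.2

open scoped PowerSeries in
theorem X_mul_derivative_divisors :
    PowerSeries.X * d⁄dX ℂ (PowerSeries.mk fun n =>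
        ({D : (Ideal B)⁰ × (Ideal C)⁰ | divDeg k D = n}.ncard : ℂ)) =
      (PowerSeries.mk fun n => if n = 0 then 0 else
        ((primeSum k B n + primeSum k C n : ℕ) : ℂ)) *
        (PowerSeries.mk fun n =>
          ({D : (Ideal B)⁰ × (Ideal C)⁰ | divDeg k D = n}.ncard : ℂ)) := by
  have h1 := X_mul_derivative_mul (X_mul_derivative_mk (mul_card_idealsOfDeg k (S := B)))
    (X_mul_derivative_mk (mul_card_idealsOfDeg k (S := C)))
  have h2 : (PowerSeries.mk fun n => ((idealsOfDeg k B n).card : ℂ)) *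
      (PowerSeries.mk fun n => ((idealsOfDeg k C n).card : ℂ)) = PowerSeries.mk fun n =>
        ({D : (Ideal B)⁰ × (Ideal C)⁰ | divDeg k D = n}.ncard : ℂ) := by
    ext n
    rw [PowerSeries.coeff_mul, PowerSeries.coeff_mk, (finite_and_ncard_divDeg n).2]
    push_cast
    simp only [PowerSeries.coeff_mk]
  have h3 : (PowerSeries.mk fun n => if n = 0 then 0 else (primeSum k B n : ℂ)) +
      (PowerSeries.mk fun n => if n = 0 then 0 else (primeSum k C n : ℂ)) =
      PowerSeries.mk fun n => if n = 0 then 0 else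
        ((primeSum k B n + primeSum k C n : ℕ) : ℂ) := by
    ext n
    simp only [map_add, PowerSeries.coeff_mk]
    split_ifs <;> simp
  rw [h2, h3] at h1
  exact h1

/-- The numbers of points over the extensions of the constant field are given by exponential
sums with at most `2 p` terms. -/
theorem TwoChart.exists_primeSum_eq (h : TwoChart k (B := B) x hx w d p γ) (hd : 0 < d)
    (hlarge : ∃ R, ∀ r ≥ R, ∃ P : Ideal B, P ≠ ⊥ ∧ P.IsPrime ∧ ideg k P ∣ r) :
    ∃ s : Multiset ℂ, s.card ≤ 2 * p ∧ ∀ r ≠ 0,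
      ((primeSum k B r + primeSum k C r : ℕ) : ℂ) =
        (Nat.card k : ℂ) ^ r + 1 - (s.map fun ω => ω ^ r).sum := by
  classical
  set S : ℕ → Type _ := fun m => {s : K // s ∈ img K (⊤ : Ideal B) ⊓
    scale (x ^ m) (pow_ne_zero m hx) (img K (⊤ : Ideal C)) ∧ s ≠ 0} with hS
  have hfinS : ∀ m, Finite (S m) := by
    intro m
    have h1 := (h.hasChi (I := ⊤) (J := ⊤) top_ne_bot top_ne_bot m).1
    have := Nat.finite_of_card_ne_zero h1
    exact Finite.of_injective (β := ↥(img K (⊤ : Ideal B) ⊓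
      scale (x ^ m) (pow_ne_zero m hx) (img K (⊤ : Ideal C)))) (fun s => ⟨s.1, s.2.1⟩)
      fun s t hst => Subtype.ext (Subtype.mk.inj hst)
  have hex : ∀ m (s : S m), ∃ b : B, ∃ c : C, b ≠ 0 ∧ c ≠ 0 ∧ algebraMap B K b = s.1 ∧
      x ^ m * algebraMap C K c = s.1 := by
    rintro m ⟨s, ⟨⟨b, -, hb⟩, ⟨_, ⟨c, -, rfl⟩, hc⟩⟩, hs⟩
    refine ⟨b, c, ?_, ?_, hb, hc⟩
    · rintro rfl
      exact hs (hb.symm.trans (map_zero _))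
    · rintro rfl
      refine hs (hc.symm.trans ?_)
      simp
  choose b c hb hc hbs hcs using hex
  set div : ∀ m, S m → (Ideal B)⁰ × (Ideal C)⁰ := fun m s =>
    (⟨Ideal.span {b m s}, mem_nonZeroDivisors_of_ne_zero (by simpa using hb m s)⟩,
      ⟨Ideal.span {c m s}, mem_nonZeroDivisors_of_ne_zero (by simpa using hc m s)⟩) with hdiv
  have hdvd : ∀ m s (D : (Ideal B)⁰ × (Ideal C)⁰), D ∣ div m s ↔
      s.1 ∈ img K (D.1 : Ideal B) ⊓ scale (x ^ m) (pow_ne_zero m hx) (img K (D.2 : Ideal C)) := by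
    intro m s D
    have h1 : D ∣ div m s ↔ b m s ∈ (D.1 : Ideal B) ∧ c m s ∈ (D.2 : Ideal C) := by
      rw [← Ideal.dvd_span_singleton, ← Ideal.dvd_span_singleton]
      constructor
      · rintro ⟨E, hE⟩
        exact ⟨⟨E.1, congrArg (fun z => (z.1 : Ideal B)) hE⟩,
          ⟨E.2, congrArg (fun z => (z.2 : Ideal C)) hE⟩⟩
      · rintro ⟨⟨I, hI⟩, ⟨J, hJ⟩⟩
        have hI0 : I ≠ 0 := by
          rintro rfl
          rw [mul_zero] at hI
          exact hb m s (by simpa using hI)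
        have hJ0 : J ≠ 0 := by
          rintro rfl
          rw [mul_zero] at hJ
          exact hc m s (by simpa using hJ)
        exact ⟨(⟨I, mem_nonZeroDivisors_of_ne_zero hI0⟩, ⟨J, mem_nonZeroDivisors_of_ne_zero hJ0⟩),
          Prod.ext (Subtype.ext hI) (Subtype.ext hJ)⟩
    rw [h1, AddSubgroup.mem_inf, mem_img, mem_scale]
    constructor
    · rintro ⟨h2, h3⟩
      exact ⟨⟨_, h2, hbs m s⟩, _, ⟨_, h3, rfl⟩, hcs m s⟩
    · rintro ⟨⟨b', h2, h3⟩, _, ⟨c', h4, rfl⟩, h5⟩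
      have h6 := h.injB (h3.trans (hbs m s).symm)
      have h7 := h.injC (mul_left_cancel₀ (pow_ne_zero m hx) (h5.trans (hcs m s).symm))
      exact ⟨h6 ▸ h2, h7 ▸ h4⟩
  have hcard : ∀ m (D : (Ideal B)⁰ × (Ideal C)⁰), divDeg k D + 2 * p ≤ m * d + 1 →
      (Nat.card {s : S m // D ∣ div m s} : ℝ) =
        γ / Nat.card k * (Nat.card k : ℝ) ^ (m * d + 1 - divDeg k D) - 1 := by
    intro m D hD
    have hI := nonZeroDivisors.coe_ne_zero D.1
    have hJ := nonZeroDivisors.coe_ne_zero D.2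
    rw [divDeg, ← h.card_eq hI hJ m hD]
    set T := img K (D.1 : Ideal B) ⊓ scale (x ^ m) (pow_ne_zero m hx) (img K (D.2 : Ideal C))
      with hT
    have hT0 : Nat.card T ≠ 0 := (h.hasChi hI hJ m).1
    have := Nat.finite_of_card_ne_zero hT0
    have := Fintype.ofFinite T
    have h1 : Nat.card {s : S m // D ∣ div m s} = Nat.card {t : T // t ≠ 0} := by
      refine Nat.card_congr ⟨fun s => ⟨⟨s.1.1, (hdvd m _ D).1 s.2⟩, fun h0 => s.1.2.2
        (congrArg Subtype.val h0)⟩, fun t => ⟨⟨t.1.1, ⟨inf_le_inf (img_mono le_top)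
        (scale_mono (img_mono le_top)) t.1.2, fun h0 => t.2 (Subtype.ext h0)⟩⟩,
        (hdvd m _ D).2 t.1.2⟩, fun s => rfl, fun t => rfl⟩
    rw [h1, Nat.card_eq_fintype_card, Nat.card_eq_fintype_card, Fintype.card_subtype_compl,
      Fintype.card_subtype_eq, Nat.cast_sub, Nat.cast_one]
    rw [Nat.card_eq_fintype_card] at hT0
    omega
  have hq : 1 < Nat.card k := Finite.one_lt_card
  obtain ⟨Z, hZ, hp⟩ := exists_ncard_deg_eq (deg := divDeg k (B := B) (C := C)) (S := S)
    (div := div) (p := p) (c := γ / Nat.card k) divDeg_mul div_mul_left_cancel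
    (fun n => (finite_and_ncard_divDeg n).1)
    (fun m s => h.ideg_add_ideg (hb m s) ((hbs m s).trans (hcs m s).symm)) hcard hd
    (by
      obtain ⟨R, hR⟩ := hlarge
      refine ⟨R, fun r hr => ?_⟩
      obtain ⟨P, hP0, hP, t, rfl⟩ := hR r hr
      refine ⟨(⟨P ^ t, mem_nonZeroDivisors_of_ne_zero (pow_ne_zero t hP0)⟩, 1), ?_⟩
      simp only [divDeg, Submonoid.coe_one, Ideal.one_eq_top, ideg_top]
      rw [ideg_pow k hP0, mul_comm, add_zero])
    hq (div_pos h.chi.pos (by exact_mod_cast hq.trans' one_pos))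
  exact exists_eq_sum_pow ncard_divDeg_zero hZ hp X_mul_derivative_divisors

end DivisorCount

end PlaneCurve

namespace PlaneCurve

section Split

variable {k : Type*} [Field k] [Finite k] {B C K : Type*} [CommRing B] [CommRing C] [Field K]
  [Algebra k B] [Algebra k C] [Algebra k K] [Algebra B K] [Algebra C K]
  [IsScalarTower k B K] [IsScalarTower k C K] {x : K} {hx : x ≠ 0} {w : C} {d p : ℕ}

omit [Finite k] in
theorem smul_mem_img {I : Ideal B} {t : K} (c : k) (ht : t ∈ img K I) : c • t ∈ img K I := by
  obtain ⟨b, hb, rfl⟩ := ht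
  exact ⟨c • b, I.smul_of_tower_mem c hb, algebraMap_smul_comm c b⟩
where
  algebraMap_smul_comm (c : k) (b : B) : algebraMap B K (c • b) = c • algebraMap B K b := by
    rw [Algebra.algebraMap_eq_smul_one, smul_assoc, ← Algebra.algebraMap_eq_smul_one]

omit [Finite k] in
/-- A functional that kills `I + x ^ m J`. -/
theorem exists_functional {I : Ideal B} {J : Ideal C} {s : K} {hs : s ≠ 0}
    (h : img K I ⊔ scale s hs (img K J) ≠ ⊤) :
    ∃ φ : K →ₗ[k] k, φ ≠ 0 ∧ ∀ t ∈ img K I ⊔ scale s hs (img K J), φ t = 0 := by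
  let W : Submodule k K :=
    { (img K I ⊔ scale s hs (img K J)) with
      smul_mem' := by
        intro c t ht
        obtain ⟨a, ha, b, hb, rfl⟩ := AddSubgroup.mem_sup.1 ht
        obtain ⟨b, hb', rfl⟩ := mem_scale.1 hb
        rw [smul_add]
        refine AddSubgroup.mem_sup.2 ⟨_, smul_mem_img c ha, _,
          mem_scale.2 ⟨_, smul_mem_img c hb', rfl⟩, ?_⟩
        rw [mul_smul_comm] }
  have hW : W < ⊤ := by
    rw [lt_top_iff_ne_top]
    intro hW
    refine h (AddSubgroup.ext fun t => ?_)
    exact ⟨fun _ => trivial, fun _ => (hW ▸ trivial : t ∈ W)⟩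
  obtain ⟨φ, h0, hφ⟩ := Submodule.exists_le_ker_of_lt_top W hW
  exact ⟨φ, h0, fun t ht => hφ (show t ∈ W from ht)⟩

/-- The Riemann-Roch type facts follow from a decomposition of the function field. -/
theorem twoChart_of_split {ι : Type*} [Fintype ι] (hι : Fintype.card ι = p) (t : ι → K)
    (hsplit : ∀ z : K, ∃ b : B, ∃ c : C, ∃ a : ι → k,
      z = algebraMap B K b + algebraMap C K c + ∑ i, a i • t i)
    (injB : Function.Injective (algebraMap B K)) (injC : Function.Injective (algebraMap C K))
    (hw : x * algebraMap C K w = 1) (hd : ideg k (Ideal.span {w}) = d)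
    (hfin : ((img K (⊤ : Ideal B) ⊓ img K (⊤ : Ideal C) : AddSubgroup K) : Set K).Finite) :
    ∃ γ, TwoChart k (B := B) x hx w d p γ := by
  classical
  set q := Nat.card k with hq
  have hq0 : 0 < q := Nat.card_pos
  set X := img K (⊤ : Ideal B)
  set Y := img K (⊤ : Ideal C)
  have hcard : Nat.card (ι → k) = q ^ p := by
    rw [Nat.card_fun, Nat.card_eq_fintype_card (α := ι), hι]
  have hXY : Finite ↥(X ⊓ Y) := hfin
  -- the index of the sum
  have hsurj : Function.Surjective fun a : ι → k =>
      (QuotientAddGroup.mk (∑ i, a i • t i) : K ⧸ (X ⊔ Y)) := by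
    intro z
    obtain ⟨z, rfl⟩ := QuotientAddGroup.mk_surjective z
    obtain ⟨b, c, a, rfl⟩ := hsplit z
    refine ⟨a, ?_⟩
    rw [eq_comm]
    refine (QuotientAddGroup.eq).2 ?_
    have h1 : algebraMap B K b ∈ X ⊔ Y := (le_sup_left : X ≤ X ⊔ Y) ⟨b, trivial, rfl⟩
    have h2 : algebraMap C K c ∈ X ⊔ Y := (le_sup_right : Y ≤ X ⊔ Y) ⟨c, trivial, rfl⟩
    convert neg_mem (add_mem h1 h2) using 1
    abel
  have hfq : Finite (K ⧸ (X ⊔ Y)) := Finite.of_surjective _ hsurj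
  have hidx : (X ⊔ Y).index ≤ q ^ p := by
    rw [← hcard]
    exact Nat.card_le_card_of_surjective _ hsurj
  have hidx0 : (X ⊔ Y).index ≠ 0 := (AddSubgroup.finiteIndex_of_finite_quotient).index_ne_zero
  have hidx0' : (0 : ℝ) < (X ⊔ Y).index := by exact_mod_cast Nat.pos_of_ne_zero hidx0
  have hqc : q ≤ Nat.card ↥(X ⊓ Y) := by
    refine Nat.card_le_card_of_injective (fun c : k => (⟨algebraMap k K c,
      ⟨⟨algebraMap k B c, trivial, (IsScalarTower.algebraMap_apply k B K c).symm⟩,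
        ⟨algebraMap k C c, trivial, (IsScalarTower.algebraMap_apply k C K c).symm⟩⟩⟩ :
          ↥(X ⊓ Y))) fun a b h => ?_
    exact (algebraMap k K).injective (Subtype.mk.inj h)
  refine ⟨Nat.card ↥(X ⊓ Y) / (X ⊔ Y).index, injB, injC, hw, hd, ⟨?_, hidx0, ?_⟩, ?_, ?_⟩
  · exact (hq0.trans_le hqc).ne'
  · rw [div_mul_cancel₀ _ hidx0'.ne']
  · rw [div_mul_eq_mul_div, le_div_iff₀ hidx0']
    gcongr
    exact_mod_cast hidx
  · intro I J m _ _ hIJ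
    obtain ⟨φ, h0, hφ⟩ := exists_functional (k := k) hIJ
    rw [← hcard]
    refine Nat.card_le_card_of_injective (fun u : ↥(img K I ⊓ scale (x ^ m) (pow_ne_zero m hx)
      (img K J)) => fun i => φ (t i * (u : K))) ?_
    intro u v huv
    by_contra hne
    have hne' : (u : K) - v ≠ 0 := sub_ne_zero.2 fun h => hne (Subtype.ext h)
    have hmem := sub_mem u.2 v.2
    set e : K := (u : K) - v with he
    have he0 : ∀ i, φ (t i * e) = 0 := fun i => by
      rw [he, mul_sub, map_sub, sub_eq_zero]
      exact congrFun huv i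
    refine h0 (LinearMap.ext fun z => ?_)
    obtain ⟨b, c, a, hz⟩ := hsplit (z / e)
    have hz' : z = algebraMap B K b * e + algebraMap C K c * e + ∑ i, a i • (t i * e) := by
      rw [← div_mul_cancel₀ z hne', hz, add_mul, add_mul, Finset.sum_mul]
      simp only [smul_mul_assoc]
    have h1 : φ (algebraMap B K b * e) = 0 := by
      obtain ⟨u, hu, hue⟩ := hmem.1
      refine hφ _ ((le_sup_left : _ ≤ img K I ⊔ _) ⟨b * u, I.mul_mem_left b hu, ?_⟩)
      rw [← hue]
      exact map_mul (algebraMap B K) _ _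
    have h2 : φ (algebraMap C K c * e) = 0 := by
      obtain ⟨_, ⟨u, hu, rfl⟩, hue⟩ := mem_scale.1 hmem.2
      refine hφ _ ((le_sup_right : scale (x ^ m) (pow_ne_zero m hx) (img K J) ≤ _)
        (mem_scale.2 ⟨_, ⟨c * u, J.mul_mem_left c hu, rfl⟩, ?_⟩))
      rw [← hue]
      change x ^ m * algebraMap C K (c * u) = _ * (x ^ m * algebraMap C K u)
      rw [map_mul]
      ring
    rw [hz', map_add, map_add, h1, h2, map_sum]
    simp [he0]

end Split

end PlaneCurve

namespace PlaneCurve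

open Polynomial

section InftyRing

/-- `O` plays the role of the local ring at infinity of the projective line. -/
structure InftyRing (k : Type*) [Field k] (F : Type*) [Field F] {O : Type*} [CommRing O]
    [Algebra k[X] F] [Algebra O F] (w : O) : Prop where
  hw : algebraMap k[X] F X * algebraMap O F w = 1
  split : ∀ z : F, ∃ (P : k[X]) (o : O), z = algebraMap k[X] F P + algebraMap O F (w * o)
  inter : ∀ (P : k[X]) (o : O), algebraMap k[X] F P = algebraMap O F (w * o) → P = 0
  dvd_pow : ∀ o : O, o ≠ 0 → ∃ n, o ∣ w ^ n

namespace InftyRing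

variable {k : Type*} [Field k] {F : Type*} [Field F] {O : Type*} [CommRing O]
    [Algebra k[X] F] [Algebra O F] [Algebra k F] [Algebra k O] [IsScalarTower k O F]
    [IsScalarTower k k[X] F] {w : O} (h : InftyRing k F w)

include h

theorem eq_C_of_eq (P : k[X]) (o : O) (hP : algebraMap k[X] F P = algebraMap O F o) :
    P = C (P.coeff 0) := by
  have h1 : algebraMap k[X] F P.divX = algebraMap O F (w * (o - algebraMap k O (P.coeff 0))) := by
    have h2 : algebraMap k[X] F (X * P.divX) =
        algebraMap O F (o - algebraMap k O (P.coeff 0)) := by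
      rw [map_sub, ← hP, ← IsScalarTower.algebraMap_apply, IsScalarTower.algebraMap_apply k k[X] F,
        ← map_sub]
      congr 1
      rw [eq_sub_iff_add_eq]
      exact P.X_mul_divX_add
    rw [map_mul, ← h2, map_mul, ← mul_assoc, mul_comm (algebraMap O F w), h.hw, one_mul]
  have h2 := P.X_mul_divX_add
  rw [h.inter _ _ h1, mul_zero, zero_add] at h2
  exact h2.symm

theorem exists_const (hO : Function.Injective (algebraMap O F)) (o : O) :
    ∃ (c : k) (o' : O), o = algebraMap k O c + w * o' := by
  obtain ⟨P, o', ho⟩ := h.split (algebraMap O F o)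
  have h1 := h.eq_C_of_eq P (o - w * o') (by rw [map_sub, ho, add_sub_cancel_right])
  refine ⟨P.coeff 0, o', hO ?_⟩
  rw [ho, map_add, ← IsScalarTower.algebraMap_apply, IsScalarTower.algebraMap_apply k k[X] F]
  congr 2

theorem exists_split_pow (hO : Function.Injective (algebraMap O F)) (i : ℕ) (z : F) :
    ∃ (P : k[X]) (a : Fin (i - 1) → k) (o : O), z = algebraMap k[X] F P +
      ∑ j, a j • algebraMap O F w ^ ((j : ℕ) + 1) + algebraMap O F (w ^ i * o) := by
  induction i with
  | zero =>
    obtain ⟨P, o, ho⟩ := h.split z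
    exact ⟨P, 0, w * o, by simpa using ho⟩
  | succ i ih =>
    rcases i with _ | i
    · obtain ⟨P, o, ho⟩ := h.split z
      exact ⟨P, 0, o, by simpa using ho⟩
    · obtain ⟨P, a, o, ho⟩ := ih
      obtain ⟨c, o', rfl⟩ := h.exists_const hO o
      refine ⟨P, Fin.snoc (α := fun _ => k) a c, o', ?_⟩
      rw [ho]
      change _ = _ + ∑ j : Fin (i + 1), _ + _
      rw [Fin.sum_univ_castSucc]
      simp only [Fin.snoc_castSucc, Fin.snoc_last, Fin.val_castSucc, Fin.val_last, map_mul,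
        map_add, map_pow, Algebra.smul_def, ← IsScalarTower.algebraMap_apply]
      ring_nf
      exact congrArg _ (Finset.sum_congr rfl fun _ _ => by ring)

theorem exists_mul_pow (P : k[X]) (m : ℕ) (hP : P.natDegree ≤ m) :
    ∃ o : O, algebraMap k[X] F P * algebraMap O F w ^ m = algebraMap O F o := by
  refine ⟨∑ i ∈ Finset.range (m + 1), algebraMap k O (P.coeff i) * w ^ (m - i), ?_⟩
  conv_lhs => rw [P.as_sum_range_C_mul_X_pow' (Nat.lt_succ_of_le hP)]
  rw [map_sum, map_sum, Finset.sum_mul]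
  refine Finset.sum_congr rfl fun i hi => ?_
  have h1 : m = i + (m - i) := by
    have := Finset.mem_range.1 hi
    omega
  have h2 : algebraMap k[X] F (C (P.coeff i)) = algebraMap k F (P.coeff i) :=
    (IsScalarTower.algebraMap_apply k k[X] F _).symm
  conv_lhs => rw [h1, pow_add]
  rw [map_mul, map_mul, map_pow, map_pow, ← IsScalarTower.algebraMap_apply, h2, ← mul_assoc,
    mul_assoc (algebraMap k F _), ← mul_pow, h.hw, one_pow, mul_one]

theorem finite_quotient_span_pow [Finite k] (hO : Function.Injective (algebraMap O F)) (n : ℕ) :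
    Finite (O ⧸ Ideal.span {w ^ n}) := by
  have h1 : ∀ o : O, ∃ (a : Fin n → k) (o' : O),
      o = ∑ j, algebraMap k O (a j) * w ^ (j : ℕ) + w ^ n * o' := by
    intro o
    induction n with
    | zero => exact ⟨0, o, by simp⟩
    | succ n ih =>
      obtain ⟨a, o', ho⟩ := ih
      obtain ⟨c, o'', rfl⟩ := h.exists_const hO o'
      refine ⟨Fin.snoc (α := fun _ => k) a c, o'', ?_⟩
      rw [Fin.sum_univ_castSucc]
      simp only [Fin.snoc_castSucc, Fin.snoc_last, Fin.val_castSucc, Fin.val_last]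
      rw [ho]
      ring
  refine Finite.of_surjective (fun a : Fin n → k => Ideal.Quotient.mk (Ideal.span {w ^ n})
    (∑ j, algebraMap k O (a j) * w ^ (j : ℕ))) fun z => ?_
  obtain ⟨o, rfl⟩ := Ideal.Quotient.mk_surjective z
  obtain ⟨a, o', ho⟩ := h1 o
  refine ⟨a, ?_⟩
  rw [eq_comm, Ideal.Quotient.eq, ho, add_sub_cancel_left]
  exact Ideal.mul_mem_right _ _ (Ideal.mem_span_singleton_self _)

theorem hasFiniteQuotients [Finite k] (hO : Function.Injective (algebraMap O F)) :
    Ring.HasFiniteQuotients O := by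
  refine ⟨fun {I} hI => ?_⟩
  obtain ⟨o, hoI, ho⟩ := Submodule.exists_mem_ne_zero_of_ne_bot hI
  obtain ⟨n, o', hn⟩ := h.dvd_pow o ho
  have := h.finite_quotient_span_pow hO n
  refine Finite.of_surjective (Ideal.Quotient.factor (S := Ideal.span {w ^ n}) (T := I) ?_)
    (Ideal.Quotient.factor_surjective _)
  rw [Ideal.span_singleton_le_iff_mem, hn]
  exact I.mul_mem_right _ hoI

theorem bijective_algebraMap (hO : Function.Injective (algebraMap O F)) :
    Function.Bijective (algebraMap k (O ⧸ Ideal.span {w})) := by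
  constructor
  · rw [injective_iff_map_eq_zero]
    intro c hc
    obtain ⟨o, ho⟩ := Ideal.mem_span_singleton'.1 (Ideal.Quotient.eq_zero_iff_mem.1
      (show Ideal.Quotient.mk (Ideal.span {w}) (algebraMap k O c) = 0 from hc))
    have h1 := h.inter (C c) o (by
      rw [mul_comm, ho, ← IsScalarTower.algebraMap_apply]
      exact (IsScalarTower.algebraMap_apply k k[X] F c).symm)
    simpa using h1
  · intro z
    obtain ⟨o, rfl⟩ := Ideal.Quotient.mk_surjective z
    obtain ⟨c, o', rfl⟩ := h.exists_const hO o
    refine ⟨c, ?_⟩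
    rw [eq_comm]
    refine Ideal.Quotient.eq.2 ?_
    rw [add_sub_cancel_left]
    exact Ideal.mul_mem_right _ _ (Ideal.mem_span_singleton_self _)

theorem isMaximal (hO : Function.Injective (algebraMap O F)) : (Ideal.span {w}).IsMaximal := by
  refine Ideal.Quotient.maximal_of_isField _ ?_
  exact MulEquiv.isField (Field.toIsField k)
    (RingEquiv.ofBijective _ (h.bijective_algebraMap hO)).symm.toMulEquiv

theorem ideg_eq_one (hO : Function.Injective (algebraMap O F)) :
    ideg k (Ideal.span {w}) = 1 := by
  have e := LinearEquiv.ofBijective (Algebra.linearMap k (O ⧸ Ideal.span {w}))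
    (h.bijective_algebraMap hO)
  rw [ideg, ← e.finrank_eq, Module.finrank_self]

end InftyRing

end InftyRing

section RatFunc

open scoped Classical in
/-- The local ring at infinity of the projective line. -/
noncomputable abbrev localInfty (k : Type*) [Field k] : ValuationSubring (RatFunc k) :=
  (RatFunc.inftyValuation k).valuationSubring

variable {k : Type*} [Field k]

theorem mem_localInfty {z : RatFunc k} (hz : z ≠ 0) : z ∈ localInfty k ↔ z.intDegree ≤ 0 := by
  classical
  rw [Valuation.mem_valuationSubring_iff]
  rw [RatFunc.inftyValuation_apply, RatFunc.inftyValuation_of_nonzero _ hz]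
  rw [← WithZero.exp_zero, WithZero.exp_le_exp]

theorem exists_inftyRing : ∃ w : localInfty k, InftyRing k (RatFunc k) w := by
  have hX : (RatFunc.X : RatFunc k) ≠ 0 := RatFunc.X_ne_zero
  have hXi : (RatFunc.X⁻¹ : RatFunc k).intDegree = -1 := by
    rw [RatFunc.intDegree_inv, RatFunc.intDegree_X]
  have hw : (RatFunc.X⁻¹ : RatFunc k) ∈ localInfty k := by
    rw [mem_localInfty (inv_ne_zero hX), hXi]
    norm_num
  refine ⟨⟨_, hw⟩, ?_, ?_, ?_, ?_⟩
  · rw [RatFunc.algebraMap_X]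
    exact mul_inv_cancel₀ hX
  · intro z
    have hD : z.denom ≠ 0 := z.denom_ne_zero
    set P := z.num / z.denom
    set R := z.num % z.denom
    have h1 : z = algebraMap k[X] (RatFunc k) P + algebraMap k[X] (RatFunc k) R /
        algebraMap k[X] (RatFunc k) z.denom := by
      have h2 : algebraMap k[X] (RatFunc k) z.denom ≠ 0 := RatFunc.algebraMap_ne_zero hD
      conv_lhs => rw [← z.num_div_denom, ← EuclideanDomain.div_add_mod z.num z.denom]
      rw [map_add, map_mul]
      field_simp
      rfl
    have h2 : RatFunc.X * (algebraMap k[X] (RatFunc k) R / algebraMap k[X] (RatFunc k) z.denom) ∈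
        localInfty k := by
      by_cases hR : R = 0
      · rw [hR, map_zero, zero_div, mul_zero]
        exact zero_mem _
      · have h3 := RatFunc.algebraMap_ne_zero hR
        have h4 := RatFunc.algebraMap_ne_zero hD
        rw [mem_localInfty (mul_ne_zero hX (div_ne_zero h3 h4)),
          RatFunc.intDegree_mul hX (div_ne_zero h3 h4), div_eq_mul_inv,
          RatFunc.intDegree_mul h3 (inv_ne_zero h4), RatFunc.intDegree_inv, RatFunc.intDegree_X,
          RatFunc.intDegree_polynomial, RatFunc.intDegree_polynomial]
        have := natDegree_lt_natDegree hR (degree_mod_lt z.num hD)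
        omega
    refine ⟨P, ⟨_, h2⟩, h1.trans ?_⟩
    congr 1
    change _ = RatFunc.X⁻¹ * (RatFunc.X * _)
    rw [inv_mul_cancel_left₀ hX]
  · rintro P ⟨o, ho⟩ h
    by_contra hP
    have hP' := RatFunc.algebraMap_ne_zero hP
    change _ = RatFunc.X⁻¹ * o at h
    have ho0 : o ≠ 0 := by
      rintro rfl
      exact hP' (h.trans (mul_zero _))
    have h1 := congrArg RatFunc.intDegree h
    rw [RatFunc.intDegree_mul (inv_ne_zero hX) ho0, hXi, RatFunc.intDegree_polynomial] at h1
    have h2 := (mem_localInfty ho0).1 ho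
    omega
  · rintro ⟨o, ho⟩ h
    have ho0 : o ≠ 0 := fun h' => h (Subtype.ext h')
    set n := (-o.intDegree).toNat with hn
    have hXn : (RatFunc.X⁻¹ ^ n : RatFunc k).intDegree = -n := by
      clear_value n
      clear hn
      induction n with
      | zero => simp
      | succ n ih =>
        rw [pow_succ, RatFunc.intDegree_mul (pow_ne_zero _ (inv_ne_zero hX)) (inv_ne_zero hX), ih,
          hXi]
        push_cast
        ring
    have h1 : (RatFunc.X⁻¹ ^ n * o⁻¹ : RatFunc k) ∈ localInfty k := by
      rw [mem_localInfty (mul_ne_zero (pow_ne_zero _ (inv_ne_zero hX)) (inv_ne_zero ho0)),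
        RatFunc.intDegree_mul (pow_ne_zero _ (inv_ne_zero hX)) (inv_ne_zero ho0), hXn,
        RatFunc.intDegree_inv]
      omega
    refine ⟨n, ⟨_, h1⟩, Subtype.ext ?_⟩
    change RatFunc.X⁻¹ ^ n = o * (RatFunc.X⁻¹ ^ n * o⁻¹)
    field_simp

end RatFunc

end PlaneCurve

namespace PlaneCurve

open Polynomial

section FunctionField

variable {k : Type*} [Field k] {F : Type*} [Field F] {O : Type*} [CommRing O]
  [Algebra k[X] F] [Algebra O F] [Algebra k F] [Algebra k O] [IsScalarTower k O F]
  [IsScalarTower k k[X] F] {w : O} {K : Type*} [Field K] [Algebra F K] [Algebra k[X] K]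
  [Algebra O K] [Algebra k K] [IsScalarTower k[X] F K] [IsScalarTower O F K]
  [IsScalarTower k F K] [IsScalarTower k k[X] K] [IsScalarTower k O K]
  {f : k[X][X]} {d : ℕ} {y : K}

theorem isIntegral_w_mul (h : InftyRing k F w) (hf : f.Monic) (hd : f.natDegree = d)
    (hfd : BiDeg d f) (hy : aeval y f = 0) : IsIntegral O (algebraMap O K w * y) := by
  have h1 : ∀ j : Fin d, ∃ o : O, algebraMap k[X] K (f.coeff j) * algebraMap O K w ^ (d - j) =
      algebraMap O K o := by
    intro j
    have h2 : (f.coeff j).natDegree ≤ d - j := by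
      by_cases h0 : f.coeff j = 0
      · simp [h0]
      · have := hfd j h0
        omega
    obtain ⟨o, ho⟩ := h.exists_mul_pow _ _ h2
    refine ⟨o, ?_⟩
    rw [IsScalarTower.algebraMap_apply O F K o, ← ho, map_mul, map_pow,
      ← IsScalarTower.algebraMap_apply, ← IsScalarTower.algebraMap_apply]
  choose o ho using h1
  refine ⟨X ^ d + ∑ j : Fin d, C (o j) * X ^ (j : ℕ), ?_, ?_⟩
  · refine monic_X_pow_add ?_
    refine (degree_sum_le _ _).trans_lt ?_
    refine (Finset.sup_lt_iff (WithBot.bot_lt_coe d)).2 fun j _ => ?_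
    exact (degree_C_mul_X_pow_le _ _).trans_lt (WithBot.coe_lt_coe.2 j.2)
  · rw [eval₂_add, eval₂_X_pow, eval₂_finsetSum]
    have h2 : ∀ j : Fin d, eval₂ (algebraMap O K) (algebraMap O K w * y) (C (o j) * X ^ (j : ℕ)) =
        algebraMap O K w ^ d * (algebraMap k[X] K (f.coeff j) * y ^ (j : ℕ)) := by
      intro j
      rw [eval₂_mul, eval₂_C, eval₂_X_pow, ← ho j, mul_pow]
      have h3 : algebraMap O K w ^ d = algebraMap O K w ^ (d - j) * algebraMap O K w ^ (j : ℕ) := by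
        rw [← pow_add, Nat.sub_add_cancel j.2.le]
      rw [h3]
      ring
    simp_rw [h2]
    rw [← Finset.mul_sum, mul_pow, ← mul_add, Fin.sum_univ_eq_sum_range
      (fun j => algebraMap k[X] K (f.coeff j) * y ^ j)]
    have h3 : y ^ d + ∑ j ∈ Finset.range d, algebraMap k[X] K (f.coeff j) * y ^ j = 0 := by
      rw [← hy, aeval_eq_sum_range, hd, Finset.sum_range_succ, add_comm]
      have : f.coeff d = 1 := by rw [← hd]; exact hf
      simp [Algebra.smul_def, this]
    rw [h3, mul_zero]

theorem exists_split (h : InftyRing k F w) (hO : Function.Injective (algebraMap O F))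
    (hf : f.Monic) (hd : f.natDegree = d)
    (hfd : BiDeg d f) (hy : aeval y f = 0)
    (hspan : ∀ z : K, ∃ a : Fin d → F, z = ∑ i, a i • y ^ (i : ℕ)) (z : K) :
    ∃ (b : integralClosure k[X] K) (c : integralClosure O K)
      (a : (Σ i : Fin d, Fin ((i : ℕ) - 1)) → k),
      z = algebraMap _ K b + algebraMap _ K c +
        ∑ i, a i • (algebraMap O K w ^ ((i.2 : ℕ) + 1) * y ^ (i.1 : ℕ)) := by
  obtain ⟨g, rfl⟩ := hspan z
  have h1 := fun i : Fin d => h.exists_split_pow hO i (g i)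
  choose P a o ho using h1
  have hyi : IsIntegral k[X] y := ⟨f, hf, hy⟩
  have hwy := isIntegral_w_mul (O := O) h hf hd hfd hy
  refine ⟨∑ i, algebraMap k[X] _ (P i) * ⟨y, hyi⟩ ^ (i : ℕ),
    ∑ i, algebraMap O _ (o i) * ⟨_, hwy⟩ ^ (i : ℕ), fun i => a i.1 i.2, ?_⟩
  rw [map_sum, map_sum, Fintype.sum_sigma, ← Finset.sum_add_distrib, ← Finset.sum_add_distrib]
  refine Finset.sum_congr rfl fun i _ => ?_
  have h2 : (∑ j, a i j • algebraMap O F w ^ ((j : ℕ) + 1)) • y ^ (i : ℕ) =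
      ∑ j, a i j • (algebraMap O K w ^ ((j : ℕ) + 1) * y ^ (i : ℕ)) := by
    rw [Finset.sum_smul]
    refine Finset.sum_congr rfl fun j _ => ?_
    rw [smul_assoc, Algebra.smul_def (algebraMap O F w ^ _), map_pow,
      ← IsScalarTower.algebraMap_apply]
  conv_lhs => rw [ho i]
  rw [add_smul, add_smul, h2, Algebra.smul_def, Algebra.smul_def,
    ← IsScalarTower.algebraMap_apply, ← IsScalarTower.algebraMap_apply, add_right_comm]
  congr 2
  change _ = algebraMap O K (o i) * (algebraMap O K w * y) ^ (i : ℕ)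
  rw [map_mul, map_pow]
  ring

theorem card_splitIndex (d : ℕ) :
    Fintype.card (Σ i : Fin d, Fin ((i : ℕ) - 1)) = (d - 1) * (d - 2) / 2 := by
  rw [Fintype.card_sigma]
  simp only [Fintype.card_fin]
  rw [Fin.sum_univ_eq_sum_range (fun i => i - 1)]
  rcases d with _ | d
  · simp
  · rw [Finset.sum_range_succ']
    simp only [Nat.add_sub_cancel, zero_le, Nat.sub_eq_zero_of_le, add_zero]
    exact Finset.sum_range_id d

theorem finite_integral_both [Finite k] (h : InftyRing k F w) [IsFractionRing k[X] F]
    [IsDomain O] [IsFractionRing O F] [IsIntegrallyClosed O] [FiniteDimensional F K] :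
    {z : K | IsIntegral k[X] z ∧ IsIntegral O z}.Finite := by
  set n := Module.finrank F K
  have hfin : Set.Finite {g : k[X] | g ∈ degreeLT k (n + 1)} := by
    have : Finite (degreeLT k (n + 1)) := Finite.of_equiv _ (degreeLTEquiv k (n + 1)).toEquiv.symm
    exact Set.toFinite (degreeLT k (n + 1) : Set k[X])
  refine (hfin.biUnion (t := fun g => (g.rootSet K : Set K))
    fun g _ => rootSet_finite g K).subset ?_
  rintro z ⟨h1, h2⟩
  have h3 := minpoly.isIntegrallyClosed_eq_field_fractions F K h1
  have h4 := minpoly.isIntegrallyClosed_eq_field_fractions F K h2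
  have h5 : ∀ i, (minpoly k[X] z).coeff i = C (((minpoly k[X] z).coeff i).coeff 0) := by
    intro i
    refine h.eq_C_of_eq _ ((minpoly O z).coeff i) ?_
    rw [← coeff_map, ← coeff_map, ← h3, ← h4]
  set g : k[X] := (minpoly k[X] z).map (evalRingHom 0) with hg
  have h6 : g.map C = minpoly k[X] z := by
    ext1 i
    rw [coeff_map, hg, coeff_map, coe_evalRingHom, ← coeff_zero_eq_eval_zero]
    exact (h5 i).symm
  have hmonic : g.Monic := (minpoly.monic h1).map _
  clear_value g
  simp only [Set.mem_iUnion, mem_rootSet]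
  refine ⟨g, ?_, hmonic.ne_zero, ?_⟩
  · rw [Set.mem_ofPred_eq, mem_degreeLT]
    refine (natDegree_lt_iff_degree_lt hmonic.ne_zero).1 (Nat.lt_succ_of_le ?_)
    rw [← natDegree_map_eq_of_injective (C_injective (R := k)) g, h6,
      ← (minpoly.monic h1).natDegree_map (algebraMap k[X] F), ← h3]
    exact minpoly.natDegree_le z
  · rw [aeval_def, ← minpoly.aeval k[X] z, aeval_def, ← h6, eval₂_map]
    congr 1
    exact IsScalarTower.algebraMap_eq k k[X] K

variable (k F O K) in
theorem ideg_span_w [IsFractionRing O F] [IsDomain O] [IsPrincipalIdealRing O]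
    [FiniteDimensional F K] [Algebra.IsSeparable F K] (h : InftyRing k F w) :
    ideg k (Ideal.span {algebraMap O (integralClosure O K) w}) = Module.finrank F K := by
  have hO := IsFractionRing.injective O F
  have hmax := h.isMaximal hO
  have hfin : Module.Finite O (integralClosure O K) := IsIntegralClosure.finite O F K _
  have := integralClosure.isDedekindDomain O F K
  have := IsIntegralClosure.isFractionRing_of_finite_extension O F K (integralClosure O K)
  have h1 := Ideal.finrank_quotient_map (R := O) (S := integralClosure O K) (K := F)
    (L := K) (p := Ideal.span {w})
  have h2 : Ideal.map (algebraMap O (integralClosure O K)) (Ideal.span {w}) =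
      Ideal.span {algebraMap O (integralClosure O K) w} := by
    rw [Ideal.map_span, Set.image_singleton]
  rw [← h1, ← h2, ideg]
  have h3 : Module.finrank k (O ⧸ Ideal.span {w}) = 1 := h.ideg_eq_one hO
  let := Ideal.Quotient.field (Ideal.span {w})
  have : IsScalarTower k (O ⧸ Ideal.span {w}) (integralClosure O K ⧸
      Ideal.map (algebraMap O (integralClosure O K)) (Ideal.span {w})) :=
    IsScalarTower.of_algebraMap_eq fun c => congrArg (Ideal.Quotient.mk _)
      (Subtype.ext (IsScalarTower.algebraMap_apply k O K c) : algebraMap k (integralClosure O K) c =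
        algebraMap O (integralClosure O K) (algebraMap k O c))
  rw [← Module.finrank_mul_finrank k (O ⧸ Ideal.span {w}), h3, one_mul]

/-- The function field of a plane curve has two charts. -/
theorem exists_twoChart [Finite k] (h : InftyRing k F w) [IsFractionRing k[X] F]
    [IsDomain O] [IsFractionRing O F] [IsPrincipalIdealRing O] [FiniteDimensional F K]
    [Algebra.IsSeparable F K] (hf : f.Monic) (hd : f.natDegree = d)
    (hfd : BiDeg d f) (hy : aeval y f = 0)
    (hspan : ∀ z : K, ∃ a : Fin d → F, z = ∑ i, a i • y ^ (i : ℕ))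
    (hrank : Module.finrank F K = d) (hx : algebraMap k[X] K X ≠ 0) :
    ∃ γ, TwoChart k (B := integralClosure k[X] K) (algebraMap k[X] K X) hx
      (algebraMap O (integralClosure O K) w) d ((d - 1) * (d - 2) / 2) γ := by
  have hO := IsFractionRing.injective O F
  refine twoChart_of_split (card_splitIndex d) _ (exists_split h hO hf hd hfd hy hspan)
    Subtype.val_injective Subtype.val_injective ?_ ?_ ?_
  · rw [← IsScalarTower.algebraMap_apply, IsScalarTower.algebraMap_apply k[X] F K,
      IsScalarTower.algebraMap_apply O F K, ← map_mul, h.hw, map_one]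
  · rw [ideg_span_w k F O K h, hrank]
  · refine (finite_integral_both (O := O) (K := K) h).subset ?_
    rintro z ⟨⟨b, -, rfl⟩, ⟨c, -, hc⟩⟩
    refine ⟨b.2, ?_⟩
    rw [← hc]
    exact c.2

end FunctionField

end PlaneCurve

namespace PlaneCurve

section Homs

variable {k : Type*} [Field k] [Finite k]

theorem natCard_algHom (E Ω : Type*) [CommRing E] [IsDomain E] [Finite E] [Algebra k E]
    [Field Ω] [IsAlgClosed Ω] [Algebra k Ω] :
    Nat.card (E →ₐ[k] Ω) = Module.finrank k E := by
  let : Field E := (Finite.isField_of_domain E).toField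
  have : Module.Finite k E := Module.Finite.of_finite
  rw [Nat.card_eq_fintype_card]
  exact AlgHom.card k E Ω

theorem forall_pow_eq_iff (E : Type*) [CommRing E] [IsDomain E] [Finite E] [Algebra k E] (r : ℕ) :
    (∀ z : E, z ^ Nat.card k ^ r = z) ↔ Module.finrank k E ∣ r := by
  have := Fintype.ofFinite k
  let : Field E := (Finite.isField_of_domain E).toField
  rw [← FiniteField.orderOf_frobeniusAlgHom k E, orderOf_dvd_iff_pow_eq_one, AlgHom.ext_iff]
  refine forall_congr' fun z => ?_
  rw [AlgHom.coe_pow, FiniteField.coe_frobeniusAlgHom, pow_iterate, AlgHom.one_apply,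
    Nat.card_eq_fintype_card]

variable (k) {S : Type*} [CommRing S] [Algebra k S] (Ω : Type*) [Field Ω] [Algebra k Ω]

variable (S) in
/-- The points of `S` over the extension of degree `r`. -/
def fixedHoms (r : ℕ) : Set (S →ₐ[k] Ω) := {φ | ∀ s, φ s ^ Nat.card k ^ r = φ s}

variable [IsDedekindDomain S] [Ring.HasFiniteQuotients S] [Infinite S]

theorem ker_ne_bot_of_mem_fixedHoms {r : ℕ} (hr : r ≠ 0) {φ : S →ₐ[k] Ω}
    (hφ : φ ∈ fixedHoms k S Ω r) : RingHom.ker φ ≠ ⊥ := by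
  intro h
  have hinj : Function.Injective φ := (RingHom.injective_iff_ker_eq_bot φ).2 h
  have h1 : 1 < Nat.card k ^ r := Nat.one_lt_pow hr Finite.one_lt_card
  have hfin : (Set.range φ).Finite := by
    refine ((Polynomial.rootSet_finite (Polynomial.X ^ Nat.card k ^ r - Polynomial.X :
      Polynomial Ω) Ω)).subset ?_
    rintro _ ⟨s, rfl⟩
    rw [Polynomial.mem_rootSet]
    refine ⟨FiniteField.X_pow_card_sub_X_ne_zero Ω h1, ?_⟩
    simp [hφ s]
  have : Finite S := Set.finite_range_iff hinj |>.1 hfin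
  exact not_finite S

open scoped Classical in
theorem finite_and_ncard_fixedHoms [IsAlgClosed Ω] {r : ℕ} (hr : r ≠ 0) (a : S) :
    {φ ∈ fixedHoms k S Ω r | φ a = 0}.Finite ∧
    {φ ∈ fixedHoms k S Ω r | φ a = 0}.ncard =
      ∑ P ∈ (primesOfDegLE k S r).filter (fun P => ideg k P ∣ r ∧ a ∈ P), ideg k P := by
  set T := (primesOfDegLE k S r).filter (fun P => ideg k P ∣ r ∧ a ∈ P) with hT
  have hmemT : ∀ P, P ∈ T ↔ P ≠ ⊥ ∧ P.IsPrime ∧ ideg k P ∣ r ∧ a ∈ P := by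
    intro P
    rw [hT, Finset.mem_filter, mem_primesOfDegLE]
    exact ⟨fun h => ⟨h.1.1, h.1.2.1, h.2⟩,
      fun h => ⟨⟨h.1, h.2.1, Nat.le_of_dvd (Nat.pos_of_ne_zero hr) h.2.2.1⟩, h.2.2⟩⟩
  have hprime : ∀ P : T, P.1.IsPrime := fun P => ((hmemT _).1 P.2).2.1
  have hfin : ∀ P : T, Finite (S ⧸ P.1) := fun P =>
    Ring.HasFiniteQuotients.finiteQuotient ((hmemT _).1 P.2).1
  set g : (Σ P : T, (S ⧸ P.1 →ₐ[k] Ω)) → {φ ∈ fixedHoms k S Ω r | φ a = 0} := fun ψ =>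
    ⟨ψ.2.comp (Ideal.Quotient.mkₐ k ψ.1.1), by
      constructor
      · intro s
        have h1 := (forall_pow_eq_iff (k := k) (S ⧸ ψ.1.1) r).2 ((hmemT _).1 ψ.1.2).2.2.1
          (Ideal.Quotient.mkₐ k ψ.1.1 s)
        rw [AlgHom.comp_apply, ← map_pow, h1]
      · rw [AlgHom.comp_apply]
        have h1 : Ideal.Quotient.mkₐ k ψ.1.1 a = 0 :=
          Ideal.Quotient.eq_zero_iff_mem.2 ((hmemT _).1 ψ.1.2).2.2.2
        rw [h1, map_zero]⟩ with hg
  have hker : ∀ ψ, RingHom.ker (g ψ).1 = ψ.1.1 := by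
    rintro ⟨P, ψ⟩
    let : Field (S ⧸ P.1) := (Finite.isField_of_domain _).toField
    ext s
    rw [RingHom.mem_ker]
    change ψ (Ideal.Quotient.mk P.1 s) = 0 ↔ _
    rw [← Ideal.Quotient.eq_zero_iff_mem]
    exact map_eq_zero_iff ψ (RingHom.injective (ψ : (S ⧸ P.1) →+* Ω))
  have hbij : Function.Bijective g := by
    constructor
    · rintro ⟨P, ψ⟩ ⟨P', ψ'⟩ h
      have h1 : P = P' := by
        apply Subtype.ext
        rw [← hker ⟨P, ψ⟩, ← hker ⟨P', ψ'⟩, h]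
      subst h1
      congr 1
      refine AlgHom.ext fun z => ?_
      obtain ⟨s, rfl⟩ := Ideal.Quotient.mk_surjective z
      exact DFunLike.congr_fun (Subtype.mk.inj h) s
    · rintro ⟨φ, hφ, ha⟩
      have hP0 := ker_ne_bot_of_mem_fixedHoms k Ω hr hφ
      have hPp : (RingHom.ker φ).IsPrime := RingHom.ker_isPrime _
      have := Ring.HasFiniteQuotients.finiteQuotient hP0
      have hdvd : ideg k (RingHom.ker φ) ∣ r := by
        refine (forall_pow_eq_iff (k := k) (S ⧸ RingHom.ker φ) r).1 fun z => ?_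
        obtain ⟨s, rfl⟩ := Ideal.Quotient.mk_surjective z
        rw [← map_pow, Ideal.Quotient.eq, RingHom.mem_ker, map_sub, map_pow, hφ s, sub_self]
      exact ⟨⟨⟨RingHom.ker φ, (hmemT _).2 ⟨hP0, hPp, hdvd, ha⟩⟩,
        Ideal.Quotient.liftₐ (RingHom.ker φ) φ fun s hs => hs⟩, Subtype.ext (AlgHom.ext fun s => rfl)⟩
  have hfinite : Finite (Σ P : T, (S ⧸ P.1 →ₐ[k] Ω)) := by
    have : ∀ P : T, Finite (S ⧸ P.1 →ₐ[k] Ω) := fun P => by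
      refine Nat.finite_of_card_ne_zero ?_
      rw [natCard_algHom]
      exact (ideg_pos k ((hmemT _).1 P.2).1 (hprime P).ne_top).ne'
    infer_instance
  have hfin' : Finite {φ ∈ fixedHoms k S Ω r | φ a = 0} := Finite.of_surjective g hbij.2
  refine ⟨Set.toFinite _, ?_⟩
  rw [← Nat.card_coe_set_eq, ← Nat.card_congr (Equiv.ofBijective g hbij), Nat.card_sigma]
  rw [← Finset.sum_coe_sort T (fun P => ideg k P)]
  exact Finset.sum_congr rfl fun P _ => natCard_algHom _ _

theorem finite_and_ncard_fixedHoms_eq_primeSum [IsAlgClosed Ω] {r : ℕ} (hr : r ≠ 0) :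
    (fixedHoms k S Ω r).Finite ∧ (fixedHoms k S Ω r).ncard = primeSum k S r := by
  have h := finite_and_ncard_fixedHoms k Ω hr (0 : S)
  refine ⟨by simpa using h.1, ?_⟩
  rw [primeSum]
  convert h.2 using 2 <;> simp

theorem ncard_fixedHoms_apply_eq_zero_le [IsAlgClosed Ω] {r : ℕ} (hr : r ≠ 0) {a : S}
    (ha : a ≠ 0) :
    {φ ∈ fixedHoms k S Ω r | φ a = 0}.ncard ≤ ideg k (Ideal.span {a}) := by
  classical
  rw [(finite_and_ncard_fixedHoms k Ω hr a).2]
  refine sum_ideg_le_of_mem k ha _ fun P hP => ?_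
  rw [Finset.mem_filter, mem_primesOfDegLE] at hP
  exact ⟨hP.1.1, hP.1.2.1, hP.2.2⟩

theorem primeSum_le_of_forall_mem {r : ℕ} {a : S} (ha : a ≠ 0)
    (h : ∀ P : Ideal S, P ≠ ⊥ → P.IsPrime → a ∈ P) :
    primeSum k S r ≤ ideg k (Ideal.span {a}) := by
  refine sum_ideg_le_of_mem k ha _ fun P hP => ?_
  rw [Finset.mem_filter, mem_primesOfDegLE] at hP
  exact ⟨hP.1.1, hP.1.2.1, h P hP.1.1 hP.1.2.1⟩

theorem exists_prime_of_primeSum_ne_zero {r : ℕ} (h : primeSum k S r ≠ 0) :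
    ∃ P : Ideal S, P ≠ ⊥ ∧ P.IsPrime ∧ ideg k P ∣ r := by
  obtain ⟨P, hP, -⟩ := Finset.exists_ne_zero_of_sum_ne_zero h
  rw [Finset.mem_filter, mem_primesOfDegLE] at hP
  exact ⟨P, hP.1.1, hP.1.2.1, hP.2⟩

end Homs

section Extend

/-- A homomorphism extends to a larger ring when the difference is killed by an element that the
homomorphism does not kill. -/
theorem exists_extend_ringHom {R S Ω : Type*} [CommRing R] [CommRing S] [Field Ω] (i : R →+* S)
    (hi : Function.Injective i) (D : R) (ev : R →+* Ω) (hD : ev D ≠ 0)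
    (h : ∀ s, ∃ g, i g = i D * s) : ∃ φ : S →+* Ω, ∀ g, φ (i g) = ev g := by
  choose g hg using h
  have key : ∀ s, ∀ g', i g' = i D * s → ev g' = ev (g s) := fun s g' h' => by
    rw [hi (h'.trans (hg s).symm)]
  refine ⟨⟨⟨⟨fun s => ev (g s) / ev D, ?_⟩, fun s t => ?_⟩, ?_, fun s t => ?_⟩, fun a => ?_⟩
  · rw [← key 1 D (mul_one _).symm, div_self hD]
  · have h1 : g s * g t = D * g (s * t) := hi (by
      rw [map_mul, map_mul, hg, hg, hg]
      ring)
    have h2 := congrArg ev h1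
    rw [map_mul, map_mul] at h2
    field_simp
    rw [h2, mul_comm]
  · change ev (g 0) / ev D = 0
    rw [← key 0 0 (by simp), map_zero, zero_div]
  · change ev (g (s + t)) / ev D = ev (g s) / ev D + ev (g t) / ev D
    rw [← key (s + t) (g s + g t) (by rw [map_add, hg, hg, mul_add]), map_add, add_div]
  · change ev (g (i a)) / ev D = ev a
    rw [← key (i a) (D * a) (map_mul _ _ _), map_mul, mul_div_cancel_left₀ _ hD]

theorem ringHom_ext_of_mul {R S Ω : Type*} [CommRing R] [CommRing S] [Field Ω] (i : R →+* S)
    (D : R) (h : ∀ s, ∃ g, i g = i D * s) {φ ψ : S →+* Ω} (hD : φ (i D) ≠ 0)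
    (heq : ∀ g, φ (i g) = ψ (i g)) : φ = ψ := by
  ext s
  obtain ⟨g, hg⟩ := h s
  have h1 := heq g
  rw [hg, map_mul, map_mul, ← heq D] at h1
  exact mul_left_cancel₀ hD h1

end Extend

end PlaneCurve

namespace PlaneCurve

open Polynomial

section Points

variable {k : Type*} [Field k] {B : Type*} [CommRing B] [Algebra k B] {Ω : Type*} [Field Ω]
  [Algebra k Ω] {f : k[X][X]}

theorem evalEval_map_mapRingHom (g : k[X][X]) (x y : Ω) :
    (g.map (mapRingHom (algebraMap k Ω))).evalEval x y =
      eval₂ (eval₂RingHom (algebraMap k Ω) x) y g := by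
  rw [← coe_evalEvalRingHom, evalEvalRingHom_eq, coe_eval₂RingHom, eval₂_map]
  congr 1
  ext <;> simp

/-- Evaluation at a point of the curve with coordinates in an extension. -/
noncomputable def evalExt (f : k[X][X]) (x y : Ω)
    (h : (f.map (mapRingHom (algebraMap k Ω))).evalEval x y = 0) : AdjoinRoot f →+* Ω :=
  AdjoinRoot.lift (eval₂RingHom (algebraMap k Ω) x) y
    ((evalEval_map_mapRingHom f x y).symm.trans h)

theorem evalExt_mk (x y : Ω) (h : (f.map (mapRingHom (algebraMap k Ω))).evalEval x y = 0)
    (g : k[X][X]) :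
    evalExt f x y h (AdjoinRoot.mk f g) = (g.map (mapRingHom (algebraMap k Ω))).evalEval x y := by
  rw [evalExt, AdjoinRoot.lift_mk, evalEval_map_mapRingHom]

theorem apply_mk (φ : AdjoinRoot f →ₐ[k] Ω) (g : k[X][X]) :
    φ (AdjoinRoot.mk f g) = (g.map (mapRingHom (algebraMap k Ω))).evalEval
      (φ (AdjoinRoot.mk f (C X))) (φ (AdjoinRoot.root f)) := by
  rw [evalEval_map_mapRingHom]
  have h : ((φ : AdjoinRoot f →+* Ω).comp (AdjoinRoot.mk f)) =
      eval₂RingHom (eval₂RingHom (algebraMap k Ω) (φ (AdjoinRoot.mk f (C X))))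
        (φ (AdjoinRoot.root f)) := by
    ext a
    · simp only [RingHom.comp_apply, coe_eval₂RingHom, eval₂_C]
      exact φ.commutes a
    · simp
    · simp
  exact RingHom.congr_fun h g

/-- Away from the zeros of `D`, the homomorphisms correspond to points of the curve. -/
theorem ncard_fixedHoms_ne_zero [Finite k] (i : AdjoinRoot f →ₐ[k] B) (hi : Function.Injective i)
    (D : k[X]) (h : ∀ s, ∃ g, i g = i (AdjoinRoot.mk f (C D)) * s) (r : ℕ) :
    {φ ∈ fixedHoms k B Ω r | φ (i (AdjoinRoot.mk f (C D))) ≠ 0}.ncard =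
      {P ∈ ratPts (f.map (mapRingHom (algebraMap k Ω))) (Nat.card k ^ r) |
        aeval P.1 D ≠ 0}.ncard := by
  have := Fintype.ofFinite k
  obtain ⟨p, hp⟩ := CharP.exists k
  have hpp := CharP.char_is_prime k p
  have : Fact p.Prime := ⟨hpp⟩
  have hpΩ : CharP Ω p := charP_of_injective_algebraMap (algebraMap k Ω).injective p
  obtain ⟨a, hpa, ha⟩ := FiniteField.card k p
  set Q := Nat.card k ^ r with hQ
  have hQp : Q = p ^ (a * r) := by
    rw [hQ, Nat.card_eq_fintype_card, ha, pow_mul]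
  set Fr : Ω →+* Ω := iterateFrobenius Ω p (a * r) with hFr
  have hFr' : ∀ z, Fr z = z ^ Q := fun z => by rw [hFr, iterateFrobenius_def, hQp]
  have hFrk : ∀ c : k, (algebraMap k Ω c) ^ Q = algebraMap k Ω c := fun c => by
    rw [← map_pow, hQ, Nat.card_eq_fintype_card, FiniteField.pow_card_pow]
  have hevC : ∀ x y : Ω, ((C D : k[X][X]).map (mapRingHom (algebraMap k Ω))).evalEval x y =
      aeval x D := fun x y => by
    rw [evalEval_map_mapRingHom, eval₂_C]
    rfl
  refine Set.ncard_congr (fun φ _ => (φ (i (AdjoinRoot.mk f (C X))), φ (i (AdjoinRoot.root f))))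
    ?_ ?_ ?_
  · rintro φ ⟨hφ, hD⟩
    refine ⟨⟨?_, hφ _, hφ _⟩, ?_⟩
    · have := apply_mk (φ.comp i) f
      rw [AdjoinRoot.mk_self, map_zero] at this
      exact this.symm
    · have := apply_mk (φ.comp i) (C D)
      rw [hevC] at this
      rw [← AlgHom.comp_apply, this] at hD
      exact hD
  · rintro φ ψ ⟨hφ, hD⟩ ⟨hψ, hD'⟩ heq
    have h1 : (φ : B →+* Ω) = ψ := by
      refine ringHom_ext_of_mul (i : AdjoinRoot f →+* B) _ h hD fun g => ?_
      obtain ⟨g, rfl⟩ := AdjoinRoot.mk_surjective g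
      change (φ.comp i) _ = (ψ.comp i) _
      rw [apply_mk, apply_mk (ψ.comp i)]
      exact congrArg₂ (fun u v => (g.map _).evalEval u v) (congrArg Prod.fst heq)
        (congrArg Prod.snd heq)
    exact AlgHom.ext fun b => RingHom.congr_fun h1 b
  · rintro ⟨x, y⟩ ⟨⟨hf, hx, hy⟩, hD⟩
    have hD' : evalExt f x y hf (AdjoinRoot.mk f (C D)) ≠ 0 := by
      rw [evalExt_mk, hevC]
      exact hD
    obtain ⟨φ, hφ⟩ := exists_extend_ringHom (i : AdjoinRoot f →+* B) hi _ (evalExt f x y hf) hD' h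
    have hcomm : ∀ c, φ (algebraMap k B c) = algebraMap k Ω c := fun c => by
      rw [← i.commutes]
      change φ ((i : AdjoinRoot f →+* B) (AdjoinRoot.mk f (C (C c)))) = _
      rw [hφ, evalExt_mk]
      simp [evalEval]
    have hX : φ (i (AdjoinRoot.mk f (C X))) = x := by
      refine (hφ _).trans ?_
      rw [evalExt_mk]
      simp [evalEval]
    have hY : φ (i (AdjoinRoot.root f)) = y := by
      refine (hφ _).trans ?_
      rw [← AdjoinRoot.mk_X, evalExt_mk]
      simp [evalEval]
    let φ' : B →ₐ[k] Ω := ⟨φ, hcomm⟩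
    refine ⟨φ', ⟨?_, ?_⟩, Prod.ext hX hY⟩
    · have h1 : φ = Fr.comp φ := by
        refine ringHom_ext_of_mul (i : AdjoinRoot f →+* B) _ h ((hφ _).trans_ne hD') fun g => ?_
        let ψ : B →ₐ[k] Ω := ⟨Fr.comp φ, fun c => by
          change Fr (φ _) = _
          rw [hcomm, hFr', hFrk]⟩
        obtain ⟨g, rfl⟩ := AdjoinRoot.mk_surjective g
        change (φ'.comp i) _ = (ψ.comp i) _
        rw [apply_mk, apply_mk (ψ.comp i)]
        refine congrArg₂ (fun u v => (g.map _).evalEval u v) ?_ ?_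
        · change φ (i _) = Fr (φ (i _))
          rw [hX, hFr']
          exact hx.symm
        · change φ (i _) = Fr (φ (i _))
          rw [hY, hFr']
          exact hy.symm
      intro s
      change φ s ^ Q = φ s
      rw [← hFr']
      exact (RingHom.congr_fun h1 s).symm
    · exact (hφ _).trans_ne hD'

end Points

section Integral

open Pointwise in
/-- The discriminant multiplies the integral closure into the coordinate ring. -/
theorem exists_mul_mem_range {k : Type*} [Field k] {F : Type*} [Field F]
    [Algebra k[X] F] [IsFractionRing k[X] F] {K : Type*} [Field K] [Algebra F K] [Algebra k[X] K]
    [IsScalarTower k[X] F K] [FiniteDimensional F K] [Algebra.IsSeparable F K]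
    {f : k[X][X]} (hf : f.Monic) {y : K} (hy : minpoly F y = f.map (algebraMap k[X] F))
    (htop : Algebra.adjoin F {y} = ⊤) {s : K} (hs : IsIntegral k[X] s) :
    ∃ g : k[X][X], aeval y g = algebraMap k[X] K (disc f) * s := by
  have hy0 : aeval y f = 0 := by
    have := minpoly.aeval F y
    rwa [hy, aeval_map_algebraMap] at this
  have hyi : IsIntegral k[X] y := ⟨f, hf, hy0⟩
  have h1 := traceForm_dualSubmodule_adjoin k[X] F htop hyi
  have h2 : s ∈ (Algebra.traceForm F K).dualSubmodule
      (Subalgebra.toSubmodule (Algebra.adjoin k[X] {y})) := by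
    rw [LinearMap.BilinForm.mem_dualSubmodule]
    intro t ht
    rw [Algebra.traceForm_apply, Submodule.mem_one]
    have hti : IsIntegral k[X] t := by
      have := adjoin_le_integralClosure hyi ht
      exact this
    have h3 : IsIntegral k[X] (Algebra.trace F K (s * t)) := Algebra.isIntegral_trace (hs.mul hti)
    exact IsIntegrallyClosed.isIntegral_iff.1 h3
  rw [h1, hy, derivative_map, aeval_map_algebraMap] at h2
  obtain ⟨t, ht, hts⟩ := Submodule.mem_smul_pointwise_iff_exists _ _ _ |>.1 h2
  have ht' : t ∈ Algebra.adjoin k[X] {y} := ht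
  rw [Algebra.adjoin_singleton_eq_range_aeval] at ht'
  obtain ⟨g, hg⟩ := ht'
  obtain ⟨a, b, hab⟩ := exists_disc_eq hf
  have h4 := congrArg (aeval y) hab
  rw [aeval_C, map_add, map_mul, map_mul, hy0, mul_zero, zero_add] at h4
  have hsep : aeval y (derivative f) ≠ 0 := by
    have := (Algebra.IsSeparable.isSeparable F y).aeval_derivative_ne_zero (minpoly.aeval F y)
    rwa [hy, derivative_map, aeval_map_algebraMap] at this
  refine ⟨b * g, ?_⟩
  change aeval y g = t at hg
  rw [map_mul, hg, h4, ← hts, smul_eq_mul]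
  field_simp

end Integral

end PlaneCurve

namespace PlaneCurve

open Polynomial

section Bound

variable {k : Type*} [Field k] {B C K : Type*} [CommRing B] [CommRing C] [Field K]
  [Algebra k B] [Algebra k C] [Algebra B K] [Algebra C K] {x : K} {hx : x ≠ 0} {w : C}
  {d p : ℕ} {γ : ℝ} [Finite k] [IsDedekindDomain B] [Ring.HasFiniteQuotients B]
  [IsDedekindDomain C] [Ring.HasFiniteQuotients C] [Infinite C] [Infinite B]

theorem TwoChart.le_primeSum_one (h : TwoChart k (B := B) x hx w d p γ) (hd : 0 < d)
    {M : ℝ} (hM : ∀ r ≠ 0, |(primeSum k B r : ℝ) - (Nat.card k : ℝ) ^ r| ≤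
      M * √((Nat.card k : ℝ) ^ r)) {e : ℕ} (he : ∀ r ≠ 0, primeSum k C r ≤ e) :
    (Nat.card k : ℝ) + 1 - (2 * p : ℕ) * √(Nat.card k : ℝ) - e ≤ primeSum k B 1 := by
  set q : ℝ := (Nat.card k : ℝ) with hq
  have hq1 : 1 < q := by
    rw [hq]
    exact_mod_cast (Finite.one_lt_card : 1 < Nat.card k)
  have hq0 : 0 ≤ q := by linarith
  have hs1 : 1 < √q := by rwa [Real.lt_sqrt zero_le_one, one_pow]
  have hsr : ∀ r : ℕ, √(q ^ r) = √q ^ r := fun r => by rw [Real.sqrt_eq_rpow, Real.sqrt_eq_rpow,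
    ← Real.rpow_natCast, ← Real.rpow_natCast, ← Real.rpow_mul hq0, ← Real.rpow_mul hq0, mul_comm]
  have hsq : ∀ r : ℕ, q ^ r = √q ^ r * √q ^ r := fun r => by
    rw [← mul_pow, Real.mul_self_sqrt hq0]
  have hlarge : ∃ R, ∀ r ≥ R, ∃ P : Ideal B, P ≠ ⊥ ∧ P.IsPrime ∧ ideg k P ∣ r := by
    obtain ⟨N, hN⟩ := pow_unbounded_of_one_lt M hs1
    refine ⟨N + 1, fun r hr => exists_prime_of_primeSum_ne_zero k fun h0 => ?_⟩
    have h1 := hM r (by omega)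
    rw [h0, hsr, hsq, Nat.cast_zero, zero_sub, abs_neg, abs_of_nonneg (by positivity)] at h1
    have h2 : √q ^ N ≤ √q ^ r := pow_le_pow_right₀ hs1.le (by omega)
    have h3 : 0 < √q ^ r := by positivity
    have := le_of_mul_le_mul_right h1 h3
    linarith
  obtain ⟨s, hs, hsum⟩ := h.exists_primeSum_eq hd hlarge
  have hbd : ∀ r ≠ 0, ‖(s.map fun ω => ω ^ r).sum‖ ≤ (M + 1 + e) * √q ^ r := by
    intro r hr
    have h1 : (s.map fun ω => ω ^ r).sum =
        ((q ^ r + 1 - primeSum k B r - primeSum k C r : ℝ) : ℂ) := by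
      have := hsum r hr
      push_cast at this ⊢
      rw [hq]
      push_cast
      linear_combination this
    rw [h1, Complex.norm_real, Real.norm_eq_abs]
    have h2 := abs_le.1 (hM r hr)
    have h3 : (primeSum k C r : ℝ) ≤ e := by exact_mod_cast he r hr
    have h4 : (0 : ℝ) ≤ primeSum k C r := Nat.cast_nonneg _
    have h5 : 1 ≤ √q ^ r := one_le_pow₀ hs1.le
    have h6 : (0 : ℝ) ≤ e := Nat.cast_nonneg _
    have h7 : (e : ℝ) ≤ e * √q ^ r := le_mul_of_one_le_right h6 h5
    rw [hsr] at h2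
    rw [abs_le]
    constructor <;> nlinarith
  have h1 := norm_sum_pow_one_le hs (norm_le_of_norm_sum_pow_le (by linarith) hbd) (by linarith)
  have h2 := hsum 1 one_ne_zero
  simp only [pow_one, Multiset.map_id'] at h2
  have h3 : s.sum = ((q + 1 - primeSum k B 1 - primeSum k C 1 : ℝ) : ℂ) := by
    push_cast at h2 ⊢
    rw [hq]
    push_cast
    linear_combination h2
  rw [h3, Complex.norm_real, Real.norm_eq_abs] at h1
  have h4 := (abs_le.1 h1).2
  have h5 : (primeSum k C 1 : ℝ) ≤ e := by exact_mod_cast he 1 one_ne_zero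
  linarith

end Bound

section RatPts

theorem BiDeg.map {A A' : Type*} [CommRing A] [CommRing A'] {n : ℕ} {P : A[X][X]} (hP : BiDeg n P)
    (φ : A →+* A') : BiDeg n (P.map (mapRingHom φ)) := by
  intro i hi
  rw [coeff_map] at hi ⊢
  have h1 := hP i fun h => hi (by rw [h, map_zero])
  have h2 := natDegree_map_le (f := φ) (p := P.coeff i)
  rw [coe_mapRingHom]
  omega

theorem finite_ratPts {κ : Type*} [Field κ] (f : κ[X][X]) {Q : ℕ} (hQ : 1 < Q) :
    (ratPts f Q).Finite := by
  have h : {x : κ | x ^ Q = x}.Finite := by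
    refine (rootSet_finite (X ^ Q - X : κ[X]) κ).subset fun x hx => ?_
    rw [mem_rootSet]
    refine ⟨FiniteField.X_pow_card_sub_X_ne_zero κ hQ, ?_⟩
    rw [Set.mem_ofPred_eq] at hx
    simp [hx]
  exact (h.prod h).subset fun P hP => ⟨hP.2.1, hP.2.2⟩

variable {k : Type*} [Field k] {Ω : Type*} [Field Ω] [Algebra k Ω]
  {f : k[X][X]} {d : ℕ}

theorem ncard_ratPts_aeval_eq_zero_le (hf : f.Monic) (hd : f.natDegree = d) (hd0 : 0 < d)
    (hfd : BiDeg d f) (hirr : Irreducible (f.map (mapRingHom (algebraMap k Ω)))) {D : k[X]}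
    (hD : D ≠ 0) (Q : ℕ) :
    {P ∈ ratPts (f.map (mapRingHom (algebraMap k Ω))) Q | aeval P.1 D = 0}.ncard ≤
      d * D.natDegree := by
  have hfm := hf.map (mapRingHom (algebraMap k Ω))
  have hdm := (hf.natDegree_map (mapRingHom (algebraMap k Ω))).trans hd
  have hDm : D.map (algebraMap k Ω) ≠ 0 :=
    (Polynomial.map_ne_zero_iff (algebraMap k Ω).injective).2 hD
  have hnd : ¬ f.map (mapRingHom (algebraMap k Ω)) ∣ C (D.map (algebraMap k Ω)) := by
    intro h
    have := natDegree_le_of_dvd h (C_ne_zero.2 hDm)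
    rw [hdm, natDegree_C] at this
    omega
  obtain ⟨h1, h2⟩ := finite_and_ncard_zeros_le hfm hdm (hfd.map _) hirr
    (biDeg_C (natDegree_map_le (f := algebraMap k Ω) (p := D))) hnd
  rw [mul_comm]
  refine (Set.ncard_le_ncard ?_ h1).trans h2
  rintro P ⟨h3, h4⟩
  refine ⟨h3.1, ?_⟩
  rw [evalEval_C, eval_map_algebraMap]
  exact h4

theorem exists_abs_ncard_ratPts_map_sub_le [Finite k] [IsAlgClosed Ω] (hf : f.Monic)
    (hd : f.natDegree = d) (hd0 : 0 < d)
    (hfd : BiDeg d f) (hirr : Irreducible (f.map (mapRingHom (algebraMap k Ω))))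
    (hder : derivative f ≠ 0) :
    ∃ M : ℝ, ∀ r ≠ 0, |((ratPts (f.map (mapRingHom (algebraMap k Ω)))
      (Nat.card k ^ r)).ncard : ℝ) - (Nat.card k : ℝ) ^ r| ≤ M * √((Nat.card k : ℝ) ^ r) := by
  have := Fintype.ofFinite k
  obtain ⟨p, hp⟩ := CharP.exists k
  have hpp := CharP.char_is_prime k p
  have : Fact p.Prime := ⟨hpp⟩
  have hpΩ : CharP Ω p := charP_of_injective_algebraMap (algebraMap k Ω).injective p
  obtain ⟨a, hpa, ha⟩ := FiniteField.card k p
  have hder' : derivative (f.map (mapRingHom (algebraMap k Ω))) ≠ 0 := by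
    rw [derivative_map]
    exact (Polynomial.map_ne_zero_iff
      (map_injective _ (algebraMap k Ω).injective)).2 hder
  obtain ⟨M, hM⟩ := exists_abs_ncard_sub_le (p := p) (hf.map (mapRingHom (algebraMap k Ω)))
    ((hf.natDegree_map _).trans hd) hd0 (hfd.map _) hirr hder'
  refine ⟨M, fun r hr => ?_⟩
  have hQ : Nat.card k ^ r = p ^ (a * r) := by
    rw [Nat.card_eq_fintype_card, ha, pow_mul]
  have hQ' : (Nat.card k : ℝ) ^ r = (p : ℝ) ^ (a * r) := by exact_mod_cast hQ
  rw [hQ, hQ']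
  refine hM _ (mul_ne_zero a.ne_zero hr) fun x y => ?_
  set Fr : Ω →+* Ω := iterateFrobenius Ω p (a * r) with hFr
  rw [evalEval_map_mapRingHom, evalEval_map_mapRingHom, ← iterateFrobenius_def (R := Ω) p,
    ← iterateFrobenius_def (R := Ω) p, ← iterateFrobenius_def (R := Ω) p, ← hFr, hom_eval₂]
  congr 1
  ext c
  · have h1 : Fr (algebraMap k Ω c) = algebraMap k Ω c := by
      rw [hFr, iterateFrobenius_def, ← hQ, ← map_pow, Nat.card_eq_fintype_card,
        FiniteField.pow_card_pow]
    simp [h1]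
  · simp

end RatPts

section Chart

theorem hasFiniteQuotients_polynomial (k : Type*) [Field k] [Finite k] :
    Ring.HasFiniteQuotients k[X] := by
  refine ⟨fun {I} hI => ?_⟩
  obtain ⟨o, hoI, ho⟩ := Submodule.exists_mem_ne_zero_of_ne_bot hI
  have h1 : Finite (AdjoinRoot o) := by
    have : Module.Finite k (AdjoinRoot o) := (AdjoinRoot.powerBasis ho).finite
    exact Module.finite_of_finite k
  have h1' : Finite (k[X] ⧸ Ideal.span {o}) := h1
  have h2 : Ideal.span {o} ≤ I := by rwa [Ideal.span_singleton_le_iff_mem]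
  exact Finite.of_surjective (Ideal.Quotient.factor h2 : AdjoinRoot o → k[X] ⧸ I)
    (Ideal.Quotient.factor_surjective h2)

theorem infinite_of_isFractionRing (O F : Type*) [CommRing O] [Field F] [Algebra O F]
    [IsFractionRing O F] [Infinite F] : Infinite O := by
  by_contra h
  rw [not_infinite_iff_finite] at h
  have : Finite F := Finite.of_surjective
    (fun p : O × nonZeroDivisors O => IsLocalization.mk' F p.1 p.2)
    (fun z => by
      obtain ⟨a, b, h⟩ := IsLocalization.exists_mk'_eq (nonZeroDivisors O) z
      exact ⟨(a, b), h⟩)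
  exact not_finite F

variable {k : Type*} [Field k] [Finite k] {F : Type*} [Field F] {O : Type*} [CommRing O]
  [Algebra k[X] F] [Algebra O F] [Algebra k F] [Algebra k O] [IsScalarTower k O F]
  [IsScalarTower k k[X] F] {w : O} {K : Type*} [Field K] [Algebra F K] [Algebra k[X] K]
  [Algebra O K] [Algebra k K] [IsScalarTower k[X] F K] [IsScalarTower O F K]
  [IsScalarTower k F K] [IsScalarTower k k[X] K] [IsScalarTower k O K]
  {f : k[X][X]} {d : ℕ} {y : K}

/-- The Hasse-Weil lower bound for the points off the discriminant locus. -/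
theorem le_ncard_of_inftyRing (h : InftyRing k F w) [IsFractionRing k[X] F]
    [IsDomain O] [IsFractionRing O F] [IsPrincipalIdealRing O] [FiniteDimensional F K]
    [Algebra.IsSeparable F K] (hf : f.Monic) (hd : f.natDegree = d) (hd0 : 0 < d)
    (hfd : BiDeg d f) (hy : minpoly F y = f.map (algebraMap k[X] F))
    (htop : Algebra.adjoin F {y} = ⊤) {Ω : Type*} [Field Ω] [IsAlgClosed Ω] [Algebra k Ω]
    (hirr : Irreducible (f.map (mapRingHom (algebraMap k Ω)))) :
    (Nat.card k : ℝ) + 1 - (2 * ((d - 1) * (d - 2) / 2) : ℕ) * √(Nat.card k : ℝ) - d -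
      (d * (disc f).natDegree : ℕ) ≤
      {P ∈ ratPts (f.map (mapRingHom (algebraMap k Ω))) (Nat.card k) |
        aeval P.1 (disc f) ≠ 0}.ncard := by
  have hq1 : 1 < Nat.card k := Finite.one_lt_card
  have hB := hasFiniteQuotients_polynomial k
  have hOinj := IsFractionRing.injective O F
  have hO := h.hasFiniteQuotients hOinj
  have hinjF : Function.Injective (algebraMap k[X] F) := IsFractionRing.injective k[X] F
  have hinfF : Infinite F := Infinite.of_injective _ hinjF
  have hinfO : Infinite O := infinite_of_isFractionRing O F
  have hinjK : Function.Injective (algebraMap k[X] K) := by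
    rw [IsScalarTower.algebraMap_eq k[X] F K]
    exact (algebraMap F K).injective.comp hinjF
  have hinjOK : Function.Injective (algebraMap O K) := by
    rw [IsScalarTower.algebraMap_eq O F K]
    exact (algebraMap F K).injective.comp hOinj
  set B := integralClosure k[X] K with hBdef
  set C' := integralClosure O K with hCdef
  have hfinB : Module.Finite k[X] B := IsIntegralClosure.finite k[X] F K _
  have hdedB : IsDedekindDomain B := integralClosure.isDedekindDomain k[X] F K
  have hfqB : Ring.HasFiniteQuotients B := Ring.HasFiniteQuotients.of_module_finite k[X] B
  have hfinC : Module.Finite O C' := IsIntegralClosure.finite O F K _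
  have hdedC : IsDedekindDomain C' := integralClosure.isDedekindDomain O F K
  have hfqC : Ring.HasFiniteQuotients C' := Ring.HasFiniteQuotients.of_module_finite O C'
  have hinfB : Infinite B := Infinite.of_injective (algebraMap k[X] B) fun a b hab =>
    hinjK (congrArg Subtype.val hab)
  have hinfC : Infinite C' := Infinite.of_injective (algebraMap O C') fun a b hab =>
    hinjOK (congrArg Subtype.val hab)
  have hy0 : aeval y f = 0 := by
    have := minpoly.aeval F y
    rwa [hy, aeval_map_algebraMap] at this
  have hyi : IsIntegral k[X] y := ⟨f, hf, hy0⟩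
  have hsep : derivative f ≠ 0 := by
    intro h0
    have := (Algebra.IsSeparable.isSeparable F y).aeval_derivative_ne_zero (minpoly.aeval F y)
    rw [hy, derivative_map, h0] at this
    simp at this
  have hirrk : Irreducible f := hf.irreducible_of_irreducible_map _ _ hirr
  set D := disc f with hDdef
  have hD : D ≠ 0 := disc_ne_zero hf hirrk hsep
  -- the chart
  have hxK : algebraMap k[X] K X ≠ 0 := (map_ne_zero_iff _ hinjK).2 X_ne_zero
  have hFy : IsIntegral F y := Algebra.IsIntegral.isIntegral y
  let pb : PowerBasis F K := PowerBasis.ofAdjoinEqTop' hFy htop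
  have hpbdim : pb.dim = d := by
    rw [PowerBasis.ofAdjoinEqTop'_dim, hy, hf.natDegree_map, hd]
  have hpbgen : pb.gen = y := PowerBasis.ofAdjoinEqTop'_gen hFy htop
  have hrank : Module.finrank F K = d := by rw [pb.finrank, hpbdim]
  have hspan : ∀ z : K, ∃ a : Fin d → F, z = ∑ i, a i • y ^ (i : ℕ) := by
    clear_value pb
    subst hpbdim
    intro z
    refine ⟨pb.basis.repr z, ?_⟩
    conv_lhs => rw [← pb.basis.sum_repr z]
    refine Finset.sum_congr rfl fun i _ => ?_
    rw [pb.basis_eq_pow, hpbgen]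
  obtain ⟨γ, hT⟩ := exists_twoChart (O := O) h hf hd hfd hy0 hspan hrank hxK
  set wC : C' := algebraMap O C' w with hwC
  have hwC0 : wC ≠ 0 := by
    intro h0
    have := hT.hw
    rw [h0, map_zero, mul_zero] at this
    exact zero_ne_one this
  have hprimeC : ∀ r ≠ 0, primeSum k C' r ≤ d := by
    intro r hr
    rw [← hT.hd]
    refine primeSum_le_of_forall_mem k hwC0 fun P hP hPp => ?_
    have h1 : P.comap (algebraMap O C') ≠ ⊥ := Ideal.IsIntegral.comap_ne_bot O hP
    obtain ⟨o, hoP, ho⟩ := Submodule.exists_mem_ne_zero_of_ne_bot h1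
    obtain ⟨n, hn⟩ := h.dvd_pow o ho
    have h2 : w ^ n ∈ P.comap (algebraMap O C') := Ideal.mem_of_dvd _ hn hoP
    rw [Ideal.mem_comap, map_pow] at h2
    exact hPp.mem_of_pow_mem _ h2
  -- the coordinate ring
  let yB : B := ⟨y, hyi⟩
  have hyB : eval₂ (algebraMap k[X] B) yB f = 0 := by
    apply Subtype.val_injective
    change (integralClosure k[X] K).val _ = 0
    rw [← aeval_def, ← aeval_algHom_apply]
    exact hy0
  let i : AdjoinRoot f →ₐ[k] B :=
    ⟨AdjoinRoot.lift (algebraMap k[X] B) yB hyB, fun c => by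
      change AdjoinRoot.lift (algebraMap k[X] B) yB hyB (AdjoinRoot.of f (C c)) = _
      rw [AdjoinRoot.lift_of hyB]
      exact Subtype.ext (IsScalarTower.algebraMap_apply k k[X] K c).symm⟩
  have hi : ∀ g : k[X][X], ((i (AdjoinRoot.mk f g) : B) : K) = aeval y g := by
    intro g
    have h1 : i (AdjoinRoot.mk f g) = aeval yB g := AdjoinRoot.lift_mk hyB g
    rw [h1]
    exact (aeval_algHom_apply (integralClosure k[X] K).val yB g).symm
  have hiinj : Function.Injective i := by
    refine (injective_iff_map_eq_zero i).2 fun g hg => ?_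
    obtain ⟨g, rfl⟩ := AdjoinRoot.mk_surjective g
    have h1 := hi g
    rw [hg, ← aeval_map_algebraMap F] at h1
    have h2 := minpoly.dvd F y h1.symm
    rw [hy, map_dvd_map _ hinjF hf] at h2
    exact AdjoinRoot.mk_eq_zero.2 h2
  have hiD : i (AdjoinRoot.mk f (C D)) = algebraMap k[X] B D := by
    apply Subtype.val_injective
    rw [hi, aeval_C]
    rfl
  have hiD0 : i (AdjoinRoot.mk f (C D)) ≠ 0 := by
    rw [hiD]
    intro h0
    exact hD (hinjK ((congrArg Subtype.val h0).trans (map_zero _).symm))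
  have hmul : ∀ s, ∃ g, i g = i (AdjoinRoot.mk f (C D)) * s := by
    intro s
    obtain ⟨g, hg⟩ := exists_mul_mem_range (F := F) hf hy htop s.2
    refine ⟨AdjoinRoot.mk f g, Subtype.val_injective ?_⟩
    rw [hi, hg, hiD]
    rfl
  have hideg : ideg k (Ideal.span {i (AdjoinRoot.mk f (C D))}) ≤ d * D.natDegree := by
    obtain ⟨o, ho⟩ := h.exists_mul_pow D _ le_rfl
    have h1 : algebraMap B K (i (AdjoinRoot.mk f (C D))) =
        algebraMap k[X] K X ^ D.natDegree * algebraMap C' K (algebraMap O C' o) := by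
      have h2 : algebraMap C' K (algebraMap O C' o) = algebraMap F K (algebraMap O F o) := by
        rw [← IsScalarTower.algebraMap_apply O F K]
        rfl
      have h3 : algebraMap k[X] K X * algebraMap F K (algebraMap O F w) = 1 := by
        rw [IsScalarTower.algebraMap_apply k[X] F K, ← map_mul, h.hw, map_one]
      have h4 : algebraMap B K (i (AdjoinRoot.mk f (C D))) = algebraMap F K (algebraMap k[X] F D) := by
        rw [hiD, ← IsScalarTower.algebraMap_apply k[X] F K]
        rfl
      rw [h2, h4, ← ho, map_mul, map_pow, mul_left_comm, ← mul_pow, h3, one_pow, mul_one]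
    have := hT.ideg_add_ideg hiD0 h1
    rw [mul_comm]
    omega
  -- comparison of counts
  set fΩ := f.map (mapRingHom (algebraMap k Ω)) with hfΩ
  have hcount : ∀ r ≠ 0,
      primeSum k B r ≤ {P ∈ ratPts fΩ (Nat.card k ^ r) | aeval P.1 D ≠ 0}.ncard + d * D.natDegree ∧
      {P ∈ ratPts fΩ (Nat.card k ^ r) | aeval P.1 D ≠ 0}.ncard ≤ primeSum k B r := by
    intro r hr
    obtain ⟨h1, h2⟩ := finite_and_ncard_fixedHoms_eq_primeSum (S := B) k Ω hr
    have h3 := ncard_fixedHoms_ne_zero (Ω := Ω) i hiinj D hmul r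
    have h4 := (ncard_fixedHoms_apply_eq_zero_le k Ω hr hiD0).trans hideg
    rw [← hfΩ] at h3
    rw [← h2, ← h3]
    refine ⟨?_, Set.ncard_le_ncard (fun φ hφ => hφ.1) h1⟩
    refine (Set.ncard_le_ncard (t := {φ ∈ fixedHoms k B Ω r | φ (i (AdjoinRoot.mk f (C D))) ≠ 0} ∪
      {φ ∈ fixedHoms k B Ω r | φ (i (AdjoinRoot.mk f (C D))) = 0}) (fun φ hφ => ?_)
      (h1.subset ?_)).trans ((Set.ncard_union_le _ _).trans (by omega))
    · by_cases h5 : φ (i (AdjoinRoot.mk f (C D))) = 0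
      · exact Or.inr ⟨hφ, h5⟩
      · exact Or.inl ⟨hφ, h5⟩
    · rintro φ (hφ | hφ)
      · exact hφ.1
      · exact hφ.1
  have hrat : ∀ r ≠ 0,
      (ratPts fΩ (Nat.card k ^ r)).ncard ≤
        {P ∈ ratPts fΩ (Nat.card k ^ r) | aeval P.1 D ≠ 0}.ncard + d * D.natDegree ∧
      {P ∈ ratPts fΩ (Nat.card k ^ r) | aeval P.1 D ≠ 0}.ncard ≤
        (ratPts fΩ (Nat.card k ^ r)).ncard := by
    intro r hr
    have h1 := finite_ratPts fΩ (Nat.one_lt_pow hr hq1)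
    have h4 := ncard_ratPts_aeval_eq_zero_le hf hd hd0 hfd hirr hD (Nat.card k ^ r)
    rw [← hfΩ] at h4
    refine ⟨?_, Set.ncard_le_ncard (fun φ hφ => hφ.1) h1⟩
    refine (Set.ncard_le_ncard (t := {P ∈ ratPts fΩ (Nat.card k ^ r) | aeval P.1 D ≠ 0} ∪
      {P ∈ ratPts fΩ (Nat.card k ^ r) | aeval P.1 D = 0}) (fun φ hφ => ?_)
      (h1.subset ?_)).trans ((Set.ncard_union_le _ _).trans (by omega))
    · by_cases h5 : aeval φ.1 D = 0
      · exact Or.inr ⟨hφ, h5⟩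
      · exact Or.inl ⟨hφ, h5⟩
    · rintro φ (hφ | hφ)
      · exact hφ.1
      · exact hφ.1
  obtain ⟨M, hM⟩ := exists_abs_ncard_ratPts_map_sub_le hf hd hd0 hfd hirr hsep
  have hfinal := hT.le_primeSum_one hd0 (M := M + (d * D.natDegree : ℕ)) (fun r hr => by
    have h1 := abs_le.1 (hM r hr)
    obtain ⟨h2, h3⟩ := hcount r hr
    obtain ⟨h4, h5⟩ := hrat r hr
    have h6 : (primeSum k B r : ℝ) ≤ (ratPts fΩ (Nat.card k ^ r)).ncard + (d * D.natDegree : ℕ) := by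
      exact_mod_cast (by omega : primeSum k B r ≤
        (ratPts fΩ (Nat.card k ^ r)).ncard + d * D.natDegree)
    have h7 : ((ratPts fΩ (Nat.card k ^ r)).ncard : ℝ) ≤ primeSum k B r + (d * D.natDegree : ℕ) := by
      exact_mod_cast (by omega : (ratPts fΩ (Nat.card k ^ r)).ncard ≤
        primeSum k B r + d * D.natDegree)
    have h8 : (1 : ℝ) ≤ √((Nat.card k : ℝ) ^ r) := by
      rw [Real.le_sqrt' one_pos, one_pow]
      exact one_le_pow₀ (by exact_mod_cast hq1.le)
    have h9 : ((d * D.natDegree : ℕ) : ℝ) ≤ (d * D.natDegree : ℕ) * √((Nat.card k : ℝ) ^ r) :=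
      le_mul_of_one_le_right (Nat.cast_nonneg _) h8
    rw [add_mul, abs_le]
    constructor <;> linarith) (e := d) hprimeC
  have h1 := (hcount 1 one_ne_zero).1
  rw [pow_one] at h1
  have h2 : (primeSum k B 1 : ℝ) ≤ {P ∈ ratPts fΩ (Nat.card k) | aeval P.1 D ≠ 0}.ncard +
      (d * D.natDegree : ℕ) := by exact_mod_cast h1
  linarith

end Chart

end PlaneCurve

namespace PlaneCurve

open Polynomial

section PlaneBound

variable {k : Type*} [Field k] [Finite k] {f : k[X][X]} {d : ℕ}

theorem le_ncard_of_inftyRing_adjoinRoot {F : Type*} [Field F] {O : Type*} [CommRing O]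
    [Algebra k[X] F] [Algebra O F] [Algebra k F] [Algebra k O] [IsScalarTower k O F]
    [IsScalarTower k k[X] F] {w : O} (h : InftyRing k F w) [IsFractionRing k[X] F]
    [IsDomain O] [IsFractionRing O F] [IsPrincipalIdealRing O] (hf : f.Monic)
    (hd : f.natDegree = d) (hd0 : 0 < d) (hfd : BiDeg d f) (hder : derivative f ≠ 0)
    {Ω : Type*} [Field Ω] [IsAlgClosed Ω] [Algebra k Ω]
    (hirr : Irreducible (f.map (mapRingHom (algebraMap k Ω)))) :
    (Nat.card k : ℝ) + 1 - (2 * ((d - 1) * (d - 2) / 2) : ℕ) * √(Nat.card k : ℝ) - d -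
      (d * (disc f).natDegree : ℕ) ≤
      {P ∈ ratPts (f.map (mapRingHom (algebraMap k Ω))) (Nat.card k) |
        aeval P.1 (disc f) ≠ 0}.ncard := by
  have hirrk : Irreducible f := hf.irreducible_of_irreducible_map _ _ hirr
  set fF := f.map (algebraMap k[X] F) with hfF
  have hinjF : Function.Injective (algebraMap k[X] F) := IsFractionRing.injective k[X] F
  have hirrF : Irreducible fF := (hf.irreducible_iff_irreducible_map_fraction_map).1 hirrk
  have hmonF : fF.Monic := hf.map _
  have : Fact (Irreducible fF) := ⟨hirrF⟩
  have hfin : FiniteDimensional F (AdjoinRoot fF) := hmonF.finite_adjoinRoot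
  have htop : Algebra.adjoin F {AdjoinRoot.root fF} = ⊤ := AdjoinRoot.adjoinRoot_eq_top
  have hmin : minpoly F (AdjoinRoot.root fF) = fF :=
    (minpoly.eq_of_irreducible_of_monic hirrF (by simp) hmonF).symm
  have hsep : Algebra.IsSeparable F (AdjoinRoot fF) := by
    have h1 : IsSeparable F (AdjoinRoot.root fF) := by
      rw [IsSeparable, hmin]
      refine (separable_iff_derivative_ne_zero hirrF).2 ?_
      rw [hfF, derivative_map]
      exact (Polynomial.map_ne_zero_iff hinjF).2 hder
    have h2 := (IntermediateField.isSeparable_adjoin_simple_iff_isSeparable F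
      (AdjoinRoot fF)).2 h1
    have h3 : IntermediateField.adjoin F {AdjoinRoot.root fF} = ⊤ :=
      IntermediateField.adjoin_eq_top_of_algebra _ _ htop
    rw [h3] at h2
    exact Algebra.IsSeparable.of_algHom F _
      (IntermediateField.topEquiv.symm : AdjoinRoot fF ≃ₐ[F] _).toAlgHom
  exact le_ncard_of_inftyRing h hf hd hd0 hfd hmin htop hirr

/-- The Hasse-Weil lower bound for absolutely irreducible plane curves. -/
theorem le_ncard_disc_ne_zero (hf : f.Monic)
    (hd : f.natDegree = d) (hd0 : 0 < d) (hfd : BiDeg d f) (hder : derivative f ≠ 0)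
    {Ω : Type*} [Field Ω] [IsAlgClosed Ω] [Algebra k Ω]
    (hirr : Irreducible (f.map (mapRingHom (algebraMap k Ω)))) :
    (Nat.card k : ℝ) + 1 - (2 * ((d - 1) * (d - 2) / 2) : ℕ) * √(Nat.card k : ℝ) - d -
      (d * (disc f).natDegree : ℕ) ≤
      {P : k × k | f.evalEval P.1 P.2 = 0 ∧ (disc f).eval P.1 ≠ 0}.ncard := by
  obtain ⟨w, hw⟩ := exists_inftyRing (k := k)
  let alg : k →+* localInfty k :=
    (algebraMap k (RatFunc k)).codRestrict (localInfty k).toSubring fun c => by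
      by_cases hc : c = 0
      · rw [hc, map_zero]
        exact zero_mem _
      · change algebraMap k (RatFunc k) c ∈ localInfty k
        rw [mem_localInfty ((_root_.map_ne_zero _).2 hc), RatFunc.algebraMap_eq_C, RatFunc.intDegree_C]
  let : Algebra k (localInfty k) := alg.toAlgebra
  have : IsScalarTower k (localInfty k) (RatFunc k) := IsScalarTower.of_algebraMap_eq fun c => rfl
  refine (le_ncard_of_inftyRing_adjoinRoot hw hf hd hd0 hfd hder hirr).trans (Nat.cast_le.2 ?_)
  have := Fintype.ofFinite k
  have hfr : ∀ z : Ω, z ^ Nat.card k = z → ∃ c : k, algebraMap k Ω c = z := by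
    intro z hz
    by_contra! h
    classical
    have h1 : (X ^ Nat.card k - X : Polynomial Ω) ≠ 0 :=
      FiniteField.X_pow_card_sub_X_ne_zero Ω Finite.one_lt_card
    have h2 := card_roots' (X ^ Nat.card k - X : Polynomial Ω)
    rw [FiniteField.X_pow_card_sub_X_natDegree_eq Ω Finite.one_lt_card] at h2
    have h3 : insert z (Finset.univ.map ⟨_, (algebraMap k Ω).injective⟩) ⊆
        (X ^ Nat.card k - X : Polynomial Ω).roots.toFinset := by
      intro t ht
      rw [Multiset.mem_toFinset, mem_roots h1]
      rw [Finset.mem_insert, Finset.mem_map] at ht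
      rcases ht with rfl | ⟨c, -, rfl⟩
      · simp only [IsRoot.def, eval_sub, eval_pow, eval_X, hz, sub_self]
      · simp only [Function.Embedding.coeFn_mk, IsRoot.def, eval_sub, eval_pow, eval_X]
        rw [← map_pow, Nat.card_eq_fintype_card, FiniteField.pow_card, sub_self]
    have h4 := (Finset.card_le_card h3).trans (Multiset.toFinset_card_le _)
    rw [Finset.card_insert_of_notMem (by simpa using h), Finset.card_map, Finset.card_univ,
      ← Nat.card_eq_fintype_card] at h4
    omega
  refine (Set.ncard_le_ncard (t := Prod.map (algebraMap k Ω) (algebraMap k Ω) ''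
    {P : k × k | f.evalEval P.1 P.2 = 0 ∧ (disc f).eval P.1 ≠ 0}) ?_
    (Set.toFinite _)).trans (Set.ncard_image_le (Set.toFinite _))
  rintro ⟨x, y⟩ ⟨⟨h1, h2, h3⟩, h4⟩
  obtain ⟨x, rfl⟩ := hfr x h2
  obtain ⟨y, rfl⟩ := hfr y h3
  refine ⟨(x, y), ⟨?_, ?_⟩, rfl⟩
  · rw [map_mapRingHom_evalEval] at h1
    exact (map_eq_zero _).1 h1
  · intro h5
    exact h4 (by rw [aeval_algebraMap_apply, coe_aeval_eq_eval, h5, map_zero])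

end PlaneBound

end PlaneCurve

namespace PlaneCurve

open Polynomial

section LineSection

variable {A B B' : Type*} [CommRing A] [CommRing B] [CommRing B'] {n d : ℕ}

/-- The restriction of a polynomial to the line through `a` in direction `b`. -/
noncomputable def lineSec (φ : A →+* B) (G : MvPolynomial (Fin n) A) (a b : Fin n → B) : B[X] :=
  G.eval₂ (C.comp φ) (fun i => C (a i) + C (b i) * X)

theorem map_lineSec (φ : A →+* B) (G : MvPolynomial (Fin n) A) (a b : Fin n → B) (ψ : B →+* B') :
    (lineSec φ G a b).map ψ = lineSec (ψ.comp φ) G (ψ ∘ a) (ψ ∘ b) := by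
  rw [lineSec, lineSec, ← coe_mapRingHom, MvPolynomial.eval₂_comp_left]
  congr 1
  · ext x; simp
  · ext1 i; simp

theorem ringHom_lineSec (φ : A →+* B) (G : MvPolynomial (Fin n) A) (a b : Fin n → B)
    (ψ : B[X] →+* B') : ψ (lineSec φ G a b) =
      G.eval₂ (ψ.comp (C.comp φ)) (fun i => ψ (C (a i) + C (b i) * X)) := by
  rw [lineSec, MvPolynomial.eval₂_comp_left]
  rfl

theorem lineSec_map {A' : Type*} [CommRing A'] (φ : A →+* B) (ρ : A' →+* A)
    (G : MvPolynomial (Fin n) A') (a b : Fin n → B) :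
    lineSec φ (MvPolynomial.map ρ G) a b = lineSec (φ.comp ρ) G a b := by
  rw [lineSec, lineSec, MvPolynomial.eval₂_map]
  rfl

theorem eval_lineSec (φ : A →+* B) (G : MvPolynomial (Fin n) A) (a b : Fin n → B) (y : B) :
    (lineSec φ G a b).eval y = G.eval₂ φ (fun i => a i + b i * y) := by
  rw [lineSec, ← coe_evalRingHom, MvPolynomial.eval₂_comp_left]
  congr 1
  · ext x; simp
  · ext1 i; simp

theorem lineSec_pow (φ : A →+* B) (G : MvPolynomial (Fin n) A) (a b : Fin n → B) (m : ℕ) :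
    lineSec φ (G ^ m) a b = lineSec φ G a b ^ m :=
  MvPolynomial.eval₂_pow ..

/-- The derivative of a polynomial in the direction `v`. -/
noncomputable def dirDeriv (v : Fin n → A) (G : MvPolynomial (Fin n) A) : MvPolynomial (Fin n) A :=
  ∑ i, MvPolynomial.C (v i) * MvPolynomial.pderiv i G

theorem dirDeriv_mul_X (v : Fin n → A) (G : MvPolynomial (Fin n) A) (i : Fin n) :
    dirDeriv v (G * MvPolynomial.X i) =
      dirDeriv v G * MvPolynomial.X i + G * MvPolynomial.C (v i) := by
  simp only [dirDeriv, Derivation.leibniz, smul_eq_mul, MvPolynomial.pderiv_X, mul_add,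
    Finset.sum_add_distrib, Finset.sum_mul]
  rw [add_comm]
  congr 1
  · exact Finset.sum_congr rfl fun j _ => by ring
  · rw [Finset.sum_eq_single i]
    · simp; ring
    · intro j _ hj
      simp [Ne.symm hj]
    · simp

theorem derivative_lineSec (φ : A →+* B) (G : MvPolynomial (Fin n) A) (a : Fin n → B)
    (v : Fin n → A) : derivative (lineSec φ G a (φ ∘ v)) = lineSec φ (dirDeriv v G) a (φ ∘ v) := by
  induction G using MvPolynomial.induction_on with
  | C c => simp [lineSec, dirDeriv]
  | add p q hp hq =>
    have h1 : dirDeriv v (p + q) = dirDeriv v p + dirDeriv v q := by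
      simp [dirDeriv, mul_add, Finset.sum_add_distrib]
    rw [h1]
    simp only [lineSec, MvPolynomial.eval₂_add, map_add] at hp hq ⊢
    rw [hp, hq]
  | mul_X p i hp =>
    rw [dirDeriv_mul_X]
    simp only [lineSec, MvPolynomial.eval₂_add, MvPolynomial.eval₂_mul, MvPolynomial.eval₂_X,
      derivative_mul, MvPolynomial.eval₂_C] at hp ⊢
    rw [hp]
    simp

theorem natDegree_prod_lin_le (a b : Fin n → B) (m : Fin n →₀ ℕ) (s : Finset (Fin n)) :
    (∏ i ∈ s, (C (a i) + C (b i) * X) ^ m i).natDegree ≤ ∑ i ∈ s, m i ∧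
    (∏ i ∈ s, (C (a i) + C (b i) * X) ^ m i).coeff (∑ i ∈ s, m i) = ∏ i ∈ s, b i ^ m i := by
  classical
  induction s using Finset.induction_on with
  | empty => simp
  | insert i s hi ih =>
    rw [Finset.prod_insert hi, Finset.sum_insert hi, Finset.prod_insert hi]
    have h1 : (C (a i) + C (b i) * X).natDegree ≤ 1 := by
      rw [add_comm]; exact natDegree_linear_le
    have h2 : ((C (a i) + C (b i) * X) ^ m i).natDegree ≤ m i := by
      simpa using natDegree_pow_le_of_le (m i) h1
    have h3 : ((C (a i) + C (b i) * X) ^ m i).coeff (m i) = b i ^ m i := by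
      have := coeff_pow_of_natDegree_le (m := m i) h1
      rw [mul_one] at this
      rw [this]
      simp
    exact ⟨natDegree_mul_le_of_le h2 ih.1, by rw [coeff_mul_add_eq_of_natDegree_le h2 ih.1, h3, ih.2]⟩

theorem _root_.MvPolynomial.IsHomogeneous.sum_eq_of_mem_support {G : MvPolynomial (Fin n) A}
    (hG : G.IsHomogeneous d) {m : Fin n →₀ ℕ} (hm : m ∈ G.support) : ∑ i, m i = d := by
  rw [← hG (MvPolynomial.mem_support_iff.1 hm), ← Finsupp.degree_eq_sum,
    Finsupp.degree_eq_weight_one]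
  rfl

theorem lineSec_eq_sum (φ : A →+* B) (G : MvPolynomial (Fin n) A) (a b : Fin n → B) :
    lineSec φ G a b = ∑ m ∈ G.support, C (φ (G.coeff m)) *
      ∏ i, (C (a i) + C (b i) * X) ^ m i :=
  MvPolynomial.eval₂_eq' ..

theorem natDegree_lineSec_le (φ : A →+* B) {G : MvPolynomial (Fin n) A} (hG : G.IsHomogeneous d)
    (a b : Fin n → B) : (lineSec φ G a b).natDegree ≤ d := by
  rw [lineSec_eq_sum]
  refine natDegree_sum_le_of_forall_le _ _ fun m hm => ?_
  refine (natDegree_C_mul_le _ _).trans ((natDegree_prod_lin_le a b m Finset.univ).1.trans ?_)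
  have := hG.sum_eq_of_mem_support hm
  exact this.le

theorem coeff_lineSec (φ : A →+* B) {G : MvPolynomial (Fin n) A} (hG : G.IsHomogeneous d)
    (a b : Fin n → B) : (lineSec φ G a b).coeff d = G.eval₂ φ b := by
  rw [lineSec_eq_sum, finsetSum_coeff, MvPolynomial.eval₂_eq']
  refine Finset.sum_congr rfl fun m hm => ?_
  have := hG.sum_eq_of_mem_support hm
  rw [coeff_C_mul, ← this, (natDegree_prod_lin_le a b m Finset.univ).2]

theorem monic_lineSec (φ : A →+* B) {G : MvPolynomial (Fin n) A} (hG : G.IsHomogeneous d)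
    (a : Fin n → B) {v : Fin n → A} (hv : MvPolynomial.eval v G = 1) :
    (lineSec φ G a (φ ∘ v)).Monic := by
  refine monic_of_natDegree_le_of_coeff_eq_one d (natDegree_lineSec_le φ hG a _) ?_
  rw [coeff_lineSec φ hG, ← map_one φ, ← hv, ← MvPolynomial.eval₂_id, MvPolynomial.eval₂_comp_left]
  rfl

theorem natDegree_lineSec [Nontrivial B] (φ : A →+* B) {G : MvPolynomial (Fin n) A}
    (hG : G.IsHomogeneous d) (a : Fin n → B) {v : Fin n → A} (hv : MvPolynomial.eval v G = 1) :
    (lineSec φ G a (φ ∘ v)).natDegree = d := by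
  refine le_antisymm (natDegree_lineSec_le φ hG a _) (le_natDegree_of_ne_zero ?_)
  rw [coeff_lineSec φ hG]
  have : G.eval₂ φ (φ ∘ v) = φ 1 := by
    rw [← hv, ← MvPolynomial.eval₂_id, MvPolynomial.eval₂_comp_left]
    rfl
  rw [this, map_one]
  exact one_ne_zero

theorem biDeg_lineSec (φ : A →+* B[X]) {G : MvPolynomial (Fin n) A} (hφ : ∀ c, (φ c).natDegree = 0)
    (hG : G.IsHomogeneous d) {a b : Fin n → B[X]} (ha : ∀ i, (a i).natDegree ≤ 1)
    (hb : ∀ i, (b i).natDegree = 0) : BiDeg d (lineSec φ G a b) := by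
  classical
  rw [lineSec_eq_sum]
  refine BiDeg.sum _ _ fun m hm => ?_
  have hd := hG.sum_eq_of_mem_support hm
  have h1 : ∀ s : Finset (Fin n), BiDeg (∑ i ∈ s, m i)
      (∏ i ∈ s, (C (a i) + C (b i) * X) ^ m i) := by
    intro s
    induction s using Finset.induction_on with
    | empty => simpa using BiDeg.one
    | insert i s hi ih =>
      rw [Finset.prod_insert hi, Finset.sum_insert hi]
      refine BiDeg.mul ?_ ih
      have h2 : BiDeg 1 (C (a i) + C (b i) * X) :=
        (biDeg_C (ha i)).add (by simpa using (biDeg_C (hb i).le).mul (biDeg_X (A := B)))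
      simpa using h2.pow (m i)
  have := (biDeg_C (hφ (G.coeff m)).le).mul (h1 Finset.univ)
  rwa [zero_add, hd] at this

end LineSection

section SchwartzZippel

variable {k κ : Type*} [Field k] [Fintype k] [Field κ] {n : ℕ}

theorem exists_eval_ne_zero (φ : k →+* κ) {P : MvPolynomial (Fin n) κ} (h0 : P ≠ 0)
    (hP : P.totalDegree < Fintype.card k) : ∃ x : Fin n → k, MvPolynomial.eval (φ ∘ x) P ≠ 0 := by
  classical
  by_contra! h
  set S : Finset κ := Finset.univ.map ⟨φ, φ.injective⟩ with hS
  have hcard : S.card = Fintype.card k := by simp [hS]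
  have h1 := MvPolynomial.schwartz_zippel_totalDegree h0 S
  have h2 : (Fintype.piFinset fun _ : Fin n => S).filter (fun x => MvPolynomial.eval x P = 0) =
      Fintype.piFinset fun _ : Fin n => S := by
    refine Finset.filter_true_of_mem fun x hx => ?_
    rw [Fintype.mem_piFinset] at hx
    have : ∀ i, ∃ y : k, φ y = x i := fun i => by simpa [hS] using hx i
    choose y hy using this
    rw [← h y]
    congr 2
    ext1 i; exact (hy i).symm
  have hpos : (0 : ℚ≥0) < S.card := by
    rw [hcard]; exact_mod_cast Fintype.card_pos
  rw [h2, Fintype.card_piFinset_const, Nat.cast_pow, div_self (by positivity),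
    le_div_iff₀ hpos, one_mul, hcard] at h1
  have : Fintype.card k ≤ P.totalDegree := by exact_mod_cast h1
  omega

end SchwartzZippel

end PlaneCurve

namespace PlaneCurve

open Polynomial

section GenericSection

variable {K : Type*} [Field K] {n d e : ℕ}

/-- The polynomials in `t` whose `j`-th coefficient has total degree at most `j`. -/
def weightSubring (K : Type*) [Field K] (n : ℕ) : Subring (MvPolynomial (Fin n) K)[X] where
  carrier := {P | ∀ j, (P.coeff j).totalDegree ≤ j}
  mul_mem' := by
    intro P Q hP hQ j
    rw [coeff_mul]
    refine MvPolynomial.totalDegree_finsetSum_le fun x hx => ?_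
    have := MvPolynomial.totalDegree_mul (P.coeff x.1) (Q.coeff x.2)
    have := hP x.1
    have := hQ x.2
    have : x.1 + x.2 = j := by simpa using hx
    omega
  one_mem' := by
    intro j
    rw [coeff_one]
    split_ifs <;> simp
  add_mem' := by
    intro P Q hP hQ j
    rw [coeff_add]
    exact (MvPolynomial.totalDegree_add _ _).trans (max_le (hP j) (hQ j))
  zero_mem' := by intro j; simp
  neg_mem' := by
    intro P hP j
    rw [coeff_neg, MvPolynomial.totalDegree_neg]
    exact hP j

theorem C_C_mem_weightSubring (c : K) :
    (C (MvPolynomial.C c) : (MvPolynomial (Fin n) K)[X]) ∈ weightSubring K n := by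
  intro j
  rw [coeff_C]
  split_ifs <;> simp

theorem X_mul_mem_weightSubring (i : Fin n) :
    (C (MvPolynomial.X i) * X : (MvPolynomial (Fin n) K)[X]) ∈ weightSubring K n := by
  intro j
  rw [coeff_C_mul, coeff_X]
  split_ifs with h
  · subst h; simp
  · simp

theorem X_mem_weightSubring :
    (X : (MvPolynomial (Fin n) K)[X]) ∈ weightSubring K n := by
  intro j
  rw [coeff_X]
  split_ifs <;> simp

/-- The restriction of a form to the plane through `u` spanned by `w` and `v`. -/
noncomputable def planeSec (G : MvPolynomial (Fin n) K) (u v w : Fin n → K) : K[X][X] :=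
  lineSec C G (fun i => C (u i) + C (w i) * X) (C ∘ v)

/-- The restriction of a form to the plane through `u` spanned by `v` and a generic vector. -/
noncomputable def genSec (G : MvPolynomial (Fin n) K) (u v : Fin n → K) :
    (MvPolynomial (Fin n) K)[X][X] :=
  lineSec (C.comp MvPolynomial.C) G (fun i => C (MvPolynomial.C (u i)) + C (MvPolynomial.X i) * X)
    ((C.comp MvPolynomial.C) ∘ v)

theorem exists_map_eq_genSec (G : MvPolynomial (Fin n) K) (u v : Fin n → K) :
    ∃ f : (weightSubring K n)[X], f.map (weightSubring K n).subtype = genSec G u v ∧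
      (G.IsHomogeneous d → MvPolynomial.eval v G = 1 → f.Monic) := by
  set φ : K →+* weightSubring K n :=
    (C.comp MvPolynomial.C).codRestrict (weightSubring K n) (fun c => C_C_mem_weightSubring c)
  refine ⟨lineSec φ G (fun i => φ (u i) + ⟨_, X_mul_mem_weightSubring i⟩) (φ ∘ v), ?_,
    fun hG hv => monic_lineSec φ hG _ hv⟩
  rw [map_lineSec]
  rfl

theorem monic_genSec {G : MvPolynomial (Fin n) K} (hG : G.IsHomogeneous d) (u : Fin n → K)
    {v : Fin n → K} (hv : MvPolynomial.eval v G = 1) : (genSec G u v).Monic :=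
  monic_lineSec _ hG _ hv

theorem monic_planeSec {G : MvPolynomial (Fin n) K} (hG : G.IsHomogeneous d) (u w : Fin n → K)
    {v : Fin n → K} (hv : MvPolynomial.eval v G = 1) : (planeSec G u v w).Monic :=
  monic_lineSec _ hG _ hv

theorem natDegree_genSec {G : MvPolynomial (Fin n) K} (hG : G.IsHomogeneous d) (u : Fin n → K)
    {v : Fin n → K} (hv : MvPolynomial.eval v G = 1) : (genSec G u v).natDegree = d :=
  natDegree_lineSec _ hG _ hv

theorem natDegree_planeSec {G : MvPolynomial (Fin n) K} (hG : G.IsHomogeneous d) (u w : Fin n → K)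
    {v : Fin n → K} (hv : MvPolynomial.eval v G = 1) : (planeSec G u v w).natDegree = d :=
  natDegree_lineSec _ hG _ hv

theorem natDegree_C_add_C_mul_X_le {A : Type*} [CommRing A] (a b : A) :
    (C a + C b * X).natDegree ≤ 1 := by
  rw [add_comm]; exact natDegree_linear_le

theorem biDeg_genSec {G : MvPolynomial (Fin n) K} (hG : G.IsHomogeneous d) (u v : Fin n → K) :
    BiDeg d (genSec G u v) :=
  biDeg_lineSec _ (fun c => by simp) hG (fun i => natDegree_C_add_C_mul_X_le _ _)
    (fun i => by simp)

theorem biDeg_planeSec {G : MvPolynomial (Fin n) K} (hG : G.IsHomogeneous d) (u v w : Fin n → K) :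
    BiDeg d (planeSec G u v w) :=
  biDeg_lineSec _ (fun c => by simp) hG (fun i => natDegree_C_add_C_mul_X_le _ _)
    (fun i => by simp)

theorem map_genSec (G : MvPolynomial (Fin n) K) (u v w : Fin n → K) :
    (genSec G u v).map (mapRingHom (MvPolynomial.eval w)) = planeSec G u v w := by
  rw [genSec, planeSec, map_lineSec]
  congr 1
  · ext1 c; simp
  · ext1 i; simp
  · ext1 i; simp

theorem map_planeSec {K' : Type*} [Field K'] (φ : K →+* K') (G : MvPolynomial (Fin n) K)
    (u v w : Fin n → K) : (planeSec G u v w).map (mapRingHom φ) =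
      planeSec (MvPolynomial.map φ G) (φ ∘ u) (φ ∘ v) (φ ∘ w) := by
  rw [planeSec, planeSec, map_lineSec, lineSec_map]
  congr 1
  · ext1 c; simp
  · ext1 i; simp
  · ext1 i; simp

theorem evalEval_planeSec (G : MvPolynomial (Fin n) K) (u v w : Fin n → K) (x y : K) :
    (planeSec G u v w).evalEval x y =
      MvPolynomial.eval (fun i => u i + w i * x + v i * y) G := by
  rw [evalEval, planeSec, eval_lineSec, ← coe_evalRingHom, MvPolynomial.eval₂_comp_left,
    ← MvPolynomial.eval₂_id]
  congr 1
  · ext1 c; simp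
  · ext1 i; simp

theorem derivative_planeSec (G : MvPolynomial (Fin n) K) (u v w : Fin n → K) :
    derivative (planeSec G u v w) = planeSec (dirDeriv v G) u v w :=
  derivative_lineSec C G _ v

theorem planeSec_pow (G : MvPolynomial (Fin n) K) (u v w : Fin n → K) (m : ℕ) :
    planeSec (G ^ m) u v w = planeSec G u v w ^ m :=
  lineSec_pow ..

theorem not_genSec_dvd {G H : MvPolynomial (Fin n) K} (hGH : ¬ G ∣ H) (u v : Fin n → K) :
    ¬ genSec G u v ∣ genSec H u v := by
  set Θ : (MvPolynomial (Fin n) K)[X][X] →+* MvPolynomial (Fin n) K :=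
    (MvPolynomial.eval₂Hom MvPolynomial.C (fun i => MvPolynomial.X i - MvPolynomial.C (u i))).comp
      ((evalRingHom 1).comp (evalRingHom 0)) with hΘ
  have key : ∀ F : MvPolynomial (Fin n) K, Θ (genSec F u v) = F := by
    intro F
    refine (ringHom_lineSec _ F _ _ Θ).trans (Eq.trans ?_ (MvPolynomial.eval₂_eta F))
    congr 1
    · ext1 c; simp [hΘ]
    · ext1 i; simp [hΘ]
  intro h
  apply hGH
  have := map_dvd Θ h
  rwa [key, key] at this

theorem exists_forall_not_planeSec_dvd {G H : MvPolynomial (Fin n) K} (hG : G.IsHomogeneous d)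
    {v : Fin n → K} (hv : MvPolynomial.eval v G = 1) (hH : H.IsHomogeneous e) (hGH : ¬ G ∣ H)
    (u : Fin n → K) : ∃ P : MvPolynomial (Fin n) K, P ≠ 0 ∧ P.totalDegree ≤ e ∧
      ∀ w, MvPolynomial.eval w P ≠ 0 → ¬ planeSec G u v w ∣ planeSec H u v w := by
  have hm := monic_genSec hG u hv
  obtain ⟨f, hf, hfm⟩ := exists_map_eq_genSec (d := d) G u v
  obtain ⟨h, hh, -⟩ := exists_map_eq_genSec (d := d) H u v
  have hr : genSec H u v %ₘ genSec G u v ≠ 0 := by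
    rw [Ne, modByMonic_eq_zero_iff_dvd hm]
    exact not_genSec_dvd hGH u v
  have hr2 : genSec H u v %ₘ genSec G u v = (h %ₘ f).map (weightSubring K n).subtype := by
    rw [map_modByMonic _ (hfm hG hv), hf, hh]
  have hr3 : BiDeg e (genSec H u v %ₘ genSec G u v) :=
    BiDeg.modByMonic hm (natDegree_genSec hG u hv) (biDeg_genSec hG u v) (biDeg_genSec hH u v)
  obtain ⟨i, hi⟩ : ∃ i, (genSec H u v %ₘ genSec G u v).coeff i ≠ 0 := by
    by_contra! h0
    exact hr (Polynomial.ext (by simpa using h0))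
  obtain ⟨j, hj⟩ : ∃ j, ((genSec H u v %ₘ genSec G u v).coeff i).coeff j ≠ 0 := by
    by_contra! h0
    exact hi (Polynomial.ext (by simpa using h0))
  refine ⟨_, hj, ?_, fun w hw hdvd => ?_⟩
  · have h1 : j ≤ e := by
      have := hr3 i hi
      have := le_natDegree_of_ne_zero hj
      omega
    refine le_trans ?_ h1
    rw [hr2, coeff_map]
    exact ((h %ₘ f).coeff i).2 j
  · rw [← map_genSec, ← map_genSec, ← modByMonic_eq_zero_iff_dvd (hm.map _),
      ← map_modByMonic _ hm] at hdvd
    have := congrArg (fun P => (P.coeff i).coeff j) hdvd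
    simp only [coeff_map, coe_mapRingHom, coeff_zero] at this
    exact hw this

/-- The endomorphism of `K[W][s]` which fixes `s` and replaces the variables by `p`. -/
noncomputable def substHom (p : Fin n → (MvPolynomial (Fin n) K)[X]) :
    (MvPolynomial (Fin n) K)[X] →+* (MvPolynomial (Fin n) K)[X] :=
  eval₂RingHom (MvPolynomial.eval₂Hom (C.comp MvPolynomial.C) p) X

theorem substHom_C (p : Fin n → (MvPolynomial (Fin n) K)[X]) (G : MvPolynomial (Fin n) K) :
    substHom p (C G) = G.eval₂ (C.comp MvPolynomial.C) p := by
  rw [substHom, coe_eval₂RingHom, eval₂_C, MvPolynomial.coe_eval₂Hom]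

theorem substHom_comp {p r : Fin n → (MvPolynomial (Fin n) K)[X]}
    (h : ∀ i, substHom p (r i) = C (MvPolynomial.X i)) :
    (substHom p).comp (substHom r) = RingHom.id _ := by
  apply Polynomial.ringHom_ext'
  · apply MvPolynomial.ringHom_ext
    · intro c; simp [substHom_C]
    · intro i; simpa [substHom_C] using h i
  · simp [substHom]

theorem map_genSec_one (G : MvPolynomial (Fin n) K) (u v : Fin n → K) :
    (genSec G u v).map (evalRingHom 1) = G.eval₂ (C.comp MvPolynomial.C)
      (fun i => C (MvPolynomial.C (u i) + MvPolynomial.X i) + C (MvPolynomial.C (v i)) * X) := by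
  rw [genSec, map_lineSec, lineSec]
  have h1 : (evalRingHom (1 : MvPolynomial (Fin n) K)).comp (C.comp MvPolynomial.C) =
    (MvPolynomial.C : K →+* MvPolynomial (Fin n) K) := by ext1 c; simp
  rw [h1]
  refine congrArg (fun p => G.eval₂ (C.comp MvPolynomial.C) p) ?_
  ext1 i
  simp

theorem irreducible_genSec {G : MvPolynomial (Fin n) K} (hG : G.IsHomogeneous d)
    (hirr : Irreducible G) (u : Fin n → K) {v : Fin n → K} (hv : MvPolynomial.eval v G = 1) :
    Irreducible (genSec G u v) := by
  refine Monic.irreducible_of_irreducible_map (evalRingHom 1) _ (monic_genSec hG u hv) ?_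
  rw [map_genSec_one, ← substHom_C]
  have h1 := substHom_comp (p := fun i => C (MvPolynomial.C (u i) + MvPolynomial.X i) +
      C (MvPolynomial.C (v i)) * X) (r := fun i => C (MvPolynomial.X i - MvPolynomial.C (u i)) -
      C (MvPolynomial.C (v i)) * X) fun i => by
    simp only [map_sub, map_add, map_mul, substHom_C, MvPolynomial.eval₂_X, MvPolynomial.eval₂_C]
    simp [substHom]
    ring
  have h2 := substHom_comp (r := fun i => C (MvPolynomial.C (u i) + MvPolynomial.X i) +
      C (MvPolynomial.C (v i)) * X) (p := fun i => C (MvPolynomial.X i - MvPolynomial.C (u i)) -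
      C (MvPolynomial.C (v i)) * X) fun i => by
    simp only [map_sub, map_add, map_mul, substHom_C, MvPolynomial.eval₂_X, MvPolynomial.eval₂_C]
    simp [substHom]
    ring
  exact (MulEquiv.irreducible_iff (RingEquiv.ofRingHom _ _ h1 h2)).2
    (prime_C_iff.2 hirr.prime).irreducible

theorem exists_approx_root (S : Subring (MvPolynomial (Fin n) K)[X]) (f : S[X])
    (hS : ∀ c : K, C (MvPolynomial.C c) ∈ S) (y c : K) (hc : c ≠ 0)
    (h0 : X ∣ (f.map S.subtype).eval (C (MvPolynomial.C y)))
    (h1 : X ∣ (derivative (f.map S.subtype)).eval (C (MvPolynomial.C y)) - C (MvPolynomial.C c))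
    (m : ℕ) : ∃ σ : S, X ∣ (σ : (MvPolynomial (Fin n) K)[X]) - C (MvPolynomial.C y) ∧
      X ^ (m + 1) ∣ (f.map S.subtype).eval (σ : (MvPolynomial (Fin n) K)[X]) := by
  induction m with
  | zero => exact ⟨⟨_, hS y⟩, by simp, by simpa using h0⟩
  | succ m ih =>
    obtain ⟨σ, hσ, hm⟩ := ih
    set F := f.map S.subtype with hF
    have hmem : F.eval (σ : (MvPolynomial (Fin n) K)[X]) ∈ S := by
      have : F.eval (S.subtype σ) = S.subtype (f.eval σ) := by
        rw [hF, eval_map_apply]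
      exact this ▸ (f.eval σ).2
    have h2 : X ∣ (derivative F).eval (σ : (MvPolynomial (Fin n) K)[X]) - C (MvPolynomial.C c) := by
      have := dvd_add (hσ.trans (sub_dvd_eval_sub _ _ (derivative F))) h1
      rwa [sub_add_sub_cancel] at this
    have hcc : (C (MvPolynomial.C c) : (MvPolynomial (Fin n) K)[X]) * C (MvPolynomial.C c⁻¹) = 1 := by
      rw [← C_mul, ← MvPolynomial.C_mul, mul_inv_cancel₀ hc]
      simp
    refine ⟨σ - ⟨_, hS c⁻¹⟩ * ⟨_, hmem⟩, ?_, ?_⟩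
    · push_cast
      have : (X : (MvPolynomial (Fin n) K)[X]) ∣ F.eval (σ : (MvPolynomial (Fin n) K)[X]) :=
        (dvd_pow_self X m.succ_ne_zero).trans hm
      have h3 := dvd_sub hσ (this.mul_left (C (MvPolynomial.C c⁻¹)))
      convert h3 using 1
      ring
    · push_cast
      obtain ⟨r, hr⟩ := hm
      obtain ⟨s, hs⟩ := h2
      obtain ⟨z, hz⟩ := binomExpansion F (σ : (MvPolynomial (Fin n) K)[X])
        (-(C (MvPolynomial.C c⁻¹) * F.eval (σ : (MvPolynomial (Fin n) K)[X])))
      rw [← sub_eq_add_neg] at hz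
      rw [hz]
      set a := (C (MvPolynomial.C c⁻¹) : (MvPolynomial (Fin n) K)[X])
      set b := (C (MvPolynomial.C c) : (MvPolynomial (Fin n) K)[X])
      have h4 : (derivative F).eval (σ : (MvPolynomial (Fin n) K)[X]) = b + X * s := by
        linear_combination hs
      rw [h4, hr]
      refine ⟨-s * a * r + z * a ^ 2 * r ^ 2 * X ^ m, ?_⟩
      linear_combination -(X ^ (m + 1) * r) * hcc

end GenericSection

end PlaneCurve

namespace PlaneCurve

open Polynomial

section Minor

theorem exists_minor_ne_zero {A ι : Type*} [CommRing A] [IsDomain A] [Fintype ι] [DecidableEq ι]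
    {N : ℕ} (M : Matrix (Fin N) ι A) (hM : ∀ c, M.mulVec c = 0 → c = 0) :
    ∃ e : ι → Fin N, (M.submatrix e id).det ≠ 0 := by
  set L := FractionRing A
  set M' : Matrix (Fin N) ι L := M.map (algebraMap A L) with hM'
  have h1 : LinearIndependent L M'.transpose.row := by
    rw [← LinearIndependent.iff_fractionRing (R := A), Fintype.linearIndependent_iff]
    intro g hg
    have : M.mulVec g = 0 := by
      ext1 j
      rw [Pi.zero_apply, ← FaithfulSMul.algebraMap_eq_zero_iff A L, Matrix.mulVec, dotProduct,
        map_sum, ← Pi.zero_apply (M := fun _ => L) j, ← congrFun hg j, Finset.sum_apply]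
      refine Finset.sum_congr rfl fun i _ => ?_
      rw [map_mul, mul_comm, ← Algebra.smul_def]
      rfl
    exact congrFun (hM g this)
  have h2 : M'.rank = Fintype.card ι := by
    rw [← Matrix.rank_transpose]
    exact h1.rank_matrix
  obtain ⟨τ, a, ha, hspan, hli⟩ := exists_linearIndependent' L M'.row
  have := Finite.of_injective a ha
  have := Fintype.ofFinite τ
  have h3 : Fintype.card τ = Fintype.card ι := by
    rw [← h2, Matrix.rank_eq_finrank_span_row, ← hspan, finrank_span_eq_card hli]
  let ε : ι ≃ τ := Fintype.equivOfCardEq h3.symm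
  refine ⟨a ∘ ε, fun h0 => ?_⟩
  have h4 : LinearIndependent L (M'.submatrix (a ∘ ε) id).row := hli.comp ε ε.injective
  rw [Matrix.linearIndependent_rows_iff_isUnit, Matrix.isUnit_iff_isUnit_det] at h4
  have h5 : (M'.submatrix (a ∘ ε) id).det = algebraMap A L (M.submatrix (a ∘ ε) id).det := by
    rw [RingHom.map_det]
    rfl
  rw [h5, h0, map_zero] at h4
  exact not_isUnit_zero h4

theorem totalDegree_det_le {R ι σ : Type*} [CommRing R] [Fintype ι] [DecidableEq ι] {J : ℕ}
    (M : Matrix ι ι (MvPolynomial σ R)) (hM : ∀ i j, (M i j).totalDegree ≤ J) :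
    M.det.totalDegree ≤ Fintype.card ι * J := by
  rw [Matrix.det_apply]
  refine MvPolynomial.totalDegree_finsetSum_le fun s _ => ?_
  have h1 : (Equiv.Perm.sign s • ∏ i, M (s i) i).totalDegree ≤
      (∏ i, M (s i) i).totalDegree := by
    rcases Int.units_eq_one_or (Equiv.Perm.sign s) with h | h <;> simp [h]
  refine h1.trans ((MvPolynomial.totalDegree_finsetProd _ _).trans ?_)
  refine (Finset.sum_le_card_nsmul _ _ J fun i _ => hM _ _).trans ?_
  simp

end Minor

section System

variable {A B : Type*} [CommRing A] [CommRing B] {d N : ℕ}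

/-- The coefficients of the linear conditions on a polynomial of degree less than `d` in `s` and at
most `d` in `t` to vanish at `s = σ` up to order `N`. -/
noncomputable def sysMat (d N : ℕ) (σ : A[X]) : Matrix (Fin N) (Fin d × Fin (d + 1)) A :=
  Matrix.of fun j p => (σ ^ (p.1 : ℕ) * X ^ (p.2 : ℕ)).coeff j

theorem sysMat_map (ψ : A →+* B) (σ : A[X]) :
    (sysMat d N σ).map ψ = sysMat d N (σ.map ψ) := by
  ext j p
  simp only [sysMat, Matrix.map_apply, Matrix.of_apply, ← coeff_map, Polynomial.map_mul,
    Polynomial.map_pow, map_X]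

/-- The polynomial with given coefficients, of degree less than `d` in `s` and at most `d`
in `t`. -/
noncomputable def sysPoly (c : Fin d × Fin (d + 1) → A) : A[X][X] :=
  ∑ p, monomial (p.1 : ℕ) (monomial (p.2 : ℕ) (c p))

theorem coeff_coeff_sysPoly (c : Fin d × Fin (d + 1) → A) (p : Fin d × Fin (d + 1)) :
    ((sysPoly c).coeff p.1).coeff p.2 = c p := by
  rw [sysPoly, finsetSum_coeff, finsetSum_coeff, Finset.sum_eq_single p]
  · simp
  · intro b _ hb
    rw [coeff_monomial]
    split_ifs with h1
    · rw [coeff_monomial, if_neg]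
      intro h2
      exact hb (Prod.ext (Fin.ext h1) (Fin.ext h2))
    · simp
  · simp

theorem X_pow_dvd_eval_sysPoly_iff (c : Fin d × Fin (d + 1) → A) (σ : A[X]) :
    X ^ N ∣ (sysPoly c).eval σ ↔ (sysMat d N σ).mulVec c = 0 := by
  have h : ∀ j : ℕ, ((sysPoly c).eval σ).coeff j =
      ∑ p : Fin d × Fin (d + 1), (σ ^ (p.1 : ℕ) * X ^ (p.2 : ℕ)).coeff j * c p := by
    intro j
    rw [sysPoly, eval_finsetSum, finsetSum_coeff]
    refine Finset.sum_congr rfl fun p _ => ?_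
    rw [eval_monomial, ← C_mul_X_pow_eq_monomial, mul_assoc, coeff_C_mul, mul_comm,
      mul_comm (X ^ _)]
  rw [X_pow_dvd_iff]
  constructor
  · intro h0
    ext1 j
    exact (h j).symm.trans (h0 j j.2)
  · intro h0 j hj
    rw [h]
    exact congrFun h0 ⟨j, hj⟩

theorem biDeg_sysPoly (c : Fin d × Fin (d + 1) → A) : BiDeg (2 * d - 1) (sysPoly c) := by
  refine BiDeg.sum _ _ fun p _ => BiDeg.monomial _ ?_
  have := p.1.2
  have := p.2.2
  omega

theorem natDegree_sysPoly_lt (hd : 0 < d) (c : Fin d × Fin (d + 1) → A) :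
    (sysPoly c).natDegree < d := by
  have : (sysPoly c).natDegree ≤ d - 1 := by
    refine natDegree_sum_le_of_forall_le _ _ fun p _ => (natDegree_monomial_le _).trans ?_
    have := p.1.2
    omega
  omega

theorem exists_sysPoly_eq {a : A[X][X]} (h1 : a.natDegree < d)
    (h2 : ∀ i, (a.coeff i).natDegree ≤ d) : ∃ c, a = sysPoly (d := d) c := by
  refine ⟨fun p => (a.coeff p.1).coeff p.2, ?_⟩
  rw [sysPoly, Fintype.sum_prod_type]
  conv_lhs => rw [as_sum_range' a d h1, ← Fin.sum_univ_eq_sum_range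
    (fun i => monomial i (a.coeff i))]
  refine Finset.sum_congr rfl fun i _ => ?_
  simp only
  rw [← map_sum]
  congr 1
  conv_lhs => rw [as_sum_range' (a.coeff i) (d + 1) (Nat.lt_succ_of_le (h2 i)),
    ← Fin.sum_univ_eq_sum_range (fun l => monomial l ((a.coeff i).coeff l))]

theorem eq_zero_of_X_pow_dvd_eval [IsDomain A] {f : A[X][X]} (hf : f.Monic) (hd : f.natDegree = d)
    (hfd : BiDeg d f) (hp : Prime f) {m : ℕ} {h : A[X][X]} (hh : BiDeg m h) (hhd : h.natDegree < d)
    {σ : A[X]} (h1 : X ^ (m * d + 1) ∣ f.eval σ) (h2 : X ^ (m * d + 1) ∣ h.eval σ) : h = 0 := by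
  have := AdjoinRoot.isDomain_of_prime hp
  by_contra h0
  have h3 : AdjoinRoot.mk f h ≠ 0 := by
    rw [Ne, AdjoinRoot.mk_eq_zero]
    exact hf.not_dvd_of_natDegree_lt h0 (by omega)
  have hfin : Module.Finite A[X] (AdjoinRoot f) := hf.finite_adjoinRoot
  have hfree : Module.Free A[X] (AdjoinRoot f) := hf.free_adjoinRoot
  have h4 : Algebra.norm A[X] (AdjoinRoot.mk f h) ≠ 0 := by
    rwa [Ne, Algebra.norm_eq_zero_iff]
  obtain ⟨r, hr⟩ : AdjoinRoot.mk f h ∣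
      algebraMap A[X] (AdjoinRoot f) (Algebra.norm A[X] (AdjoinRoot.mk f h)) :=
    dvd_norm (AdjoinRoot.powerBasis' hf).basis _
  obtain ⟨b, rfl⟩ := AdjoinRoot.mk_surjective r
  have h5 : ∀ x : A[X], algebraMap A[X] (AdjoinRoot f) x = AdjoinRoot.mk f (C x) := fun x => rfl
  rw [h5, ← map_mul, ← sub_eq_zero, ← map_sub, AdjoinRoot.mk_eq_zero] at hr
  obtain ⟨a, ha⟩ := hr
  have h6 := congrArg (eval σ) ha
  rw [eval_sub, eval_C, eval_mul, eval_mul, sub_eq_iff_eq_add] at h6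
  have h7 : X ^ (m * d + 1) ∣ Algebra.norm A[X] (AdjoinRoot.mk f h) := by
    rw [h6]
    exact dvd_add (h1.mul_right _) (h2.mul_right _)
  have h8 := natDegree_norm_le hf hd hfd hh
  apply h4
  ext j
  rw [coeff_zero]
  by_cases hj : j < m * d + 1
  · exact X_pow_dvd_iff.1 h7 j hj
  · exact coeff_eq_zero_of_natDegree_lt (by omega)

theorem natDegree_coeff_le_of_mul [IsDomain A] {f a b : A[X][X]} (hfd : BiDeg d f) (h0 : f ≠ 0)
    (hab : a * b = f) (i : ℕ) : (a.coeff i).natDegree ≤ d := by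
  have hcoeff : ∀ (P : A[X][X]) (i j : ℕ),
      ((Bivariate.swap P).coeff i).coeff j = (P.coeff j).coeff i := by
    intro P i j
    induction P using Polynomial.induction_on' with
    | add p q hp hq => simp [hp, hq]
    | monomial m p =>
      induction p using Polynomial.induction_on' with
      | add p q hp hq => simp only [map_add, coeff_add, hp, hq]
      | monomial l c =>
        rw [Bivariate.swap_monomial_monomial, coeff_monomial, coeff_monomial]
        split_ifs with h1 h2 h2 <;> simp [coeff_monomial, h1, h2]
  have h1 : (Bivariate.swap f).natDegree ≤ d := by
    rw [natDegree_le_iff_coeff_eq_zero]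
    intro m hm
    ext j
    rw [hcoeff, coeff_zero]
    by_cases hj : f.coeff j = 0
    · simp [hj]
    · have := hfd j hj
      exact coeff_eq_zero_of_natDegree_lt (by omega)
  have hne : Bivariate.swap f ≠ 0 := by simpa using h0
  rw [← hab, map_mul] at h1 hne
  rw [natDegree_mul (left_ne_zero_of_mul hne) (right_ne_zero_of_mul hne)] at h1
  rw [natDegree_le_iff_coeff_eq_zero]
  intro m hm
  rw [← hcoeff, coeff_eq_zero_of_natDegree_lt (p := Bivariate.swap a) (by omega), coeff_zero]

theorem irreducible_of_sysMat {κ : Type*} [Field κ] {f : κ[X][X]} (hf : f.Monic)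
    (hd : f.natDegree = d) (hd0 : 0 < d) (hfd : BiDeg d f) {σ : κ[X]} (h1 : X ^ N ∣ f.eval σ) (h2 : ¬ X ∣ (derivative f).eval σ)
    (hM : ∀ c, (sysMat d N σ).mulVec c = 0 → c = 0) : Irreducible f := by
  rw [hf.irreducible_iff_natDegree]
  refine ⟨fun h => by rw [h] at hd; simp at hd; omega, ?_⟩
  have key : ∀ a b : κ[X][X], a.Monic → b.Monic → a * b = f → b.natDegree ≠ 0 →
      ¬ X ∣ b.eval σ → False := by
    intro a b ha hb hab hb0 hXb
    have hlt : a.natDegree < d := by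
      have := ha.natDegree_mul hb
      rw [hab, hd] at this
      omega
    obtain ⟨c, hc⟩ := exists_sysPoly_eq hlt (natDegree_coeff_le_of_mul hfd hf.ne_zero hab)
    rw [← hab, eval_mul] at h1
    have h3 := prime_X.pow_dvd_of_dvd_mul_right N hXb h1
    rw [hc, X_pow_dvd_eval_sysPoly_iff] at h3
    have := hM c h3
    rw [this] at hc
    refine ha.ne_zero ?_
    rw [hc]
    simp [sysPoly]
  intro a b ha hb hab
  by_contra! hcon
  by_cases hXb : X ∣ b.eval σ
  · refine key b a hb ha (by rw [mul_comm, hab]) hcon.1 fun hXa => h2 ?_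
    rw [← hab, derivative_mul, eval_add, eval_mul, eval_mul]
    exact dvd_add (hXb.mul_left _) (hXa.mul_right _)
  · exact key a b ha hb hab hcon.2 hXb

end System

end PlaneCurve

namespace PlaneCurve

open Polynomial

section Bertini

variable {K : Type*} [Field K] {n d e : ℕ}

theorem coeff_zero_eval_genSec (F : MvPolynomial (Fin n) K) (u v : Fin n → K) (y : K) :
    ((genSec F u v).eval (C (MvPolynomial.C y))).coeff 0 =
      MvPolynomial.C (MvPolynomial.eval (fun i => u i + v i * y) F) := by
  rw [coeff_zero_eq_eval_zero]
  have h := ringHom_lineSec (C.comp MvPolynomial.C) F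
    (fun i => C (MvPolynomial.C (u i)) + C (MvPolynomial.X i) * X)
    ((C.comp MvPolynomial.C) ∘ v)
    ((evalRingHom (0 : MvPolynomial (Fin n) K)).comp (evalRingHom (C (MvPolynomial.C y))))
  refine Eq.trans h ?_
  rw [← MvPolynomial.eval₂_id]
  refine Eq.trans ?_ (MvPolynomial.eval₂_comp_left MvPolynomial.C _ _ F).symm
  congr 1
  · ext1 c; simp
  · ext1 i; simp

theorem derivative_genSec (G : MvPolynomial (Fin n) K) (u v : Fin n → K) :
    derivative (genSec G u v) = genSec (dirDeriv v G) u v :=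
  derivative_lineSec (C.comp MvPolynomial.C) G _ v

theorem X_dvd_eval_genSec_sub (F : MvPolynomial (Fin n) K) (u v : Fin n → K) (y : K) :
    X ∣ (genSec F u v).eval (C (MvPolynomial.C y)) -
      C (MvPolynomial.C (MvPolynomial.eval (fun i => u i + v i * y) F)) := by
  rw [X_dvd_iff, coeff_sub, coeff_zero_eval_genSec, coeff_C_zero, sub_self]

theorem exists_forall_irreducible_planeSec {G : MvPolynomial (Fin n) K} (hG : G.IsHomogeneous d)
    (hirr : Irreducible G) (hd0 : 0 < d) {u v : Fin n → K} (hv : MvPolynomial.eval v G = 1) {y : K}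
    (hy : MvPolynomial.eval (fun i => u i + v i * y) G = 0)
    (hy' : MvPolynomial.eval (fun i => u i + v i * y) (dirDeriv v G) ≠ 0) :
    ∃ P : MvPolynomial (Fin n) K, P ≠ 0 ∧ P.totalDegree ≤ d * (d + 1) * ((2 * d - 1) * d) ∧
      ∀ w, MvPolynomial.eval w P ≠ 0 → Irreducible (planeSec G u v w) := by
  set N := (2 * d - 1) * d + 1 with hN
  obtain ⟨f, hf, -⟩ := exists_map_eq_genSec (d := d) G u v
  have h0 := X_dvd_eval_genSec_sub G u v y
  rw [hy, map_zero, map_zero, sub_zero] at h0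
  have h1 := X_dvd_eval_genSec_sub (dirDeriv v G) u v y
  rw [← derivative_genSec] at h1
  obtain ⟨σ, hσ, hσN⟩ := exists_approx_root (weightSubring K n) f C_C_mem_weightSubring y _ hy'
    (by rwa [hf]) (by rwa [hf]) ((2 * d - 1) * d)
  rw [hf] at hσN
  have hinj : ∀ c, (sysMat d N (σ : (MvPolynomial (Fin n) K)[X])).mulVec c = 0 → c = 0 := by
    intro c hc
    rw [← X_pow_dvd_eval_sysPoly_iff] at hc
    have := eq_zero_of_X_pow_dvd_eval (monic_genSec hG u hv) (natDegree_genSec hG u hv)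
      (biDeg_genSec hG u v) (irreducible_genSec hG hirr u hv).prime (biDeg_sysPoly c)
      (natDegree_sysPoly_lt hd0 c) hσN hc
    ext1 p
    rw [← coeff_coeff_sysPoly c p, this]
    simp
  obtain ⟨ε, hε⟩ := exists_minor_ne_zero _ hinj
  refine ⟨_, hε, ?_, fun w hw => ?_⟩
  · refine (totalDegree_det_le (J := (2 * d - 1) * d) _ fun p r => ?_).trans ?_
    · have hmem : (σ : (MvPolynomial (Fin n) K)[X]) ^ (r.1 : ℕ) * X ^ (r.2 : ℕ) ∈
          weightSubring K n :=
        mul_mem (pow_mem σ.2 _) (pow_mem X_mem_weightSubring _)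
      have h3 := hmem (ε p)
      have h4 := (ε p).2
      refine le_trans h3 ?_
      omega
    · simp
  · have h2 : (planeSec G u v w) =
        (genSec G u v).map (mapRingHom (MvPolynomial.eval w)) := (map_genSec G u v w).symm
    set ψ := (MvPolynomial.eval w : MvPolynomial (Fin n) K →+* K) with hψ
    have hmap : ∀ F : (MvPolynomial (Fin n) K)[X][X],
        (F.map (mapRingHom ψ)).eval ((σ : (MvPolynomial (Fin n) K)[X]).map ψ) =
          (F.eval (σ : (MvPolynomial (Fin n) K)[X])).map ψ := fun F => by
      rw [← coe_mapRingHom, eval_map_apply]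
    refine irreducible_of_sysMat (N := N) (σ := (σ : (MvPolynomial (Fin n) K)[X]).map ψ)
      (monic_planeSec hG u w hv) (natDegree_planeSec hG u w hv) hd0 (biDeg_planeSec hG u v w)
      ?_ ?_ ?_
    · rw [h2, hmap]
      simpa using Polynomial.map_dvd ψ hσN
    · intro hX
      rw [h2, derivative_map, hmap] at hX
      have h5 := dvd_add (hσ.trans (sub_dvd_eval_sub _ _ (derivative (genSec G u v)))) h1
      rw [sub_add_sub_cancel] at h5
      have h6 := Polynomial.map_dvd ψ h5
      rw [map_X, Polynomial.map_sub, dvd_sub_right hX, map_C, hψ, MvPolynomial.eval_C, X_dvd_iff,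
        coeff_C_zero] at h6
      exact hy' h6
    · intro c hc
      rw [← sysMat_map] at hc
      have hdet : (((sysMat d N (σ : (MvPolynomial (Fin n) K)[X])).map ψ).submatrix ε id).det ≠ 0 := by
        have : (((sysMat d N (σ : (MvPolynomial (Fin n) K)[X])).map ψ).submatrix ε id).det =
          ψ ((sysMat d N (σ : (MvPolynomial (Fin n) K)[X])).submatrix ε id).det := by
          rw [RingHom.map_det]
          rfl
        rwa [this]
      refine Matrix.eq_zero_of_mulVec_eq_zero hdet ?_
      ext1 p
      exact congrFun hc (ε p)

end Bertini

end PlaneCurve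

namespace PlaneCurve

open Polynomial

section Separable

variable {κ : Type*} [Field κ] {n d : ℕ}

theorem exists_pderiv_ne_zero (p : ℕ) [Fact p.Prime] [CharP κ p] [IsAlgClosed κ]
    {G : MvPolynomial (Fin n) κ} (hirr : Irreducible G) : ∃ i, MvPolynomial.pderiv i G ≠ 0 := by
  classical
  by_contra! h
  have hp : p.Prime := Fact.out
  have hdvd : ∀ m ∈ G.support, ∀ i, p ∣ m i := by
    intro m hm i
    rcases Nat.eq_zero_or_pos (m i) with h0 | h0
    · simp [h0]
    have h1 := MvPolynomial.coeff_pderiv (i := i) G (m - Finsupp.single i 1)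
    have h2 : m - Finsupp.single i 1 + Finsupp.single i 1 = m := by
      ext j
      by_cases hj : i = j
      · subst hj; simp; omega
      · simp [hj]
    rw [h i, MvPolynomial.coeff_zero, h2] at h1
    have h3 := (mul_eq_zero.1 h1.symm).resolve_left (MvPolynomial.mem_support_iff.1 hm)
    rw [← CharP.cast_eq_zero_iff κ p]
    have h4 : m i = (m - Finsupp.single i 1 : Fin n →₀ ℕ) i + 1 := by
      conv_lhs => rw [← h2]
      simp
    rw [h4]
    push_cast
    exact h3
  have hroot : ∀ c : κ, ∃ b : κ, b ^ p = c := fun c => IsAlgClosed.exists_pow_nat_eq c hp.pos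
  choose b hb using hroot
  have hexp : ∀ m : Fin n →₀ ℕ, m ∈ G.support → ∃ m' : Fin n →₀ ℕ, p • m' = m := by
    intro m hm
    refine ⟨m.mapRange (· / p) (by simp), ?_⟩
    ext i
    simpa using Nat.mul_div_cancel' (hdvd m hm i)
  choose! m' hm' using hexp
  have hpow : G = (∑ m ∈ G.support, MvPolynomial.monomial (m' m) (b (G.coeff m))) ^ p := by
    rw [sum_pow_char]
    conv_lhs => rw [G.as_sum]
    refine Finset.sum_congr rfl fun m hm => ?_
    rw [MvPolynomial.monomial_pow, hb, hm' m hm]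
  rw [hpow] at hirr
  exact not_irreducible_pow hp.ne_one hirr

end Separable

section Choice

variable {k κ : Type*} [Field k] [Fintype k] [Field κ] {n d : ℕ}

theorem dirDeriv_isHomogeneous {G : MvPolynomial (Fin n) k} (hG : G.IsHomogeneous d)
    (v : Fin n → k) : (dirDeriv v G).IsHomogeneous (d - 1) := by
  refine MvPolynomial.IsHomogeneous.sum _ _ _ fun i _ => ?_
  simpa using (MvPolynomial.isHomogeneous_C (Fin n) (v i)).mul hG.pderiv

theorem exists_eval_ne_zero_dirDeriv_ne_zero {G : MvPolynomial (Fin n) k}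
    (hG : G.IsHomogeneous d) (hG0 : G ≠ 0) {i : Fin n} (hi : MvPolynomial.pderiv i G ≠ 0)
    (hq : d + 1 < Fintype.card k) :
    ∃ v : Fin n → k, MvPolynomial.eval v G ≠ 0 ∧ dirDeriv v G ≠ 0 := by
  obtain ⟨m, hm⟩ := MvPolynomial.ne_zero_iff.1 hi
  set L : MvPolynomial (Fin n) k :=
    ∑ j, MvPolynomial.C ((MvPolynomial.pderiv j G).coeff m) * MvPolynomial.X j with hL
  have hev : ∀ v, MvPolynomial.eval v L = (dirDeriv v G).coeff m := by
    intro v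
    simp [hL, dirDeriv, MvPolynomial.coeff_sum, MvPolynomial.coeff_C_mul, mul_comm]
  have hL0 : L ≠ 0 := by
    intro h0
    have := hev (Pi.single i 1)
    rw [h0, map_zero, dirDeriv, MvPolynomial.coeff_sum, Finset.sum_eq_single i] at this
    · simp at this
      exact hm this.symm
    · intro j _ hj
      simp [hj]
    · simp
  have hLd : L.totalDegree ≤ 1 := by
    refine MvPolynomial.totalDegree_finsetSum_le fun j _ => ?_
    refine (MvPolynomial.totalDegree_mul _ _).trans ?_
    simp
  obtain ⟨v, hv⟩ := exists_eval_ne_zero (RingHom.id k) (mul_ne_zero hG0 hL0)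
    (lt_of_le_of_lt ((MvPolynomial.totalDegree_mul _ _).trans
      (add_le_add hG.totalDegree_le hLd)) hq)
  rw [map_mul] at hv
  refine ⟨v, left_ne_zero_of_mul hv, fun h0 => right_ne_zero_of_mul hv ?_⟩
  have := hev v
  rw [h0, MvPolynomial.coeff_zero] at this
  exact this

theorem map_dirDeriv (φ : k →+* κ) (v : Fin n → k) (G : MvPolynomial (Fin n) k) :
    MvPolynomial.map φ (dirDeriv v G) = dirDeriv (φ ∘ v) (MvPolynomial.map φ G) := by
  simp [dirDeriv, MvPolynomial.pderiv_map]

theorem exists_eval_derivative_ne_zero [IsAlgClosed κ] {g h : Polynomial κ} (hg : g.Monic)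
    (hgh : ¬ g ∣ h ^ g.natDegree) : ∃ y, g.eval y = 0 ∧ h.eval y ≠ 0 := by
  by_contra! H
  have hs := IsAlgClosed.splits g
  apply hgh
  conv_lhs => rw [hs.eq_prod_roots_of_monic hg]
  rw [hs.natDegree_eq_card_roots]
  have := Multiset.prod_dvd_prod_of_dvd (S := g.roots) (fun a => X - C a) (fun _ => h) fun a ha =>
    dvd_iff_isRoot.2 (H a (isRoot_of_mem_roots ha))
  simpa using this

theorem exists_simple_root [IsAlgClosed κ] (φ : k →+* κ) {G : MvPolynomial (Fin n) k}
    (hG : G.IsHomogeneous d) (hd0 : 0 < d) (hirr : Irreducible (MvPolynomial.map φ G))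
    {v : Fin n → k} (hv : MvPolynomial.eval v G = 1) (hD : dirDeriv v G ≠ 0)
    (hq : d * (d - 1) < Fintype.card k) :
    ∃ (u : Fin n → k) (y : κ),
      MvPolynomial.eval (fun i => φ (u i) + φ (v i) * y) (MvPolynomial.map φ G) = 0 ∧
      MvPolynomial.eval (fun i => φ (u i) + φ (v i) * y)
        (dirDeriv (φ ∘ v) (MvPolynomial.map φ G)) ≠ 0 := by
  have hG0 : G ≠ 0 := by rintro rfl; simp at hirr
  have hDh := dirDeriv_isHomogeneous hG v
  have hnd : ¬ G ∣ dirDeriv v G ^ d := by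
    intro h
    have h1 := map_dvd (MvPolynomial.map φ) h
    rw [map_pow] at h1
    have h2 := hirr.prime.dvd_of_dvd_pow h1
    have h3 : MvPolynomial.map φ (dirDeriv v G) ≠ 0 := fun h0 =>
      hD (MvPolynomial.map_injective φ φ.injective (by rw [h0, map_zero]))
    have h4 := MvPolynomial.totalDegree_le_of_dvd_of_isDomain h2 h3
    rw [(hG.map φ).totalDegree hirr.ne_zero, (hDh.map φ).totalDegree h3] at h4
    omega
  have hDd : (dirDeriv v G ^ d).IsHomogeneous (d * (d - 1)) := by
    rw [mul_comm]; exact hDh.pow d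
  obtain ⟨P, hP0, hPd, hP⟩ := exists_forall_not_planeSec_dvd hG hv hDd hnd 0
  obtain ⟨w, hw⟩ := exists_eval_ne_zero (RingHom.id k) hP0 (hPd.trans_lt hq)
  have hfm := monic_planeSec hG 0 w hv
  have hr := hP w hw
  rw [← modByMonic_eq_zero_iff_dvd hfm] at hr
  obtain ⟨i, hi⟩ : ∃ i, (planeSec (dirDeriv v G ^ d) 0 v w %ₘ planeSec G 0 v w).coeff i ≠ 0 := by
    by_contra! h
    exact hr (Polynomial.ext h)
  have hbd := BiDeg.modByMonic hfm (natDegree_planeSec hG 0 w hv) (biDeg_planeSec hG 0 v w)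
    (biDeg_planeSec hDd 0 v w) i hi
  obtain ⟨t, ht⟩ := exists_eval_ne_zero_of_natDegree_lt_card _ hi (by
    rw [Cardinal.mk_fintype]
    exact_mod_cast (by omega : _ < Fintype.card k))
  set g := (planeSec G 0 v w).map (evalRingHom t) with hg
  have hgm : g.Monic := hfm.map _
  have hgd : g.natDegree = d := by
    rw [hg, hfm.natDegree_map, natDegree_planeSec hG 0 w hv]
  have hndvd : ¬ g ∣ ((planeSec (dirDeriv v G) 0 v w).map (evalRingHom t)) ^ d := by
    rw [← Polynomial.map_pow, ← planeSec_pow, ← modByMonic_eq_zero_iff_dvd hgm, hg,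
      ← map_modByMonic _ hfm]
    intro h0
    apply ht
    have := congrArg (coeff · i) h0
    simpa using this
  rw [← map_dvd_map' φ, Polynomial.map_pow] at hndvd
  obtain ⟨y, hy, hy'⟩ := exists_eval_derivative_ne_zero (hgm.map φ)
    (h := ((planeSec (dirDeriv v G) 0 v w).map (evalRingHom t)).map φ) (by
      rwa [hgm.natDegree_map, hgd])
  have key : ∀ F : MvPolynomial (Fin n) k,
      (((planeSec F 0 v w).map (evalRingHom t)).map φ).eval y =
      MvPolynomial.eval (fun i => φ (w i * t) + φ (v i) * y) (MvPolynomial.map φ F) := by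
    intro F
    rw [planeSec, map_lineSec, map_lineSec, eval_lineSec, MvPolynomial.eval_map]
    congr 1
    · ext x; simp
    · ext i; simp
  rw [hg, key] at hy
  rw [key, map_dirDeriv] at hy'
  exact ⟨fun i => w i * t, y, hy, hy'⟩

end Choice

end PlaneCurve

namespace PlaneCurve

open Polynomial

section Assembly

variable {k : Type*} [Field k] [Fintype k] {n d e : ℕ}

theorem exists_nonsingular_of_eval_eq_one {κ : Type*} [Field κ] [IsAlgClosed κ] [Algebra k κ]
    {G H : MvPolynomial (Fin n) k} (hG : G.IsHomogeneous d) (hd0 : 0 < d)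
    (hirr : Irreducible (MvPolynomial.map (algebraMap k κ) G)) (hH : H.IsHomogeneous e)
    (hGH : ¬ G ∣ H) {v : Fin n → k} (hv : MvPolynomial.eval v G = 1) (hD : dirDeriv v G ≠ 0)
    (hq : 5 * d ^ 4 + d * e < Fintype.card k)
    (hq' : ((d : ℝ) - 1) * (d - 2) * √(Fintype.card k : ℝ) + (5 * (d : ℝ) ^ 4 + d * (d + e - 1)) <
      Fintype.card k) :
    ∃ x : Fin n → k, MvPolynomial.eval x G = 0 ∧
      (∃ i, MvPolynomial.eval x (MvPolynomial.pderiv i G) ≠ 0) ∧ MvPolynomial.eval x H ≠ 0 := by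
  set φ := algebraMap k κ with hφ
  have hq1 : d * (d - 1) < Fintype.card k := by
    obtain ⟨d, rfl⟩ := Nat.exists_eq_add_of_lt hd0
    simp only [zero_add, Nat.add_sub_cancel] at hq ⊢
    refine lt_of_le_of_lt ?_ hq
    have : (d + 1) * d ≤ 5 * (d + 1) ^ 4 := by nlinarith [Nat.zero_le (d ^ 4), Nat.zero_le (d ^ 3), Nat.zero_le (d^2)]
    omega
  obtain ⟨u, y, hy, hy'⟩ := exists_simple_root φ hG hd0 hirr hv hD hq1
  have hvκ : MvPolynomial.eval (φ ∘ v) (MvPolynomial.map φ G) = 1 := by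
    rw [MvPolynomial.eval_map, ← MvPolynomial.eval₂_comp, hv, map_one]
  obtain ⟨P, hP0, hPd, hP⟩ := exists_forall_irreducible_planeSec (hG.map φ) hirr hd0
    (u := φ ∘ u) hvκ hy hy'
  obtain ⟨Q, hQ0, hQd, hQ⟩ := exists_forall_not_planeSec_dvd hG hv hH hGH u
  have hQ0' : MvPolynomial.map φ Q ≠ 0 := fun h0 =>
    hQ0 (MvPolynomial.map_injective φ φ.injective (by rw [h0, map_zero]))
  obtain ⟨w, hw⟩ := exists_eval_ne_zero φ (mul_ne_zero hP0 hQ0') (by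
    refine lt_of_le_of_lt ?_ hq
    refine (MvPolynomial.totalDegree_mul _ _).trans (add_le_add (hPd.trans ?_)
      ((Finset.sup_mono (MvPolynomial.support_map_subset φ Q)).trans (hQd.trans ?_)))
    · obtain ⟨d, rfl⟩ := Nat.exists_eq_add_of_lt hd0
      simp only [zero_add]
      rw [show 2 * (d + 1) - 1 = 2 * d + 1 by omega]
      nlinarith [Nat.zero_le (d ^ 4), Nat.zero_le (d ^ 3), Nat.zero_le (d^2)]
    · exact Nat.le_mul_of_pos_left e hd0)
  rw [map_mul] at hw
  set f := planeSec G u v w with hf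
  have hfm : f.Monic := monic_planeSec hG u w hv
  have hfd : f.natDegree = d := natDegree_planeSec hG u w hv
  have hfb : BiDeg d f := biDeg_planeSec hG u v w
  have hirrκ : Irreducible (f.map (mapRingHom φ)) := by
    rw [hf, map_planeSec]
    exact hP _ (left_ne_zero_of_mul hw)
  have hirrf : Irreducible f := hfm.irreducible_of_irreducible_map _ _ hirrκ
  have hndvd : ¬ f ∣ planeSec H u v w := by
    refine hQ w fun h0 => right_ne_zero_of_mul hw ?_
    rw [MvPolynomial.eval_map, ← MvPolynomial.eval₂_comp, h0, map_zero]
  have hder : derivative f ≠ 0 := by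
    intro h0
    have h1 := derivative_planeSec (MvPolynomial.map φ G) (φ ∘ u) (φ ∘ v) (φ ∘ w)
    rw [← map_planeSec, ← hf, derivative_map, h0, Polynomial.map_zero] at h1
    have h2 := evalEval_planeSec (dirDeriv (φ ∘ v) (MvPolynomial.map φ G)) (φ ∘ u) (φ ∘ v) (φ ∘ w) 0 y
    rw [← h1] at h2
    apply hy'
    simpa using h2.symm
  obtain ⟨hfin, hcard⟩ := finite_and_ncard_zeros_le hfm hfd hfb hirrf (biDeg_planeSec hH u v w) hndvd
  have hmain := le_ncard_disc_ne_zero hfm hfd hd0 hfb hder hirrκ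
  have hdisc := natDegree_disc_le hfm hfd hfb
  rw [Nat.card_eq_fintype_card] at hmain
  have hlt : {P : k × k | f.evalEval P.1 P.2 = 0 ∧ (planeSec H u v w).evalEval P.1 P.2 = 0}.ncard <
      {P : k × k | f.evalEval P.1 P.2 = 0 ∧ (disc f).eval P.1 ≠ 0}.ncard := by
    have h1 : ((2 * ((d - 1) * (d - 2) / 2) : ℕ) : ℝ) ≤ ((d : ℝ) - 1) * (d - 2) := by
      refine (Nat.cast_le.2 (Nat.mul_div_le _ _)).trans ?_
      rcases Nat.lt_or_ge d 2 with h | h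
      · obtain rfl : d = 1 := by omega
        simp
      · rw [Nat.cast_mul, Nat.cast_sub hd0, Nat.cast_sub h]
        norm_num
    have h2 := mul_le_mul_of_nonneg_right h1 (Real.sqrt_nonneg (Fintype.card k : ℝ))
    have h3 : ((d * (disc f).natDegree : ℕ) : ℝ) ≤ (d : ℝ) * (d * (d - 1)) := by
      refine (Nat.cast_le.2 (Nat.mul_le_mul_left d hdisc)).trans ?_
      rw [Nat.cast_mul, Nat.cast_mul, Nat.cast_sub hd0, Nat.cast_one]
    have h4 : ({P : k × k | f.evalEval P.1 P.2 = 0 ∧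
        (planeSec H u v w).evalEval P.1 P.2 = 0}.ncard : ℝ) ≤ e * d := by exact_mod_cast hcard
    have h5 : (1 : ℝ) ≤ d := by exact_mod_cast hd0
    have h6 : (d : ℝ) ^ 3 ≤ (d : ℝ) ^ 4 := pow_le_pow_right₀ h5 (by norm_num)
    have h7 : (0 : ℝ) ≤ (d : ℝ) ^ 4 := by positivity
    have h8 : (d : ℝ) ≤ (d : ℝ) ^ 2 := by nlinarith
    rw [← Nat.cast_lt (α := ℝ)]
    refine lt_of_le_of_lt h4 (lt_of_lt_of_le ?_ hmain)
    nlinarith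
  obtain ⟨⟨a, b⟩, ⟨h1, h2⟩, h3⟩ := Set.exists_mem_notMem_of_ncard_lt_ncard hlt hfin
  have h4 : (planeSec H u v w).evalEval a b ≠ 0 := fun h => h3 ⟨h1, h⟩
  have h5 : (derivative f).evalEval a b ≠ 0 := by
    obtain ⟨r, s, hrs⟩ := exists_disc_eq hfm
    intro h0
    apply h2
    have := congrArg (evalEval a b) hrs
    simpa [evalEval_add, evalEval_mul, evalEval_C, h0, show f.evalEval a b = 0 from h1] using this
  rw [hf, evalEval_planeSec] at h1
  rw [evalEval_planeSec] at h4
  rw [hf, derivative_planeSec, evalEval_planeSec] at h5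
  refine ⟨_, h1, ?_, h4⟩
  by_contra! hall
  apply h5
  rw [dirDeriv, map_sum]
  refine Finset.sum_eq_zero fun i _ => ?_
  rw [map_mul, hall i, mul_zero]

theorem mul_sqrt_add_lt_of_sq_lt {α β q : ℝ} (hβ : 0 ≤ β)
    (h : 1 / 4 * (α + √(α ^ 2 + 4 * β)) ^ 2 < q) : α * √q + β < q := by
  set t := √(α ^ 2 + 4 * β)
  have ht : t ^ 2 = α ^ 2 + 4 * β := Real.sq_sqrt (by positivity)
  have hαt : α ≤ t := Real.le_sqrt_of_sq_le (by linarith)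
  have hq : 0 ≤ q := le_trans (by positivity) h.le
  have hs : √q ^ 2 = q := Real.sq_sqrt hq
  have hlt : (α + t) / 2 < √q := Real.lt_sqrt_of_sq_lt (by linarith)
  nlinarith

theorem exists_nonsingular {κ : Type*} [Field κ] [IsAlgClosed κ] [Algebra k κ]
    {G H : MvPolynomial (Fin n) k} (hG : G.IsHomogeneous d) (hd0 : 0 < d)
    (hirr : Irreducible (MvPolynomial.map (algebraMap k κ) G)) (hH : H.IsHomogeneous e)
    (hGH : ¬ G ∣ H) (hq : 5 * d ^ 4 + d * e < Fintype.card k)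
    (hq' : ((d : ℝ) - 1) * (d - 2) * √(Fintype.card k : ℝ) + (5 * (d : ℝ) ^ 4 + d * (d + e - 1)) <
      Fintype.card k) :
    ∃ x : Fin n → k, MvPolynomial.eval x G = 0 ∧
      (∃ i, MvPolynomial.eval x (MvPolynomial.pderiv i G) ≠ 0) ∧ MvPolynomial.eval x H ≠ 0 := by
  set φ := algebraMap k κ with hφ
  obtain ⟨p, hp⟩ := CharP.exists k
  have : Fact p.Prime := ⟨CharP.char_is_prime k p⟩
  have : CharP κ p := charP_of_injective_algebraMap φ.injective p
  obtain ⟨i, hi⟩ := exists_pderiv_ne_zero p hirr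
  have hi' : MvPolynomial.pderiv i G ≠ 0 := by
    rw [MvPolynomial.pderiv_map] at hi
    exact fun h => hi (by rw [h, map_zero])
  have hG0 : G ≠ 0 := by rintro rfl; simp at hirr
  obtain ⟨v, hv, hD⟩ := exists_eval_ne_zero_dirDeriv_ne_zero hG hG0 hi' (by
    obtain ⟨d, rfl⟩ := Nat.exists_eq_add_of_lt hd0
    simp only [zero_add] at hq ⊢
    refine lt_of_le_of_lt ?_ hq
    nlinarith [Nat.zero_le (d ^ 4), Nat.zero_le (d ^ 3), Nat.zero_le (d^2)])
  set c := (MvPolynomial.eval v G)⁻¹ with hc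
  have hc0 : c ≠ 0 := inv_ne_zero hv
  have hunit : IsUnit (MvPolynomial.C c : MvPolynomial (Fin n) k) :=
    (IsUnit.mk0 c hc0).map MvPolynomial.C
  have hG' : (MvPolynomial.C c * G).IsHomogeneous d := by
    simpa using (MvPolynomial.isHomogeneous_C (Fin n) c).mul hG
  have hirr' : Irreducible (MvPolynomial.map φ (MvPolynomial.C c * G)) := by
    rw [map_mul]
    exact (irreducible_isUnit_mul (hunit.map _)).2 hirr
  have hGH' : ¬ MvPolynomial.C c * G ∣ H := fun h => hGH ((Dvd.intro_left _ rfl).trans h)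
  have hD' : dirDeriv v (MvPolynomial.C c * G) = MvPolynomial.C c * dirDeriv v G := by
    rw [dirDeriv, dirDeriv, Finset.mul_sum]
    refine Finset.sum_congr rfl fun j _ => ?_
    rw [MvPolynomial.pderiv_C_mul, mul_left_comm]
  obtain ⟨x, h1, ⟨j, h2⟩, h3⟩ := exists_nonsingular_of_eval_eq_one hG' hd0 hirr' hH hGH'
    (v := v) (by simp [hc, hv]) (by rw [hD']; exact mul_ne_zero hunit.ne_zero hD) hq hq'
  refine ⟨x, ?_, ⟨j, ?_⟩, h3⟩
  · simpa [hc0] using h1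
  · rw [MvPolynomial.pderiv_C_mul] at h2
    simpa [hc0] using h2

end Assembly

end PlaneCurve

open MvPolynomial

/-- **Theorem 2.** Let `G` be an absolutely irreducible homogeneous polynomial of degree
`d ≥ 1` over the finite field `𝔽_q` in `n ≥ 3` variables, and `H` a homogeneous polynomial
of degree `e ≥ 1` not divisible by `G`.  With `α = (d-1)(d-2)` and
`β = 5 d^{13/3} + d(d+e-1)`, if `q > (1/4)(α + √(α² + 4β))²` then there is a point
`x ∈ 𝔽_q^n` with `G(x) = 0`, `∇G(x) ≠ 0` and `H(x) ≠ 0`. -/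
theorem nonsingular_zero_of_G_not_zero_of_H
    {K : Type*} [Field K] [Fintype K] {n : ℕ} (hn : 3 ≤ n)
    {d e : ℕ} (hd : 1 ≤ d) (he : 1 ≤ e)
    (G H : MvPolynomial (Fin n) K)
    (hGdeg : G.totalDegree = d) (hGhom : G.IsHomogeneous d)
    (hHdeg : H.totalDegree = e) (hHhom : H.IsHomogeneous e)
    (hGirr : Irreducible (MvPolynomial.map (algebraMap K (AlgebraicClosure K)) G))
    (hGH : ¬ G ∣ H)
    (hq : (1 / 4 : ℝ) *
        (((d : ℝ) - 1) * ((d : ℝ) - 2) +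
          Real.sqrt ((((d : ℝ) - 1) * ((d : ℝ) - 2)) ^ 2 +
            4 * (5 * (d : ℝ) ^ ((13 : ℝ) / 3) + (d : ℝ) * ((d : ℝ) + (e : ℝ) - 1)))) ^ 2
        < (Fintype.card K : ℝ)) :
    ∃ x : Fin n → K,
      eval x G = 0 ∧ (∃ i : Fin n, eval x (pderiv i G) ≠ 0) ∧ eval x H ≠ 0 := by
  have hd1 : (1 : ℝ) ≤ d := by exact_mod_cast hd
  have he0 : (0 : ℝ) ≤ e := Nat.cast_nonneg e
  have hα : (0 : ℝ) ≤ ((d : ℝ) - 1) * ((d : ℝ) - 2) := by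
    rcases Nat.lt_or_ge d 2 with h | h
    · obtain rfl : d = 1 := by omega
      simp
    · have : (2 : ℝ) ≤ d := by exact_mod_cast h
      exact mul_nonneg (by linarith) (by linarith)
  have hpow : (d : ℝ) ^ 4 ≤ (d : ℝ) ^ ((13 : ℝ) / 3) := by
    rw [← Real.rpow_natCast]
    exact Real.rpow_le_rpow_of_exponent_le hd1 (by norm_num)
  have hd4 : (0 : ℝ) ≤ (d : ℝ) ^ 4 := by positivity
  have hlin : (0 : ℝ) ≤ (d : ℝ) * ((d : ℝ) + (e : ℝ) - 1) :=
    mul_nonneg (by linarith) (by linarith)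
  have hmain := PlaneCurve.mul_sqrt_add_lt_of_sq_lt (by linarith) hq
  have hmain' := lt_of_le_of_lt (add_le_add_right (add_le_add_left
    (mul_le_mul_of_nonneg_left hpow (by norm_num : (0 : ℝ) ≤ 5)) _) _) hmain
  refine PlaneCurve.exists_nonsingular hGhom hd hGirr hHhom hGH ?_ hmain'
  have hs := mul_nonneg hα (Real.sqrt_nonneg (Fintype.card K : ℝ))
  have hsq : (d : ℝ) ≤ (d : ℝ) * d := le_mul_of_one_le_left (by linarith) hd1
  rw [← Nat.cast_lt (α := ℝ)]
  push_cast
  linarith
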